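/- arXiv:1703.07003 — 2 statements merged into one kernel-verified Lean document; each statement's English description precedes it below -/
import Mathlib

section
/- Let X be a one-ended proper CAT(0) metric space. Then X has semistable fundamental group at infinity (i.e. any two proper rays in X are properly homotopic) if and only if any two geodesic rays in X are properly homotopic. -/
open Set Filter Topology
open scoped NNReal unitInterval

/-- A geodesic metric space: any two points are joined by a geodesic segment
(a curve along which distances are realized). -/
def IsGeodesicSpace (X : Type*) [MetricSpace X] : Prop :=
  ∀ x y : X, ∃ γ : ℝ → X, γ 0 = x ∧ γ (dist x y) = y ∧
    ∀ s ∈ Icc (0 : ℝ) (dist x y), ∀ t ∈ Icc (0 : ℝ) (dist x y),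
      dist (γ s) (γ t) = |s - t|

/-- A CAT(0) space: a geodesic metric space in which every geodesic triangle satisfies the
CAT(0) comparison inequality; for geodesic spaces this is equivalent to the CN inequality of
Bruhat–Tits (comparison of distances to midpoints with the Euclidean comparison triangle). -/
def IsCAT0Space (X : Type*) [MetricSpace X] : Prop :=
  IsGeodesicSpace X ∧
    ∀ x y m z : X, dist x m = dist x y / 2 → dist y m = dist x y / 2 →
      dist z m ^ 2 ≤ dist z x ^ 2 / 2 + dist z y ^ 2 / 2 - dist x y ^ 2 / 4

/-- A proper ray in `X`: a continuous map `[0,∞) → X` such that preimages of compact sets are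
compact. -/
structure ProperRay (X : Type*) [MetricSpace X] where
  toFun : ℝ≥0 → X
  continuous_toFun : Continuous toFun
  isProper : ∀ K : Set X, IsCompact K → IsCompact (toFun ⁻¹' K)

/-- A geodesic ray in `X`: an isometric embedding of `[0,∞)` into `X`. -/
structure GeodesicRay (X : Type*) [MetricSpace X] where
  toFun : ℝ≥0 → X
  isometry : ∀ s t : ℝ≥0, dist (toFun s) (toFun t) = |(s : ℝ) - (t : ℝ)|

/-- Two rays `[0,∞) → X` are properly homotopic if there is a continuous proper homotopy
`H : [0,∞) × [0,1] → X` between them. -/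
def ProperlyHomotopic {X : Type*} [MetricSpace X] (c c' : ℝ≥0 → X) : Prop :=
  ∃ H : ℝ≥0 × I → X, Continuous H ∧
    (∀ K : Set X, IsCompact K → IsCompact (H ⁻¹' K)) ∧
    (∀ t, H (t, 0) = c t) ∧ (∀ t, H (t, 1) = c' t)

/-- `X` has exactly one end: it is noncompact and, for every compact `K`, all points
sufficiently far out lie in a single connected component of `X ∖ K`. -/
def HasOneEnd (X : Type*) [MetricSpace X] : Prop :=
  ¬ IsCompact (univ : Set X) ∧
    ∀ K : Set X, IsCompact K → ∃ K' : Set X, IsCompact K' ∧ K ⊆ K' ∧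
      ∀ x ∈ K'ᶜ, ∀ y ∈ K'ᶜ, connectedComponentIn Kᶜ x = connectedComponentIn Kᶜ y

/-- Two geodesic rays are asymptotic (boundedly close). -/
def AsymptoticRays {X : Type*} [MetricSpace X] (γ γ' : GeodesicRay X) : Prop :=
  ∃ C : ℝ, ∀ t, dist (γ.toFun t) (γ'.toFun t) ≤ C

/-- The compactification `X̂ = X ∪ ∂X` of a proper CAT(0) space by its visual boundary with
the cone topology: a compact metrizable space containing `X` as an open dense subspace, whose
boundary points correspond bijectively to asymptoty classes of geodesic rays, each geodesic
ray converging to its point at infinity. -/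
structure BoundaryCompactification (X : Type*) [MetricSpace X] where
  carrier : Type
  [topSpace : TopologicalSpace carrier]
  compactSpace : CompactSpace carrier
  metrizable : TopologicalSpace.MetrizableSpace carrier
  incl : X → carrier
  isEmbedding : Topology.IsEmbedding incl
  dense_range : DenseRange incl
  isOpen_range : IsOpen (range incl)
  endpoint : GeodesicRay X → carrier
  endpoint_not_mem : ∀ γ, endpoint γ ∉ range incl
  tendsto_endpoint : ∀ γ, Tendsto (incl ∘ γ.toFun) atTop (𝓝 (endpoint γ))
  endpoint_eq_iff : ∀ γ γ', endpoint γ = endpoint γ' ↔ AsymptoticRays γ γ'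
  endpoint_surj : ∀ p, p ∉ range incl → ∃ γ, endpoint γ = p

attribute [instance] BoundaryCompactification.topSpace

/-- The visual boundary `∂X`, as a subset of the compactification. -/
def BoundaryCompactification.boundary {X : Type*} [MetricSpace X]
    (B : BoundaryCompactification X) : Set B.carrier :=
  (range B.incl)ᶜ

/-- A ray `c : [0,∞) → X` ends at the point `p ∈ ∂X` if `c` extends continuously to
`[0,∞]` sending `∞` to `p`, i.e. `c` converges to `p` in `X̂`. -/
def BoundaryCompactification.EndsAt {X : Type*} [MetricSpace X]
    (B : BoundaryCompactification X) (c : ℝ≥0 → X) (p : B.carrier) : Prop :=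
  p ∈ B.boundary ∧ Tendsto (B.incl ∘ c) atTop (𝓝 p)

theorem nonpos_of_midpoint_convex {g : ℝ → ℝ} (hc : ContinuousOn g (Icc 0 1))
    (hm : ∀ s ∈ Icc (0 : ℝ) 1, ∀ t ∈ Icc (0 : ℝ) 1, g ((s + t) / 2) ≤ (g s + g t) / 2)
    (h0 : g 0 ≤ 0) (h1 : g 1 ≤ 0) {t : ℝ} (ht : t ∈ Icc (0 : ℝ) 1) : g t ≤ 0 := by
  obtain ⟨m, hmI, hmax⟩ := isCompact_Icc.exists_isMaxOn (nonempty_Icc.2 zero_le_one) hc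
  have hmax' : ∀ s ∈ Icc (0 : ℝ) 1, g s ≤ g m := fun s hs => hmax hs
  by_contra! hpos
  have hmpos : 0 < g m := hpos.trans_le (hmax' t ht)
  have hS : IsCompact (Icc (0 : ℝ) 1 ∩ g ⁻¹' {g m}) :=
    isCompact_Icc.of_isClosed_subset
      (hc.preimage_isClosed_of_isClosed isClosed_Icc isClosed_singleton) inter_subset_left
  obtain ⟨a, ⟨haI, hag⟩, hleast⟩ := hS.exists_isLeast ⟨m, hmI, rfl⟩
  have hag : g a = g m := hag
  have ha0 : 0 < a := haI.1.lt_of_ne (by rintro rfl; linarith)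
  have ha1 : a < 1 := haI.2.lt_of_ne (by rintro rfl; linarith)
  set δ := min a (1 - a) with hδ
  have hδ0 : 0 < δ := lt_min ha0 (by linarith)
  have hδa : δ ≤ a := min_le_left _ _
  have hδb : δ ≤ 1 - a := min_le_right _ _
  have hl : a - δ ∈ Icc (0 : ℝ) 1 := ⟨by linarith, by linarith⟩
  have hr : a + δ ∈ Icc (0 : ℝ) 1 := ⟨by linarith, by linarith⟩
  have hmid := hm _ hl _ hr
  rw [show (a - δ + (a + δ)) / 2 = a by ring] at hmid
  have h2 : g (a - δ) ≠ g m := fun h => by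
    have := hleast ⟨hl, h⟩
    linarith
  have h3 := lt_of_le_of_ne (hmax' _ hl) h2
  have h4 := hmax' _ hr
  linarith

section CAT0

variable {X : Type*} [MetricSpace X]

/-- An affinely parametrized geodesic segment on `[0,1]`. -/
def IsAffineGeodesic (c : ℝ → X) : Prop :=
  ∀ s ∈ Icc (0 : ℝ) 1, ∀ t ∈ Icc (0 : ℝ) 1, dist (c s) (c t) = |s - t| * dist (c 0) (c 1)

theorem IsGeodesicSpace.exists_isAffineGeodesic (h : IsGeodesicSpace X) (x y : X) :
    ∃ c : ℝ → X, c 0 = x ∧ c 1 = y ∧ IsAffineGeodesic c := by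
  obtain ⟨γ, h0, h1, hγ⟩ := h x y
  refine ⟨fun t => γ (t * dist x y), by simpa using h0, by simpa using h1, ?_⟩
  intro s hs t ht
  have hmem : ∀ u ∈ Icc (0 : ℝ) 1, u * dist x y ∈ Icc 0 (dist x y) := fun u hu =>
    ⟨mul_nonneg hu.1 dist_nonneg, mul_le_of_le_one_left dist_nonneg hu.2⟩
  simp only [zero_mul, one_mul, h0, h1]
  rw [hγ _ (hmem s hs) _ (hmem t ht), ← sub_mul, abs_mul, abs_of_nonneg (dist_nonneg (x := x))]

theorem IsCAT0Space.dist_midpoint_le (h : IsCAT0Space X) {x y y' m m' : X}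
    (h1 : dist x m = dist x y / 2) (h2 : dist y m = dist x y / 2)
    (h3 : dist x m' = dist x y' / 2) (h4 : dist y' m' = dist x y' / 2) :
    dist m m' ≤ dist y y' / 2 := by
  have e1 := h.2 x y m m' h1 h2
  have e2 := h.2 x y' m' y h3 h4
  rw [dist_comm m' x, h3, dist_comm m' y] at e1
  rw [dist_comm y x] at e2
  rw [dist_comm m m']
  have := dist_nonneg (x := y) (y := y')
  nlinarith [dist_nonneg (x := m') (y := m)]

theorem IsAffineGeodesic.continuousOn {c : ℝ → X} (hc : IsAffineGeodesic c) :
    ContinuousOn c (Icc 0 1) := by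
  have : LipschitzOnWith (Real.toNNReal (dist (c 0) (c 1))) c (Icc 0 1) := by
    refine LipschitzOnWith.of_dist_le_mul fun s hs t ht => ?_
    rw [hc s hs t ht, Real.coe_toNNReal _ dist_nonneg, Real.dist_eq, mul_comm]
  exact this.continuousOn

theorem IsAffineGeodesic.dist_mid {c : ℝ → X} (hc : IsAffineGeodesic c) {s t : ℝ}
    (hs : s ∈ Icc (0 : ℝ) 1) (ht : t ∈ Icc (0 : ℝ) 1) :
    dist (c s) (c ((s + t) / 2)) = dist (c s) (c t) / 2 := by
  have hm : (s + t) / 2 ∈ Icc (0 : ℝ) 1 := ⟨by linarith [hs.1, ht.1], by linarith [hs.2, ht.2]⟩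
  rw [hc s hs _ hm, hc s hs t ht, show s - (s + t) / 2 = (s - t) / 2 by ring, abs_div]
  norm_num
  ring

theorem IsCAT0Space.dist_le_of_isAffineGeodesic (h : IsCAT0Space X) {c c' : ℝ → X}
    (hc : IsAffineGeodesic c) (hc' : IsAffineGeodesic c') {t : ℝ} (ht : t ∈ Icc (0 : ℝ) 1) :
    dist (c t) (c' t) ≤ (1 - t) * dist (c 0) (c' 0) + t * dist (c 1) (c' 1) := by
  have key := nonpos_of_midpoint_convex
    (g := fun t => dist (c t) (c' t) - ((1 - t) * dist (c 0) (c' 0) + t * dist (c 1) (c' 1)))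
    ?_ ?_ (by simp) (by simp) ht
  · linarith
  · exact (continuous_dist.comp_continuousOn (hc.continuousOn.prodMk hc'.continuousOn)).sub
      (by fun_prop)
  · intro s hs t ht
    obtain ⟨e, he0, he1, he⟩ := h.1.exists_isAffineGeodesic (c s) (c' t)
    have h01 : (0 : ℝ) ∈ Icc (0 : ℝ) 1 := by simp
    have h11 : (1 : ℝ) ∈ Icc (0 : ℝ) 1 := by simp
    have a1 := he.dist_mid h01 h11
    have a2 := he.dist_mid h11 h01
    have b1 := hc.dist_mid hs ht
    have b2 := hc.dist_mid ht hs
    have d1 := hc'.dist_mid hs ht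
    have d2 := hc'.dist_mid ht hs
    rw [add_comm t s, dist_comm (c t) (c s)] at b2
    rw [add_comm t s] at d2
    rw [dist_comm (c' s) (c' t)] at d1
    rw [he0, he1] at a1 a2
    rw [add_comm (1 : ℝ) 0, dist_comm (c' t) (c s)] at a2
    have k1 := h.dist_midpoint_le b1 b2 a1 a2
    rw [dist_comm (c s) (c' t)] at a1 a2
    have k2 := h.dist_midpoint_le a2 a1 d2 d1
    have := dist_triangle (c ((s + t) / 2)) (e ((0 + 1) / 2)) (c' ((s + t) / 2))
    linarith

theorem IsCAT0Space.dist_le_of_unitSpeed (h : IsCAT0Space X) {f g : ℝ → X} {K : ℝ}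
    (h0 : f 0 = g 0)
    (hf : ∀ s ∈ Icc (0 : ℝ) K, ∀ t ∈ Icc (0 : ℝ) K, dist (f s) (f t) = |s - t|)
    (hg : ∀ s ∈ Icc (0 : ℝ) K, ∀ t ∈ Icc (0 : ℝ) K, dist (g s) (g t) = |s - t|)
    {s : ℝ} (hs : s ∈ Icc (0 : ℝ) K) : dist (f s) (g s) * K ≤ s * dist (f K) (g K) := by
  have hK : 0 ≤ K := hs.1.trans hs.2
  have aux : ∀ e : ℝ → X, (∀ s ∈ Icc (0 : ℝ) K, ∀ t ∈ Icc (0 : ℝ) K, dist (e s) (e t) = |s - t|) →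
      IsAffineGeodesic fun t => e (t * K) := by
    intro e he s hs t ht
    have hmem : ∀ u ∈ Icc (0 : ℝ) 1, u * K ∈ Icc 0 K := fun u hu =>
      ⟨mul_nonneg hu.1 hK, mul_le_of_le_one_left hK hu.2⟩
    simp only
    rw [he _ (hmem s hs) _ (hmem t ht), he _ (hmem 0 (by simp)) _ (hmem 1 (by simp)), ← sub_mul,
      abs_mul]
    simp
  rcases hK.eq_or_lt with rfl | hK
  · have : s = 0 := le_antisymm hs.2 hs.1
    simp [this]
  have := h.dist_le_of_isAffineGeodesic (aux f hf) (aux g hg) (t := s / K)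
    ⟨div_nonneg hs.1 hK.le, (div_le_one hK).2 hs.2⟩
  simp only [zero_mul, h0, dist_self, mul_zero, zero_add, one_mul, div_mul_cancel₀ _ hK.ne'] at this
  calc dist (f s) (g s) * K ≤ (s / K * dist (f K) (g K)) * K := by gcongr
    _ = s * dist (f K) (g K) := by field_simp

section Segments

variable [hX : Fact (IsCAT0Space X)]

/-- The affinely parametrized geodesic from `x` to `y`, extended by constants
outside `[0,1]`. -/
noncomputable def geo (x y : X) (t : ℝ) : X :=
  (hX.out.1.exists_isAffineGeodesic x y).choose (max 0 (min 1 t))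

theorem clamp_mem (t : ℝ) : max 0 (min 1 t) ∈ Icc (0 : ℝ) 1 :=
  ⟨le_max_left _ _, max_le zero_le_one (min_le_left _ _)⟩

theorem clamp_eq {t : ℝ} (ht : t ∈ Icc (0 : ℝ) 1) : max 0 (min 1 t) = t := by
  rw [min_eq_right ht.2, max_eq_right ht.1]

theorem abs_clamp_sub_le (d s t : ℝ) : |max 0 (min d s) - max 0 (min d t)| ≤ |s - t| := by
  have h1 := abs_max_sub_max_le_max 0 (min d s) 0 (min d t)
  have h2 := abs_min_sub_min_le_max d s d t
  simp only [sub_self, abs_zero, abs_nonneg, max_eq_right] at h1 h2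
  exact h1.trans h2

@[simp] theorem geo_zero (x y : X) : geo x y 0 = x := by
  have := (hX.out.1.exists_isAffineGeodesic x y).choose_spec.1
  simpa [geo] using this

@[simp] theorem geo_one (x y : X) : geo x y 1 = y := by
  have := (hX.out.1.exists_isAffineGeodesic x y).choose_spec.2.1
  simpa [geo] using this

theorem geo_of_nonpos (x y : X) {t : ℝ} (ht : t ≤ 0) : geo x y t = x := by
  conv_rhs => rw [← geo_zero x y]
  rw [geo, geo, max_eq_left ((min_le_right _ _).trans ht), max_eq_left (min_le_right _ _)]

theorem geo_of_one_le (x y : X) {t : ℝ} (ht : 1 ≤ t) : geo x y t = y := by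
  conv_rhs => rw [← geo_one x y]
  rw [geo, geo, min_eq_left ht, min_self]

theorem geo_isAffineGeodesic (x y : X) : IsAffineGeodesic (geo x y) := by
  intro s hs t ht
  have := (hX.out.1.exists_isAffineGeodesic x y).choose_spec.2.2
  simp only [geo]
  rw [clamp_eq hs, clamp_eq ht]
  simpa using this s hs t ht

theorem dist_geo_geo_le (x y x' y' : X) {t : ℝ} (ht : t ∈ Icc (0 : ℝ) 1) :
    dist (geo x y t) (geo x' y' t) ≤ (1 - t) * dist x x' + t * dist y y' := by
  simpa using hX.out.dist_le_of_isAffineGeodesic (geo_isAffineGeodesic x y)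
    (geo_isAffineGeodesic x' y') ht

theorem dist_geo_param (x y : X) {s t : ℝ} (hs : s ∈ Icc (0 : ℝ) 1) (ht : t ∈ Icc (0 : ℝ) 1) :
    dist (geo x y s) (geo x y t) = |s - t| * dist x y := by
  simpa using geo_isAffineGeodesic x y s hs t ht

theorem geo_clamp (x y : X) (t : ℝ) : geo x y (max 0 (min 1 t)) = geo x y t := by
  rw [geo, geo, clamp_eq (clamp_mem t)]

theorem dist_geo_le (x y x' y' : X) (s t : ℝ) :
    dist (geo x y s) (geo x' y' t) ≤ dist x x' + dist y y' + |s - t| * dist x y := by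
  rw [← geo_clamp x y, ← geo_clamp x' y']
  have hs := clamp_mem s
  have ht := clamp_mem t
  have h1 := dist_geo_param x y hs ht
  have h2 := dist_geo_geo_le x y x' y' ht
  have h3 := dist_triangle (geo x y (max 0 (min 1 s))) (geo x y (max 0 (min 1 t)))
    (geo x' y' (max 0 (min 1 t)))
  have h4 := mul_le_mul_of_nonneg_right (abs_clamp_sub_le 1 s t) (dist_nonneg (x := x) (y := y))
  have h5 : (1 - max 0 (min 1 t)) * dist x x' ≤ dist x x' :=
    mul_le_of_le_one_left dist_nonneg (by linarith [ht.1])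
  have h6 : max 0 (min 1 t) * dist y y' ≤ dist y y' := mul_le_of_le_one_left dist_nonneg ht.2
  linarith

theorem continuous_geo : Continuous fun p : X × X × ℝ => geo p.1 p.2.1 p.2.2 := by
  rw [continuous_iff_continuousAt]
  rintro ⟨x, y, t⟩
  rw [ContinuousAt, tendsto_iff_dist_tendsto_zero]
  have hb : Tendsto (fun p : X × X × ℝ => dist x p.1 + dist y p.2.1 + |t - p.2.2| * dist x y)
      (𝓝 (x, y, t)) (𝓝 0) := by
    have : Continuous fun p : X × X × ℝ => dist x p.1 + dist y p.2.1 + |t - p.2.2| * dist x y := by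
      fun_prop
    simpa using this.tendsto (x, y, t)
  refine squeeze_zero (fun _ => dist_nonneg) (fun p => ?_) hb
  rw [dist_comm]
  exact dist_geo_le _ _ _ _ _ _

theorem Continuous.geo {Y : Type*} [TopologicalSpace Y] {f g : Y → X} {h : Y → ℝ}
    (hf : Continuous f) (hg : Continuous g) (hh : Continuous h) :
    Continuous fun y => _root_.geo (f y) (g y) (h y) :=
  continuous_geo.comp (hf.prodMk (hg.prodMk hh))

theorem geo_self (x : X) (t : ℝ) : geo x x t = x := by
  rw [← geo_clamp]
  have := dist_geo_param x x (clamp_mem t) (left_mem_Icc.2 zero_le_one)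
  simpa using this

theorem dist_geo_point_le (z x y : X) {t r : ℝ} (hx : dist z x ≤ r) (hy : dist z y ≤ r) :
    dist z (geo x y t) ≤ r := by
  have ht := clamp_mem t
  have := dist_geo_geo_le z z x y ht
  rw [geo_self, geo_clamp] at this
  nlinarith [ht.1, ht.2]

theorem dist_left_geo_le (x y : X) (t : ℝ) : dist x (geo x y t) ≤ dist x y :=
  dist_geo_point_le x x y (by simp) le_rfl

/-- The unit speed geodesic from `o` to `a`, constant before time `0` and after time
`dist o a`. -/
noncomputable def radial (o a : X) (s : ℝ) : X := geo o a (s / dist o a)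

theorem radial_of_nonpos (o a : X) {s : ℝ} (hs : s ≤ 0) : radial o a s = o :=
  geo_of_nonpos _ _ (div_nonpos_of_nonpos_of_nonneg hs dist_nonneg)

theorem radial_of_le (o a : X) {s : ℝ} (hs : dist o a ≤ s) : radial o a s = a := by
  rcases (dist_nonneg (x := o) (y := a)).eq_or_lt with h | h
  · have : o = a := dist_eq_zero.1 h.symm
    subst this
    exact geo_self _ _
  · exact geo_of_one_le _ _ ((one_le_div h).2 hs)

theorem dist_radial_radial (o a : X) {s t : ℝ} (hs : s ∈ Icc 0 (dist o a))
    (ht : t ∈ Icc 0 (dist o a)) : dist (radial o a s) (radial o a t) = |s - t| := by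
  rcases (dist_nonneg (x := o) (y := a)).eq_or_lt with h | h
  · rw [← h] at hs ht
    have e1 := le_antisymm hs.2 hs.1
    have e2 := le_antisymm ht.2 ht.1
    simp [e1, e2]
  · have hm : ∀ u ∈ Icc 0 (dist o a), u / dist o a ∈ Icc (0 : ℝ) 1 := fun u hu =>
      ⟨div_nonneg hu.1 h.le, (div_le_one h).2 hu.2⟩
    rw [radial, radial, dist_geo_param o a (hm s hs) (hm t ht), ← sub_div, abs_div,
      abs_of_pos h, div_mul_cancel₀ _ h.ne']

theorem radial_clamp (o a : X) (s : ℝ) :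
    radial o a (max 0 (min (dist o a) s)) = radial o a s := by
  rcases le_total s 0 with h | h
  · rw [max_eq_left ((min_le_right _ _).trans h), radial_of_nonpos _ _ le_rfl,
      radial_of_nonpos _ _ h]
  rcases le_total s (dist o a) with h' | h'
  · rw [min_eq_right h', max_eq_right h]
  · rw [min_eq_left h', max_eq_right dist_nonneg, radial_of_le _ _ le_rfl, radial_of_le _ _ h']

theorem dist_left_radial (o a : X) {s : ℝ} (hs : 0 ≤ s) :
    dist o (radial o a s) = min (dist o a) s := by
  have h0 : 0 ≤ min (dist o a) s := le_min dist_nonneg hs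
  have := dist_radial_radial o a (s := 0) (t := min (dist o a) s) (by simp)
    ⟨h0, min_le_left _ _⟩
  rw [radial_of_nonpos _ _ le_rfl, zero_sub, abs_neg, abs_of_nonneg h0] at this
  rw [← this, ← radial_clamp o a s, max_eq_right h0]

theorem dist_radial_radial_le (o a : X) (s t : ℝ) :
    dist (radial o a s) (radial o a t) ≤ |s - t| := by
  rw [← radial_clamp o a s, ← radial_clamp o a t]
  have hm : ∀ u, max 0 (min (dist o a) u) ∈ Icc 0 (dist o a) := fun u =>
    ⟨le_max_left _ _, max_le dist_nonneg (min_le_left _ _)⟩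
  rw [dist_radial_radial o a (hm s) (hm t)]
  exact abs_clamp_sub_le _ _ _

theorem dist_radial_le_of_le (o a b : X) (t : ℝ) (hab : dist o a ≤ dist o b) :
    dist (radial o a t) (radial o b t) ≤ 3 * dist a b := by
  have hab' : dist o b - dist o a ≤ dist a b := by linarith [dist_triangle o a b]
  have h1 : dist a (radial o b (dist o a)) ≤ 2 * dist a b := by
    have h2 := dist_radial_radial_le o b (dist o b) (dist o a)
    rw [radial_of_le o b le_rfl, abs_of_nonneg (by linarith)] at h2
    linarith [dist_triangle a b (radial o b (dist o a))]
  have hn := dist_nonneg (x := a) (y := b)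
  rcases le_total t 0 with ht | ht
  · rw [radial_of_nonpos _ _ ht, radial_of_nonpos _ _ ht, dist_self]
    positivity
  rcases le_total t (dist o a) with hta | hta
  · have h3 := hX.out.dist_le_of_unitSpeed (f := radial o a) (g := radial o b) (K := dist o a)
      (by rw [radial_of_nonpos _ _ le_rfl, radial_of_nonpos _ _ le_rfl])
      (fun s hs t ht => dist_radial_radial o a hs ht)
      (fun s hs t ht => dist_radial_radial o b ⟨hs.1, hs.2.trans hab⟩ ⟨ht.1, ht.2.trans hab⟩)
      ⟨ht, hta⟩
    rw [radial_of_le o a le_rfl] at h3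
    rcases (dist_nonneg (x := o) (y := a)).eq_or_lt with h | h
    · have : t = 0 := le_antisymm (h ▸ hta) ht
      rw [this, radial_of_nonpos _ _ le_rfl, radial_of_nonpos _ _ le_rfl, dist_self]
      positivity
    · refine le_of_mul_le_mul_right (h3.trans ?_) h
      nlinarith [dist_nonneg (x := a) (y := radial o b (dist o a))]
  · rw [radial_of_le o a hta]
    have h4 : dist (radial o b (dist o a)) (radial o b t) ≤ dist a b := by
      rcases le_total t (dist o b) with htb | htb
      · refine (dist_radial_radial_le _ _ _ _).trans ?_
        rw [abs_sub_comm, abs_of_nonneg (by linarith)]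
        linarith
      · rw [radial_of_le o b htb, ← radial_of_le o b le_rfl]
        refine le_trans (b := |dist o a - dist o b|) ?_ ?_
        · conv_lhs => rw [radial_of_le o b le_rfl]
          have := dist_radial_radial_le o b (dist o a) (dist o b)
          rwa [radial_of_le o b le_rfl] at this
        · rw [radial_of_le o b le_rfl, abs_sub_comm, abs_of_nonneg (by linarith)]
          exact hab'
    linarith [dist_triangle a (radial o b (dist o a)) (radial o b t)]

theorem dist_radial_le (o a b : X) (t : ℝ) :
    dist (radial o a t) (radial o b t) ≤ 3 * dist a b := by
  rcases le_total (dist o a) (dist o b) with h | h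
  · exact dist_radial_le_of_le o a b t h
  · rw [dist_comm, dist_comm a]
    exact dist_radial_le_of_le o b a t h

theorem continuous_radial (o : X) : Continuous fun p : X × ℝ => radial o p.1 p.2 := by
  refine (LipschitzWith.of_dist_le_mul (K := 4) fun p q => ?_).continuous
  have h1 := dist_radial_radial_le o p.1 p.2 q.2
  have h2 := dist_radial_le o p.1 q.1 q.2
  have h3 := dist_triangle (radial o p.1 p.2) (radial o p.1 q.2) (radial o q.1 q.2)
  rw [← Real.dist_eq] at h1
  have h4 : dist p.1 q.1 ≤ dist p q := le_max_left _ _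
  have h5 : dist p.2 q.2 ≤ dist p q := le_max_right _ _
  norm_num
  linarith

theorem Continuous.radial {Y : Type*} [TopologicalSpace Y] {f : Y → X} {h : Y → ℝ} (o : X)
    (hf : Continuous f) (hh : Continuous h) : Continuous fun y => _root_.radial o (f y) (h y) :=
  (continuous_radial o).comp (hf.prodMk hh)

end Segments

end CAT0

section DeepRelations

variable {R : Type*} [MetricSpace R]

/-- A decreasing sequence of relations on a metric space which are equivalence relations at
scale `ε`, each of which contains a uniform neighbourhood of the diagonal, and whose
intersection has locally only countably many classes. -/
structure IsDeepRelation (ε : ℝ) (r : ℕ → R → R → Prop) : Prop where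
  pos : 0 < ε
  symm : ∀ k x y, dist x y < ε → r k x y → r k y x
  trans : ∀ k x y z, dist x y < ε → dist y z < ε → dist x z < ε → r k x y → r k y z → r k x z
  anti : ∀ k x y, r (k + 1) x y → r k x y
  near : ∀ k, ∃ η > 0, ∀ x y, dist x y < η → r k x y
  count : ∀ x, ∃ N ∈ 𝓝 x, ∃ f : R → ℕ, ∀ y ∈ N, ∀ y' ∈ N, f y = f y' → ∀ k, r k y y'

/-- The points of `A` arbitrarily close to which there are points of `A` unrelated to them. -/
def badSet (r : ℕ → R → R → Prop) (A : Set R) : Set R :=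
  {x | x ∈ A ∧ ∀ η > 0, ∃ y ∈ A, dist x y < η ∧ ¬ ∀ k, r k x y}

/-- `T` is a part of `A` at positive distance from the rest of `A`. -/
def IsPart (T A : Set R) : Prop :=
  T ⊆ A ∧ ∃ η > 0, ∀ y ∈ T, ∀ y' ∈ A, dist y y' < η → y' ∈ T

/-- `B` is a subset of `A` meeting all nonempty parts of `A`. -/
def MeetsParts (A B : Set R) : Prop :=
  B ⊆ A ∧ ∀ T, IsPart T A → T.Nonempty → (T ∩ B).Nonempty

theorem IsPart.isClosed {T A : Set R} (h : IsPart T A) (hA : IsClosed A) : IsClosed T := by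
  obtain ⟨hTA, η, hη, h⟩ := h
  refine isClosed_of_closure_subset fun y hy => ?_
  obtain ⟨z, hz, hyz⟩ := Metric.mem_closure_iff.1 hy η hη
  exact h z hz y (closure_minimal hTA hA hy) (by rwa [dist_comm])

theorem MeetsParts.refl (A : Set R) : MeetsParts A A :=
  ⟨subset_rfl, fun T hT hne => by rwa [inter_eq_left.2 hT.1]⟩

theorem MeetsParts.trans {A B C : Set R} (h : MeetsParts A B) (h' : MeetsParts B C) :
    MeetsParts A C := by
  refine ⟨h'.1.trans h.1, fun T hT hne => ?_⟩
  obtain ⟨hTA, η, hη, hT⟩ := id hT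
  have := h'.2 (T ∩ B) ⟨inter_subset_right, η, hη, fun y hy y' hy' hd =>
    ⟨hT y hy.1 y' (h.1 hy') hd, hy'⟩⟩ (h.2 T ‹_› hne)
  exact this.mono (inter_subset_inter_left _ inter_subset_left)

namespace IsDeepRelation

variable {ε : ℝ} {r : ℕ → R → R → Prop} (h : IsDeepRelation ε r)

include h

theorem refl (k : ℕ) (x : R) : r k x x := by
  obtain ⟨η, hη, H⟩ := h.near k
  exact H x x (by simpa)

theorem anti_le {k l : ℕ} (hkl : k ≤ l) {x y : R} (hr : r l x y) : r k x y := by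
  induction l, hkl using Nat.le_induction with
  | base => exact hr
  | succ l _ ih => exact ih (h.anti _ _ _ hr)

theorem isClosed_badSet {A : Set R} (hA : IsClosed A) : IsClosed (badSet r A) := by
  refine isClosed_of_closure_subset fun x hx => ?_
  have hxA : x ∈ A := closure_minimal (fun _ hy => hy.1) hA hx
  refine ⟨hxA, fun η hη => ?_⟩
  by_contra! hcon
  have hδ : 0 < min (η / 2) (ε / 2) := lt_min (by linarith) (by linarith [h.pos])
  obtain ⟨x', hx', hd⟩ := Metric.mem_closure_iff.1 hx _ hδ
  obtain ⟨y, hyA, hy, hbad⟩ := hx'.2 _ hδ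
  rw [lt_min_iff] at hd hy
  have hxy := dist_triangle x x' y
  refine hbad fun k => ?_
  have h1 := hcon x' hx'.1 (by linarith) k
  have h2 := hcon y hyA (by linarith) k
  have h3 : dist x x' < ε := by linarith [h.pos]
  exact h.trans k x' x y (by rwa [dist_comm]) (by linarith) (by linarith [h.pos])
    (h.symm k _ _ h3 h1) h2

theorem exists_uniform {L B : Set R} (hL : IsCompact L) (hLB : L ⊆ B)
    (hbad : L ∩ badSet r B = ∅) :
    ∃ η > 0, ∀ z ∈ L, ∀ z' ∈ B, dist z z' < η → ∀ k, r k z z' := by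
  have := hL.induction_on (p := fun s => ∃ η > 0, ∀ z ∈ s ∩ L, ∀ z' ∈ B, dist z z' < η →
    ∀ k, r k z z') ⟨1, one_pos, by simp⟩
    (fun s t hst ⟨η, hη, H⟩ => ⟨η, hη, fun z hz => H z ⟨hst hz.1, hz.2⟩⟩)
    (fun s t ⟨η, hη, H⟩ ⟨η', hη', H'⟩ => ⟨min η η', lt_min hη hη', fun z hz z' hz' hd => by
      rw [lt_min_iff] at hd
      rcases hz.1 with h1 | h1
      · exact H z ⟨h1, hz.2⟩ z' hz' hd.1
      · exact H' z ⟨h1, hz.2⟩ z' hz' hd.2⟩)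
    (fun x hx => by
      have hx' : x ∉ badSet r B := fun hb => by
        have : x ∈ L ∩ badSet r B := ⟨hx, hb⟩
        simp [hbad] at this
      have : ∃ η > 0, ∀ y ∈ B, dist x y < η → ∀ k, r k x y := by
        by_contra! hcon
        refine hx' ⟨hLB hx, fun η hη => ?_⟩
        obtain ⟨y, hy, hd, k, hk⟩ := hcon η hη
        exact ⟨y, hy, hd, fun H => hk (H k)⟩
      obtain ⟨η, hη, H⟩ := this
      have hδ : 0 < min (η / 2) (ε / 2) := lt_min (by linarith) (by linarith [h.pos])
      refine ⟨Metric.ball x (min (η / 2) (ε / 2)),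
        mem_nhdsWithin_of_mem_nhds (Metric.ball_mem_nhds _ hδ), _, hδ, ?_⟩
      intro z hz z' hz' hd k
      have hzx := hz.1
      rw [Metric.mem_ball] at hzx
      rw [lt_min_iff] at hzx hd
      have hxz' := dist_triangle x z z'
      rw [dist_comm x z] at hxz'
      have h1 := H z (hLB hz.2) (by rw [dist_comm]; linarith) k
      have h2 := H z' hz' (by linarith) k
      exact h.trans k z x z' (by linarith [h.pos]) (by linarith) (by linarith [h.pos])
        (h.symm k _ _ (by rw [dist_comm]; linarith [h.pos]) h1) h2)
  obtain ⟨η, hη, H⟩ := this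
  exact ⟨η, hη, fun z hz => H z ⟨hz, hz⟩⟩

end IsDeepRelation

/-- A compact set of mutually related clusters with a collar of size `ρ`. -/
structure IsIsland (ε : ℝ) (r : ℕ → R → R → Prop) (B L : Set R) (ρ : ℝ) : Prop where
  pos : 0 < ρ
  lt : 4 * ρ < ε
  compact : IsCompact L
  nonempty : L.Nonempty
  rel : ∀ z ∈ L, ∀ z' ∈ L, dist z z' < 4 * ρ → ∀ k, r k z z'
  sep : ∀ z ∈ L, ∀ z' ∈ B, dist z z' < 4 * ρ → z' ∈ L

/-- `x` is related at level `k` to a nearby point of `L`. -/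
def NearIsland (r : ℕ → R → R → Prop) (L : Set R) (ρ : ℝ) (k : ℕ) (x : R) : Prop :=
  ∃ z ∈ L, dist x z < 2 * ρ ∧ r k x z

namespace IsDeepRelation

variable {ε : ℝ} {r : ℕ → R → R → Prop} (h : IsDeepRelation ε r)

include h

theorem exists_isIsland {B L : Set R} (hB : IsClosed B) [CompactSpace R] (hL : IsPart L B)
    (hne : L.Nonempty) (hbad : L ∩ badSet r B = ∅) : ∃ ρ, IsIsland ε r B L ρ := by
  have hLc : IsCompact L := (hL.isClosed hB).isCompact
  obtain ⟨η, hη, H⟩ := h.exists_uniform hLc hL.1 hbad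
  obtain ⟨hLB, η', hη', H'⟩ := hL
  have hp := h.pos
  have hm : 0 < min ε (min η η') := lt_min hp (lt_min hη hη')
  have h1 : min ε (min η η') ≤ ε := min_le_left _ _
  have h2 : min ε (min η η') ≤ η := (min_le_right _ _).trans (min_le_left _ _)
  have h3 : min ε (min η η') ≤ η' := (min_le_right _ _).trans (min_le_right _ _)
  exact ⟨min ε (min η η') / 5, by positivity, by linarith, hLc, hne,
    fun z hz z' hz' hd => H z hz z' (hLB hz') (by linarith),
    fun z hz z' hz' hd => H' z hz z' hz' (by linarith)⟩

variable {B L : Set R} {ρ : ℝ} (hI : IsIsland ε r B L ρ)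

include hI

theorem rel_of_nearIsland {k : ℕ} {x z : R} (hz : z ∈ L) (hd : dist x z < 2 * ρ)
    (hn : NearIsland r L ρ k x) : r k x z := by
  obtain ⟨z', hz', hd', hr⟩ := hn
  have := dist_triangle_left z' z x
  have hp := hI.pos
  have hl := hI.lt
  exact h.trans k x z' z (by linarith) (by linarith) (by linarith) hr
    (hI.rel z' hz' z hz (by linarith) k)

theorem nearIsland_of_rel {k : ℕ} {x x' : R} (hx' : Metric.infDist x' L ≤ ρ)
    (hd : dist x x' < ρ) (hr : r k x' x) (hn : NearIsland r L ρ k x) : NearIsland r L ρ k x' := by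
  obtain ⟨z, hz, hzd⟩ := hI.compact.exists_infDist_eq_dist hI.nonempty x'
  rw [hzd] at hx'
  have := dist_triangle x x' z
  have hp := hI.pos
  have hl := hI.lt
  refine ⟨z, hz, by linarith, h.trans k x' x z (by rw [dist_comm]; linarith) (by linarith)
    (by linarith) hr (h.rel_of_nearIsland hI hz (by linarith) hn)⟩

theorem nearIsland_of_mem {k : ℕ} {x : R} (hx : x ∈ L) : NearIsland r L ρ k x :=
  ⟨x, hx, by simpa using hI.pos, h.refl k x⟩

omit h in
theorem _root_.IsIsland.mem_of_infDist_le {x : R} (hx : x ∈ B) (hd : Metric.infDist x L ≤ ρ) :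
    x ∈ L := by
  obtain ⟨z, hz, hzd⟩ := hI.compact.exists_infDist_eq_dist hI.nonempty x
  exact hI.sep z hz x hx (by rw [dist_comm, ← hzd]; linarith [hI.pos])

omit h hI in
theorem _root_.infDist_lt_add {L : Set R} {x y : R} {a η : ℝ} (hx : Metric.infDist x L < a)
    (hd : dist x y < η) : Metric.infDist y L < a + η := by
  have := Metric.infDist_le_infDist_add_dist (s := L) (x := y) (y := x)
  rw [dist_comm] at this
  linarith

theorem isPart_nearIsland {A : Set R} {m κ : ℕ}
    (hgap : ∀ y ∈ A, Metric.infDist y L ≤ ρ → NearIsland r L ρ m y → ¬ NearIsland r L ρ κ y →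
      Metric.infDist y L < ρ / 2) :
    IsPart {y | y ∈ A ∧ Metric.infDist y L ≤ ρ ∧ NearIsland r L ρ m y ∧
      ¬ NearIsland r L ρ κ y} A := by
  obtain ⟨η₁, hη₁, H₁⟩ := h.near m
  obtain ⟨η₂, hη₂, H₂⟩ := h.near κ
  have hp := hI.pos
  refine ⟨fun y hy => hy.1, min (ρ / 2) (min η₁ η₂),
    lt_min (by linarith) (lt_min hη₁ hη₂), ?_⟩
  rintro y ⟨hyA, hyV, hm, hκ⟩ y' hy'A hd
  simp only [lt_min_iff] at hd
  have hy := hgap y hyA hyV hm hκ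
  have hy' := infDist_lt_add hy hd.1
  exact ⟨hy'A, by linarith,
    h.nearIsland_of_rel hI (by linarith) (by linarith) (H₁ _ _ (by rw [dist_comm]; exact
        hd.2.1)) hm,
    fun hn => hκ (h.nearIsland_of_rel hI hyV (by rw [dist_comm]; linarith) (H₂ _ _ hd.2.2) hn)⟩

omit hI

variable [CompactSpace R]

theorem meetsParts_badSet_badSet {A : Set R} (hA : IsClosed A)
    (hAB : MeetsParts A (badSet r A)) : MeetsParts (badSet r A) (badSet r (badSet r A)) := by
  refine ⟨fun x hx => hx.1, fun L hL hne => ?_⟩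
  by_contra! hempty
  obtain ⟨ρ, hI⟩ := h.exists_isIsland (h.isClosed_badSet hA) hL hne hempty
  have hp := hI.pos
  have hl := hI.lt
  have hcont : Continuous fun x => Metric.infDist x L := Metric.continuous_infDist_pt L
  obtain ⟨m, hm⟩ : ∃ m, ∀ y ∈ A, Metric.infDist y L ≤ ρ → ρ / 2 ≤ Metric.infDist y L →
      NearIsland r L ρ m y → ∀ k, NearIsland r L ρ k y := by
    have hS : IsCompact {y | y ∈ A ∧ Metric.infDist y L ≤ ρ ∧ ρ / 2 ≤ Metric.infDist y L} :=
      (hA.inter ((isClosed_le hcont continuous_const).inter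
        (isClosed_le continuous_const hcont))).isCompact
    have := hS.induction_on (p := fun s => ∃ m, ∀ y ∈ s, y ∈ A → Metric.infDist y L ≤ ρ →
      ρ / 2 ≤ Metric.infDist y L → NearIsland r L ρ m y → ∀ k, NearIsland r L ρ k y)
      ⟨0, by simp⟩ (fun s t hst ⟨m, H⟩ => ⟨m, fun y hy => H y (hst hy)⟩)
      (fun s t ⟨m, H⟩ ⟨m', H'⟩ => ⟨max m m', fun y hy h1 h2 h3 ⟨z, hz, hd, hr⟩ => by
        rcases hy with hy | hy
        · exact H y hy h1 h2 h3 ⟨z, hz, hd, h.anti_le (le_max_left _ _) hr⟩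
        · exact H' y hy h1 h2 h3 ⟨z, hz, hd, h.anti_le (le_max_right _ _) hr⟩⟩)
      (fun y hy => by
        obtain ⟨hyA, hyV, hyS⟩ := hy
        have hyB : y ∉ badSet r A := fun hb => by
          have := hI.mem_of_infDist_le hb hyV
          have := Metric.infDist_zero_of_mem this
          linarith
        have : ∃ η > 0, ∀ y' ∈ A, dist y y' < η → ∀ k, r k y y' := by
          by_contra! hcon
          refine hyB ⟨hyA, fun η hη => ?_⟩
          obtain ⟨y, hy, hd, k, hk⟩ := hcon η hη
          exact ⟨y, hy, hd, fun H => hk (H k)⟩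
        obtain ⟨η, hη, H⟩ := this
        have hnhds : Metric.ball y (min η ρ) ∈
            𝓝[{y | y ∈ A ∧ Metric.infDist y L ≤ ρ ∧ ρ / 2 ≤ Metric.infDist y L}] y :=
          mem_nhdsWithin_of_mem_nhds (Metric.ball_mem_nhds _ (lt_min hη hp))
        have hball : ∀ y' ∈ Metric.ball y (min η ρ), y' ∈ A → Metric.infDist y' L ≤ ρ →
            ∀ k, NearIsland r L ρ k y ↔ NearIsland r L ρ k y' := by
          intro y' hy' hy'A hy'V k
          rw [Metric.mem_ball, dist_comm, lt_min_iff] at hy'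
          have hr := H y' hy'A hy'.1 k
          exact ⟨h.nearIsland_of_rel hI hy'V hy'.2 (h.symm k _ _ (by linarith) hr),
            h.nearIsland_of_rel hI hyV (by rw [dist_comm]; exact hy'.2) hr⟩
        by_cases hall : ∀ k, NearIsland r L ρ k y
        · exact ⟨_, hnhds, 0, fun y' hy' h1 h2 _ _ k => (hball y' hy' h1 h2 k).1 (hall k)⟩
        · push Not at hall
          obtain ⟨κ, hκ⟩ := hall
          exact ⟨_, hnhds, κ, fun y' hy' h1 h2 _ hn => absurd ((hball y' hy' h1 h2 κ).2 hn) hκ⟩)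
    obtain ⟨m, H⟩ := this
    exact ⟨m, fun y h1 h2 h3 => H y ⟨h1, h2, h3⟩ h1 h2 h3⟩
  obtain ⟨x, hx⟩ := hne
  obtain ⟨η, hη, H⟩ := h.near m
  obtain ⟨x', hx'A, hd, hns⟩ := (hL.1 hx).2 (min η (ρ / 2)) (lt_min hη (by linarith))
  rw [lt_min_iff] at hd
  have hx'V : Metric.infDist x' L ≤ ρ := by
    have := Metric.infDist_le_dist_of_mem (x := x') hx
    rw [dist_comm] at this
    linarith
  have hx'm : NearIsland r L ρ m x' := h.nearIsland_of_rel hI hx'V (by linarith)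
    (H _ _ (by rw [dist_comm]; exact hd.1)) (h.nearIsland_of_mem hI hx)
  have : ∃ κ, ¬ NearIsland r L ρ κ x' := by
    by_contra! hall
    refine hns fun k => h.symm k _ _ (by rw [dist_comm]; linarith)
      (h.rel_of_nearIsland hI hx (by rw [dist_comm]; linarith) (hall k))
  obtain ⟨κ, hκ⟩ := this
  obtain ⟨y, ⟨hyA, hyV, -, hyκ⟩, hyB⟩ := hAB.2 _ (h.isPart_nearIsland hI (A := A) (m := m) (κ := κ)
    fun y hyA hyV h1 h2 => by
      by_contra! h3
      exact h2 (hm y hyA hyV h3 h1 κ)) ⟨x', hx'A, hx'V, hx'm, hκ⟩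
  exact hyκ (h.nearIsland_of_mem hI (hI.mem_of_infDist_le hyB hyV))

theorem meetsParts_badSet_of_inter {B : Set R} (hB : IsClosed B)
    (hBB : ∀ L ρ, IsIsland ε r B L ρ → ∃ A, IsClosed A ∧ MeetsParts A B ∧
      MeetsParts A (badSet r A) ∧ ∀ y ∈ A, Metric.infDist y L ≤ ρ → Metric.infDist y L < ρ / 2) :
    MeetsParts B (badSet r B) := by
  refine ⟨fun x hx => hx.1, fun L hL hne => ?_⟩
  by_contra! hempty
  obtain ⟨ρ, hI⟩ := h.exists_isIsland hB hL hne hempty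
  have hp := hI.pos
  have hl := hI.lt
  obtain ⟨A, hA, hAB, hAA, hgap⟩ := hBB L ρ hI
  obtain ⟨x, ⟨hxA, hxV⟩, -, hxbad⟩ := hAA.2 {y | y ∈ A ∧ Metric.infDist y L ≤ ρ}
    ⟨fun y hy => hy.1, ρ / 2, by linarith, fun y hy y' hy' hd => ⟨hy', by
      have := infDist_lt_add (hgap y hy.1 hy.2) hd
      linarith⟩⟩
    (hne.mono fun x hx => ⟨hAB.1 (hL.1 hx), by rw [Metric.infDist_zero_of_mem hx]; exact hp.le⟩)
  obtain ⟨x', hx'A, hd, hns⟩ := hxbad (ρ / 2) (by linarith)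
  have hx2 := hgap x hxA hxV
  have hx'V : Metric.infDist x' L ≤ ρ := by
    have := infDist_lt_add hx2 hd
    linarith
  have : ∃ y ∈ A, Metric.infDist y L ≤ ρ ∧ ∃ κ, ¬ NearIsland r L ρ κ y := by
    by_contra! hall
    obtain ⟨z, hz, hzd⟩ := hI.compact.exists_infDist_eq_dist hI.nonempty x
    rw [hzd] at hxV
    have h1 : dist x' z < 2 * ρ := by
      have := dist_triangle_left x' z x
      linarith
    refine hns fun k => h.trans k x z x' (by linarith) (by rw [dist_comm]; linarith)
      (by linarith) (h.rel_of_nearIsland hI hz (by linarith) (hall x hxA (by rwa [hzd]) k))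
      (h.symm k _ _ (by linarith) (h.rel_of_nearIsland hI hz h1 (hall x' hx'A hx'V k)))
  obtain ⟨x₁, hx₁A, hx₁V, κ, hκ⟩ := this
  obtain ⟨η, hη, H⟩ := h.near κ
  obtain ⟨y, ⟨hyA, hyV, hyκ⟩, hyB⟩ := hAB.2
    {y | y ∈ A ∧ Metric.infDist y L ≤ ρ ∧ ¬ NearIsland r L ρ κ y}
    ⟨fun y hy => hy.1, min η (ρ / 2), lt_min hη (by linarith), by
      rintro y ⟨hyA, hyV, hyκ⟩ y' hy'A hd
      rw [lt_min_iff] at hd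
      have := infDist_lt_add (hgap y hyA hyV) hd.2
      exact ⟨hy'A, by linarith, fun hn => hyκ (h.nearIsland_of_rel hI hyV
        (by rw [dist_comm]; linarith) (H _ _ hd.1) hn)⟩⟩ ⟨x₁, hx₁A, hx₁V, hκ⟩
  exact hyκ (h.nearIsland_of_mem hI (hI.mem_of_infDist_le hyB hyV))

theorem not_subset_badSet {A : Set R} (hA : IsClosed A) (hne : A.Nonempty) :
    ¬ A ⊆ badSet r A := by
  intro hsub
  obtain ⟨x, hx⟩ := hne
  obtain ⟨N, hN, f, hf⟩ := h.count x
  obtain ⟨s, hs, hsN⟩ := Metric.mem_nhds_iff.1 hN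
  have hp := h.pos
  have : CompleteSpace A := hA.completeSpace_coe
  set t := min s (ε / 4) with ht
  have ht0 : 0 < t := lt_min hs (by linarith)
  have hts : t ≤ s := min_le_left _ _
  have hte : t ≤ ε / 4 := min_le_right _ _
  let F : Option ℕ → Set A := fun o => o.elim {y | t ≤ dist (y : R) x}
    fun i => closure {y | dist (y : R) x < t ∧ f y = i}
  have hFc : ∀ o, IsClosed (F o) := by
    rintro (_ | i)
    · exact isClosed_le continuous_const (by fun_prop)
    · exact isClosed_closure
  have hFu : ⋃ o, F o = univ := by
    refine eq_univ_of_forall fun y => mem_iUnion.2 ?_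
    by_cases hy : t ≤ dist (y : R) x
    · exact ⟨none, hy⟩
    · exact ⟨some (f y), subset_closure ⟨not_le.1 hy, rfl⟩⟩
  have hdense := dense_iUnion_interior_of_closed hFc hFu
  obtain ⟨y, hyb, hyI⟩ := hdense.exists_mem_open (Metric.isOpen_ball (x := (⟨x, hx⟩ : A)) (ε := t))
    ⟨⟨x, hx⟩, Metric.mem_ball_self ht0⟩
  obtain ⟨o, ho⟩ := mem_iUnion.1 hyb
  have hyI' : dist (y : R) x < t := hyI
  rcases o with _ | i
  · have : y ∈ F none := interior_subset ho
    have : t ≤ dist (y : R) x := this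
    linarith
  obtain ⟨η, hη, hball⟩ := Metric.isOpen_iff.1 isOpen_interior y ho
  obtain ⟨y', hy'A, hd, hns⟩ := (hsub y.2).2 η hη
  have hy'F : (⟨y', hy'A⟩ : A) ∈ F (some i) :=
    interior_subset (hball (by rw [Metric.mem_ball, dist_comm]; exact hd))
  have hyF : y ∈ F (some i) := interior_subset ho
  refine hns fun k => ?_
  obtain ⟨δ, hδ, H⟩ := h.near k
  have hm : 0 < min δ (ε / 8) := lt_min hδ (by linarith)
  obtain ⟨p, ⟨hp1, hp2⟩, hpd⟩ := Metric.mem_closure_iff.1 hyF _ hm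
  obtain ⟨q, ⟨hq1, hq2⟩, hqd⟩ := Metric.mem_closure_iff.1 hy'F _ hm
  rw [lt_min_iff] at hpd hqd
  have hpd' : dist (y : R) p < δ ∧ dist (y : R) p < ε / 8 := hpd
  have hqd' : dist y' q < δ ∧ dist y' q < ε / 8 := hqd
  have hpq : r k (p : R) q := hf p (hsN (by rw [Metric.mem_ball]; linarith)) q
    (hsN (by rw [Metric.mem_ball]; linarith)) (hp2.trans hq2.symm) k
  have d1 := dist_triangle_right (p : R) q x
  have d2 := dist_triangle (y : R) p q
  have d3 := dist_triangle (y : R) q y'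
  rw [dist_comm (q : R) y'] at d3
  have h1 := h.trans k y p q (by linarith) (by linarith) (by linarith) (H _ _ hpd'.1) hpq
  exact h.trans k y q y' (by linarith) (by rw [dist_comm]; linarith) (by linarith) h1
    (h.symm k _ _ (by linarith) (H _ _ hqd'.1))

/-- On a compact connected metric space a deep relation contains a uniform neighbourhood of
the diagonal. -/
theorem exists_uniform_univ [PreconnectedSpace R] :
    ∃ η > 0, ∀ x y, dist x y < η → ∀ k, r k x y := by
  by_cases hempty : badSet r univ = ∅
  · obtain ⟨η, hη, H⟩ := h.exists_uniform isCompact_univ subset_rfl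
      (by rw [hempty, inter_empty])
    exact ⟨η, hη, fun x y => H x (mem_univ _) y (mem_univ _)⟩
  exfalso
  have huniv : MeetsParts univ (badSet r univ) := by
    refine ⟨subset_univ _, fun T ⟨_, η, hη, hT⟩ hne => ?_⟩
    have hcl : IsClopen T := by
      refine ⟨⟨Metric.isOpen_iff.2 fun y hy => ⟨η, hη, fun z hz hzT => hy ?_⟩⟩,
        Metric.isOpen_iff.2 fun y hy => ⟨η, hη, fun z hz => ?_⟩⟩
      · exact hT z hzT y (mem_univ _) hz
      · exact hT y hy z (mem_univ _) (by rw [dist_comm]; exact hz)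
    rw [hcl.eq_univ hne, univ_inter]
    exact nonempty_iff_ne_empty.2 hempty
  let 𝓕 := {A : Set R // IsClosed A ∧ A.Nonempty ∧ MeetsParts A (badSet r A)}
  let base : 𝓕 := ⟨univ, isClosed_univ, (nonempty_iff_ne_empty.2 hempty).mono (subset_univ _),
      huniv⟩
  obtain ⟨M, hM⟩ := exists_maximal_of_chains_bounded (α := 𝓕)
    (r := fun A B => MeetsParts A.1 B.1) (fun c hc => by
      rcases c.eq_empty_or_nonempty with rfl | ⟨A₀, hA₀⟩
      · exact ⟨base, by simp⟩
      have hdir : ∀ A ∈ c, ∀ B ∈ c, MeetsParts A.1 B.1 ∨ MeetsParts B.1 A.1 := by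
        intro A hA B hB
        by_cases hAB : A = B
        · exact Or.inl (hAB ▸ MeetsParts.refl _)
        · exact hc hA hB hAB
      have hfip : ∀ T : Set R, IsClosed T → (∀ A ∈ c, (T ∩ A.1).Nonempty) →
          (T ∩ ⋂ A ∈ c, A.1).Nonempty := by
        intro T hT hTA
        have : Nonempty c := ⟨⟨A₀, hA₀⟩⟩
        have := IsCompact.nonempty_iInter_of_directed_nonempty_isCompact_isClosed
          (fun A : c => T ∩ A.1.1) (fun A B => by
            rcases hdir A A.2 B B.2 with hAB | hAB
            · exact ⟨B, inter_subset_inter_right _ hAB.1, subset_rfl⟩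
            · exact ⟨A, subset_rfl, inter_subset_inter_right _ hAB.1⟩)
          (fun A => hTA A A.2) (fun A => (hT.inter A.1.2.1).isCompact)
          (fun A => hT.inter A.1.2.1)
        obtain ⟨x, hx⟩ := this
        rw [mem_iInter] at hx
        exact ⟨x, (hx ⟨A₀, hA₀⟩).1, mem_iInter₂.2 fun A hA => (hx ⟨A, hA⟩).2⟩
      set B : Set R := ⋂ A ∈ c, A.1 with hBdef
      have hBc : IsClosed B := isClosed_biInter fun A _ => A.2.1
      have hBsub : ∀ A ∈ c, B ⊆ A.1 := fun A hA => biInter_subset_of_mem hA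
      have hmeet : ∀ A ∈ c, MeetsParts A.1 B := fun A hA => ⟨hBsub A hA, fun T hT hne =>
        hfip T (hT.isClosed A.2.1) fun A' hA' => by
          rcases hdir A hA A' hA' with hAA | hAA
          · exact hAA.2 T hT hne
          · rwa [inter_eq_left.2 (hT.1.trans hAA.1)]⟩
      have hBne : B.Nonempty := (hfip univ isClosed_univ fun A _ => by
        rw [univ_inter]; exact A.2.2.1).mono inter_subset_right
      refine ⟨⟨B, hBc, hBne, h.meetsParts_badSet_of_inter hBc fun L ρ hI => ?_⟩,
        fun A hA => hmeet A hA⟩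
      by_contra! hcon
      have hcont : Continuous fun x => Metric.infDist x L := Metric.continuous_infDist_pt L
      obtain ⟨x, ⟨hx1, hx2⟩, hxB⟩ := hfip
        ({y | Metric.infDist y L ≤ ρ} ∩ {y | ρ / 2 ≤ Metric.infDist y L})
        ((isClosed_le hcont continuous_const).inter (isClosed_le continuous_const hcont))
        fun A hA => by
          obtain ⟨y, hyA, h1, h2⟩ := hcon A.1 A.2.1 (hmeet A hA) A.2.2.2
          exact ⟨y, ⟨h1, h2⟩, hyA⟩
      have hx1 : Metric.infDist x L ≤ ρ := hx1
      have hx2 : ρ / 2 ≤ Metric.infDist x L := hx2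
      rw [Metric.infDist_zero_of_mem (hI.mem_of_infDist_le hxB hx1)] at hx2
      linarith [hI.pos])
    (fun {A B C} hAB hBC => hAB.trans hBC)
  obtain ⟨M, hMc, hMne, hMM⟩ := M
  have hne' : (badSet r M).Nonempty :=
    (hMM.2 M ⟨subset_rfl, 1, one_pos, fun _ _ y' hy' _ => hy'⟩ hMne).mono inter_subset_right
  have := hM ⟨badSet r M, h.isClosed_badSet hMc, hne', h.meetsParts_badSet_badSet hMc hMM⟩ hMM
  exact h.not_subset_badSet hMc hMne this.1

end IsDeepRelation

end DeepRelations

section PathClasses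

open CategoryTheory

variable {X : Type*} [TopologicalSpace X] {U : Set X}

/-- A point of `U` as an object of the fundamental groupoid of `U`. -/
def fgPt (U : Set X) (x : X) (hx : x ∈ U) : FundamentalGroupoid U := ⟨⟨x, hx⟩⟩

/-- A path of `X` with values in `U` as a path of `U`. -/
def Path.restrictTo {x y : X} (p : Path x y) (h : ∀ t, p t ∈ U) (hx : x ∈ U) (hy : y ∈ U) :
    Path (⟨x, hx⟩ : U) ⟨y, hy⟩ where
  toFun t := ⟨p t, h t⟩
  source' := Subtype.ext p.source
  target' := Subtype.ext p.target

theorem Path.source_mem {x y : X} {p : Path x y} (h : ∀ t, p t ∈ U) : x ∈ U := by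
  simpa using h 0

theorem Path.target_mem {x y : X} {p : Path x y} (h : ∀ t, p t ∈ U) : y ∈ U := by
  simpa using h 1

/-- The morphism in the fundamental groupoid of `U` given by a path with values in `U`. -/
def fgCls {x y : X} (p : Path x y) (h : ∀ t, p t ∈ U) :
    fgPt U x (Path.source_mem h) ⟶ fgPt U y (Path.target_mem h) :=
  Path.Homotopic.Quotient.mk (p.restrictTo h (Path.source_mem h) (Path.target_mem h))

theorem Path.trans_mem {x y z : X} {p : Path x y} {q : Path y z} (hp : ∀ t, p t ∈ U)
    (hq : ∀ t, q t ∈ U) (t : I) : p.trans q t ∈ U := by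
  rw [Path.trans_apply]
  split_ifs
  exacts [hp _, hq _]

theorem Path.symm_mem {x y : X} {p : Path x y} (hp : ∀ t, p t ∈ U) (t : I) : p.symm t ∈ U :=
  hp _

theorem fgCls_trans {x y z : X} {p : Path x y} {q : Path y z} (hp : ∀ t, p t ∈ U)
    (hq : ∀ t, q t ∈ U) : fgCls (p.trans q) (Path.trans_mem hp hq) = fgCls p hp ≫ fgCls q hq := by
  rw [FundamentalGroupoid.comp_eq]
  refine (congrArg Path.Homotopic.Quotient.mk ?_).trans (Path.Homotopic.Quotient.mk_trans _ _)
  ext t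
  change p.trans q t = ((Path.trans (p.restrictTo hp _ _) (q.restrictTo hq _ _) t : U) : X)
  rw [Path.trans_apply, Path.trans_apply]
  split_ifs <;> rfl

theorem fgCls_congr {x y : X} {p q : Path x y} (h : p = q) (hp : ∀ t, p t ∈ U)
    (hq : ∀ t, q t ∈ U) : fgCls p hp = fgCls q hq := by
  subst h
  rfl

theorem fgCls_symm {x y : X} {p : Path x y} (hp : ∀ t, p t ∈ U) :
    fgCls p.symm (Path.symm_mem hp) = Groupoid.inv (fgCls p hp) := rfl

theorem fgCls_refl {x : X} (hx : ∀ t, Path.refl x t ∈ U) :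
    fgCls (Path.refl x) hx = 𝟙 (fgPt U x (Path.source_mem hx)) := rfl

theorem exists_fgCls {x y : X} {hx : x ∈ U} {hy : y ∈ U} (E : fgPt U x hx ⟶ fgPt U y hy) :
    ∃ (p : Path x y) (h : ∀ t, p t ∈ U), E = fgCls p h := by
  obtain ⟨q, rfl⟩ := Path.Homotopic.Quotient.mk_surjective E
  exact ⟨q.map continuous_subtype_val, fun t => (q t).2, rfl⟩

theorem fgCls_eq_iff {x y : X} {p q : Path x y} (hp : ∀ t, p t ∈ U) (hq : ∀ t, q t ∈ U) :
    fgCls p hp = fgCls q hq ↔ ∃ F : I × I → X, Continuous F ∧ (∀ z, F z ∈ U) ∧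
      (∀ t, F (0, t) = p t) ∧ (∀ t, F (1, t) = q t) ∧ (∀ s, F (s, 0) = x) ∧
      (∀ s, F (s, 1) = y) := by
  refine (Path.Homotopic.Quotient.eq).trans ⟨fun ⟨F⟩ => ?_, ?_⟩
  · refine ⟨fun z => (F z : X), continuous_subtype_val.comp F.continuous, fun z => (F z).2,
      fun t => ?_, fun t => ?_, fun s => ?_, fun s => ?_⟩
    · exact congrArg Subtype.val (F.apply_zero t)
    · exact congrArg Subtype.val (F.apply_one t)
    · exact congrArg Subtype.val (F.source s)
    · exact congrArg Subtype.val (F.target s)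
  · rintro ⟨F, hF, hFU, h0, h1, hs, ht⟩
    exact ⟨{
      toFun := fun z => ⟨F z, hFU z⟩
      continuous_toFun := hF.subtype_mk _
      map_zero_left := fun t => Subtype.ext (h0 t)
      map_one_left := fun t => Subtype.ext (h1 t)
      prop' := by
        rintro s t (rfl | ht')
        · exact Subtype.ext ((hs s).trans p.source.symm)
        · rw [mem_singleton_iff] at ht'
          subst ht'
          exact Subtype.ext ((ht s).trans p.target.symm) }⟩

/-- Two paths in a convex set have images in the same class. -/
theorem fgCls_map_eq {E : Type*} [AddCommGroup E] [Module ℝ E] [TopologicalSpace E]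
    [ContinuousAdd E] [ContinuousSMul ℝ E] {u v : E} (P Q : Path u v) {J : Set E}
    (hJ : Convex ℝ J) (hP : ∀ t, P t ∈ J) (hQ : ∀ t, Q t ∈ J) {G : E → X} (hG : Continuous G)
    (hU : ∀ e ∈ J, G e ∈ U) :
    fgCls (P.map hG) (fun t => hU _ (hP t)) = fgCls (Q.map hG) (fun t => hU _ (hQ t)) := by
  refine (fgCls_eq_iff _ _).2 ⟨fun z => G ((1 - (z.1 : ℝ)) • P z.2 + (z.1 : ℝ) • Q z.2),
      by fun_prop, fun z => hU _
    (hJ (hP _) (hQ _) (sub_nonneg.2 z.1.2.2) z.1.2.1 (by ring)), by simp, by simp, fun s => ?_,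
    fun s => ?_⟩
  · simp [← add_smul]
  · simp [← add_smul]

/-- The path running along the curve `f` from time `a` to time `b`. -/
def arc (f : ℝ → X) (hf : Continuous f) (a b : ℝ) {x y : X} (hx : f a = x) (hy : f b = y) :
    Path x y where
  toFun t := f ((1 - (t : ℝ)) * a + t * b)
  continuous_toFun := by fun_prop
  source' := by simpa using hx
  target' := by simpa using hy

theorem arc_param_mem {J : Set ℝ} (hJ : J.OrdConnected) {a b : ℝ} (ha : a ∈ J) (hb : b ∈ J)
    (t : I) : (1 - (t : ℝ)) * a + t * b ∈ J :=
  hJ.convex ha hb (sub_nonneg.2 t.2.2) t.2.1 (by ring)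

theorem arc_mem {f : ℝ → X} {hf : Continuous f} {a b : ℝ} {x y : X} {hx : f a = x} {hy : f b = y}
    {J : Set ℝ} (hJ : J.OrdConnected) (ha : a ∈ J) (hb : b ∈ J) (hU : ∀ s ∈ J, f s ∈ U) (t : I) :
    arc f hf a b hx hy t ∈ U :=
  hU _ (arc_param_mem hJ ha hb t)

theorem arc_symm {f : ℝ → X} (hf : Continuous f) {a b : ℝ} {x y : X} (hx : f a = x)
    (hy : f b = y) : (arc f hf a b hx hy).symm = arc f hf b a hy hx := by
  ext t
  change f _ = f _
  rw [unitInterval.coe_symm_eq]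
  congr 1
  ring

theorem arc_congr {f g : ℝ → X} {hf : Continuous f} {hg : Continuous g} {a b : ℝ} {x y : X}
    {hx : f a = x} {hy : f b = y} {hx' : g a = x} {hy' : g b = y}
    {J : Set ℝ} (hJ : J.OrdConnected) (ha : a ∈ J) (hb : b ∈ J)
    (h : EqOn f g J) : arc f hf a b hx hy = arc g hg a b hx' hy' := by
  ext t
  exact h (arc_param_mem hJ ha hb t)

theorem arc_refl {f : ℝ → X} (hf : Continuous f) {a : ℝ} {x : X} (hx : f a = x) (hx' : f a = x) :
    arc f hf a a hx hx' = Path.refl x := by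
  ext t
  simp only [arc, Path.coe_mk_mk, Path.refl_apply, ← hx]
  congr 1
  ring

theorem arc_eq_map {f : ℝ → X} (hf : Continuous f) (a b : ℝ) :
    arc f hf a b rfl rfl = (Path.segment a b).map hf := by
  ext t
  simp [arc, AffineMap.lineMap_apply_ring]

theorem segment_mem {J : Set ℝ} (hJ : J.OrdConnected) {a b : ℝ} (ha : a ∈ J) (hb : b ∈ J) (t : I) :
    Path.segment a b t ∈ J := by
  have := arc_param_mem hJ ha hb t
  simpa [AffineMap.lineMap_apply_ring] using this

theorem arc_trans {f : ℝ → X} {hf : Continuous f} {a b c : ℝ} {x y z : X} {hx : f a = x}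
    {hy : f b = y} {hz : f c = z} {J : Set ℝ} (hJ : J.OrdConnected) (ha : a ∈ J) (hb : b ∈ J)
    (hc : c ∈ J) (hU : ∀ s ∈ J, f s ∈ U) :
    fgCls (arc f hf a b hx hy) (arc_mem hJ ha hb hU) ≫ fgCls (arc f hf b c hy hz)
      (arc_mem hJ hb hc hU) = fgCls (arc f hf a c hx hz) (arc_mem hJ ha hc hU) := by
  subst hx hy hz
  rw [← fgCls_trans]
  have key := fgCls_map_eq ((Path.segment a b).trans (Path.segment b c)) (Path.segment a c)
    hJ.convex (Path.trans_mem (segment_mem hJ ha hb) (segment_mem hJ hb hc))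
    (segment_mem hJ ha hc) hf hU
  refine (fgCls_congr ?_ _ _).trans (key.trans (fgCls_congr ?_ _ _))
  · rw [Path.map_trans, arc_eq_map, arc_eq_map]
  · rw [arc_eq_map]

theorem continuous_slice_left {G : ℝ → ℝ → X} (hG : Continuous fun p : ℝ × ℝ => G p.1 p.2)
    (t : ℝ) : Continuous fun s => G s t :=
  hG.comp (by fun_prop : Continuous fun s : ℝ => (s, t))

theorem continuous_slice_right {G : ℝ → ℝ → X} (hG : Continuous fun p : ℝ × ℝ => G p.1 p.2)
    (s : ℝ) : Continuous fun t => G s t :=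
  hG.comp (by fun_prop : Continuous fun t : ℝ => (s, t))

theorem arc_square {G : ℝ → ℝ → X} (hG : Continuous fun p : ℝ × ℝ => G p.1 p.2) {a b c d : ℝ}
    {x₀₀ x₁₀ x₀₁ x₁₁ : X} (h₀₀ : G a c = x₀₀) (h₁₀ : G b c = x₁₀) (h₀₁ : G a d = x₀₁)
    (h₁₁ : G b d = x₁₁) {J K : Set ℝ} (hJ : J.OrdConnected) (hK : K.OrdConnected) (ha : a ∈ J)
    (hb : b ∈ J) (hc : c ∈ K) (hd : d ∈ K) (hU : ∀ s ∈ J, ∀ t ∈ K, G s t ∈ U) :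
    fgCls (arc (fun s => G s c) (continuous_slice_left hG c) a b h₀₀ h₁₀)
        (arc_mem hJ ha hb fun s hs => hU s hs c hc) ≫
      fgCls (arc (fun t => G b t) (continuous_slice_right hG b) c d h₁₀ h₁₁)
        (arc_mem hK hc hd fun t ht => hU b hb t ht) =
    fgCls (arc (fun t => G a t) (continuous_slice_right hG a) c d h₀₀ h₀₁)
        (arc_mem hK hc hd fun t ht => hU a ha t ht) ≫
      fgCls (arc (fun s => G s d) (continuous_slice_left hG d) a b h₀₁ h₁₁)
        (arc_mem hJ ha hb fun s hs => hU s hs d hd) := by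
  subst h₀₀ h₁₀ h₀₁ h₁₁
  rw [← fgCls_trans, ← fgCls_trans]
  have e : ∀ {u v : ℝ × ℝ} (t : I), ((Path.segment u v t : ℝ × ℝ)) =
      (Path.segment u.1 v.1 t, Path.segment u.2 v.2 t) := by
    intro u v t
    ext <;> simp [AffineMap.lineMap_apply]
  have key := fgCls_map_eq ((Path.segment (a, c) (b, c)).trans (Path.segment (b, c) (b, d)))
    ((Path.segment (a, c) (a, d)).trans (Path.segment (a, d) (b, d))) (J := J ×ˢ K)
    (hJ.convex.prod hK.convex)
    (Path.trans_mem (fun t => by rw [e]; exact ⟨segment_mem hJ ha hb t, segment_mem hK hc hc t⟩)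
      (fun t => by rw [e]; exact ⟨segment_mem hJ hb hb t, segment_mem hK hc hd t⟩))
    (Path.trans_mem (fun t => by rw [e]; exact ⟨segment_mem hJ ha ha t, segment_mem hK hc hd t⟩)
      (fun t => by rw [e]; exact ⟨segment_mem hJ ha hb t, segment_mem hK hd hd t⟩))
    hG (fun p hp => hU p.1 hp.1 p.2 hp.2)
  refine (fgCls_congr ?_ _ _).trans (key.trans (fgCls_congr ?_ _ _))
  all_goals
    rw [Path.map_trans]
    congr 1 <;> ext t <;> simp [arc, AffineMap.lineMap_apply] <;> congr 1 <;> ring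

end PathClasses

section

variable {X : Type*} [MetricSpace X] [Fact (IsCAT0Space X)] {U : Set X}

theorem fgCls_eq_of_geo_mem {x y : X} {p q : Path x y} (hp : ∀ t, p t ∈ U) (hq : ∀ t, q t ∈ U)
    (h : ∀ s τ, geo (p s) (q s) τ ∈ U) : fgCls p hp = fgCls q hq := by
  rw [fgCls_eq_iff]
  refine ⟨fun z => geo (p z.2) (q z.2) z.1, Continuous.geo (by fun_prop) (by fun_prop)
    (by fun_prop), fun z => h _ _, by simp, by simp, by simp [geo_self], by simp [geo_self]⟩

end

section RaySpace

variable {X : Type*} [MetricSpace X]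

/-- The set of curves that are constantly `o` for negative times and are unit speed geodesic
rays issuing from `o` for positive times. -/
def raysFrom (o : X) : Set (ℝ → X) :=
  {f | (∀ t ≤ 0, f t = o) ∧ ∀ s, 0 ≤ s → ∀ t, 0 ≤ t → dist (f s) (f t) = |s - t|}

/-- The complement of the closed ball of radius `r` about `o`. -/
def outside (o : X) (r : ℝ) : Set X := {x | r < dist o x}

theorem isOpen_outside (o : X) (r : ℝ) : IsOpen (outside o r) :=
  isOpen_lt continuous_const (by fun_prop)

theorem outside_anti (o : X) {r s : ℝ} (h : r ≤ s) : outside o s ⊆ outside o r :=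
  fun _ hx => h.trans_lt hx

namespace raysFrom

variable {o : X}

theorem zero (f : raysFrom o) : f.1 0 = o := f.2.1 0 le_rfl

theorem dist_eq (f : raysFrom o) {s t : ℝ} (hs : 0 ≤ s) (ht : 0 ≤ t) :
    dist (f.1 s) (f.1 t) = |s - t| := f.2.2 s hs t ht

theorem dist_left (f : raysFrom o) {t : ℝ} (ht : 0 ≤ t) : dist o (f.1 t) = t := by
  have := dist_eq f le_rfl ht
  rwa [zero f, zero_sub, abs_neg, abs_of_nonneg ht] at this

theorem apply_clamp (f : raysFrom o) (t : ℝ) : f.1 (max 0 t) = f.1 t := by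
  rcases le_total t 0 with h | h
  · rw [max_eq_left h, zero f, f.2.1 t h]
  · rw [max_eq_right h]

theorem dist_le (f : raysFrom o) (s t : ℝ) : dist (f.1 s) (f.1 t) ≤ |s - t| := by
  rw [← apply_clamp f s, ← apply_clamp f t, dist_eq f (le_max_left _ _) (le_max_left _ _)]
  simpa using abs_max_sub_max_le_max 0 s 0 t

theorem continuous (f : raysFrom o) : Continuous f.1 :=
  (LipschitzWith.of_dist_le_mul (K := 1) fun s t => by
    simpa [Real.dist_eq] using dist_le f s t).continuous

theorem mem_outside (f : raysFrom o) {r t : ℝ} (ht : 0 ≤ t) (h : r < t) :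
    f.1 t ∈ outside o r := by
  rw [outside, mem_ofPred_eq, dist_left f ht]
  exact h

theorem isClosed : IsClosed (raysFrom o) := by
  simp only [raysFrom, ofPred_and, ofPred_forall]
  refine (isClosed_iInter fun t => isClosed_iInter fun _ => ?_).inter
    (isClosed_iInter fun s => isClosed_iInter fun _ => isClosed_iInter fun t =>
      isClosed_iInter fun _ => ?_)
  · exact isClosed_eq (continuous_apply t) continuous_const
  · exact isClosed_eq ((continuous_apply s).dist (continuous_apply t)) continuous_const

theorem isCompact [ProperSpace X] : IsCompact (raysFrom o) := by
  refine (isCompact_univ_pi fun t : ℝ => isCompact_closedBall o |t|).of_isClosed_subset isClosed ?_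
  intro f hf t _
  rcases le_total t 0 with h | h
  · rw [hf.1 t h, Metric.mem_closedBall, dist_self]
    positivity
  · rw [Metric.mem_closedBall, dist_comm, dist_left ⟨f, hf⟩ h, abs_of_nonneg h]

instance [ProperSpace X] : CompactSpace (raysFrom o) := isCompact_iff_compactSpace.1 isCompact

theorem continuous_eval : Continuous fun p : raysFrom o × ℝ => p.1.1 p.2 := by
  rw [continuous_iff_continuousAt]
  rintro ⟨f, t⟩
  rw [ContinuousAt, tendsto_iff_dist_tendsto_zero]
  have hb : Tendsto (fun p : raysFrom o × ℝ => |p.2 - t| + dist (p.1.1 t) (f.1 t)) (𝓝 (f, t))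
      (𝓝 0) := by
    have : Continuous fun p : raysFrom o × ℝ => |p.2 - t| + dist (p.1.1 t) (f.1 t) := by
      have : Continuous fun p : raysFrom o × ℝ => p.1.1 t :=
        (continuous_apply t).comp (continuous_subtype_val.comp continuous_fst)
      fun_prop
    simpa using this.tendsto (f, t)
  refine squeeze_zero (fun _ => dist_nonneg) (fun p => ?_) hb
  exact (dist_triangle _ (p.1.1 t) _).trans (add_le_add_left (dist_le (p.1) _ _) _)

theorem continuous_eval_left (t : ℝ) : Continuous fun f : raysFrom o => f.1 t :=
  continuous_eval.comp (by fun_prop : Continuous fun f : raysFrom o => (f, t))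

section

variable [hX : Fact (IsCAT0Space X)]

theorem dist_mul_le (f g : raysFrom o) {s K : ℝ} (hs : 0 ≤ s) (hK : s ≤ K) :
    dist (f.1 s) (g.1 s) * K ≤ s * dist (f.1 K) (g.1 K) :=
  hX.out.dist_le_of_unitSpeed (by rw [zero f, zero g]) (fun s hs t ht => dist_eq f hs.1 ht.1)
    (fun s hs t ht => dist_eq g hs.1 ht.1) ⟨hs, hK⟩

theorem radial_dist_mul_le (x : X) (g : raysFrom o) {s K : ℝ} (hs : 0 ≤ s) (hK : s ≤ K)
    (hx : K ≤ dist o x) :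
    dist (radial o x s) (g.1 s) * K ≤ s * dist (radial o x K) (g.1 K) :=
  hX.out.dist_le_of_unitSpeed (by rw [radial_of_nonpos _ _ le_rfl, zero g])
    (fun s hs t ht => dist_radial_radial o x ⟨hs.1, hs.2.trans hx⟩ ⟨ht.1, ht.2.trans hx⟩)
    (fun s hs t ht => dist_eq g hs.1 ht.1) ⟨hs, hK⟩

theorem le_of_mul_le {a b s K : ℝ} (ha : 0 ≤ a) (hb : 0 ≤ b) (hs : 0 ≤ s) (hK : s ≤ K)
    (h : a * K ≤ s * b) (h0 : s = 0 → a = 0) : a ≤ b := by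
  rcases hs.eq_or_lt with rfl | hs
  · rw [h0 rfl]
    exact hb
  · by_contra! hab
    nlinarith

theorem dist_mono (f g : raysFrom o) {s K : ℝ} (hs : 0 ≤ s) (hK : s ≤ K) :
    dist (f.1 s) (g.1 s) ≤ dist (f.1 K) (g.1 K) :=
  le_of_mul_le dist_nonneg dist_nonneg hs hK (dist_mul_le f g hs hK) (by
    rintro rfl
    rw [zero f, zero g, dist_self])

theorem radial_dist_mono (x : X) (g : raysFrom o) {s K : ℝ} (hs : 0 ≤ s) (hK : s ≤ K)
    (hx : K ≤ dist o x) : dist (radial o x s) (g.1 s) ≤ dist (radial o x K) (g.1 K) :=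
  le_of_mul_le dist_nonneg dist_nonneg hs hK (radial_dist_mul_le x g hs hK hx) (by
    rintro rfl
    rw [zero g, radial_of_nonpos _ _ le_rfl, dist_self])

theorem radial_apply (f : raysFrom o) {s T : ℝ} (hs : 0 ≤ s) (hT : s ≤ T) :
    radial o (f.1 T) s = f.1 s := by
  have h1 := dist_left f (hs.trans hT)
  have := radial_dist_mono (f.1 T) f hs hT h1.ge
  rw [radial_of_le _ _ h1.le, dist_self] at this
  exact dist_le_zero.1 this

theorem eq_of_forall_nat {f g : raysFrom o} (h : ∀ j : ℕ, dist (f.1 j) (g.1 j) ≤ 1 / (j + 1)) :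
    f = g := by
  refine Subtype.ext (funext fun t => ?_)
  rcases le_total t 0 with ht | ht
  · rw [f.2.1 t ht, g.2.1 t ht]
  refine dist_le_zero.1 (le_of_forall_pos_le_add fun ε hε => ?_)
  obtain ⟨n, hn⟩ := exists_nat_gt (max t (1 / ε))
  rw [max_lt_iff] at hn
  have h1 := (dist_mono f g ht hn.1.le).trans (h n)
  have h2 : 1 / ((n : ℝ) + 1) ≤ ε := by
    rw [div_le_iff₀ (by positivity)]
    have := (div_lt_iff₀ hε).1 hn.2
    nlinarith
  linarith

instance [ProperSpace X] : TopologicalSpace.MetrizableSpace (raysFrom o) := by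
  have hc : Continuous fun (f : raysFrom o) (n : ℕ) => f.1 n :=
    continuous_pi fun n => continuous_eval_left _
  refine (hc.isClosedEmbedding fun f g hfg => ?_).isEmbedding.metrizableSpace
  refine eq_of_forall_nat fun j => ?_
  have : f.1 j = g.1 j := congrFun hfg j
  rw [this, dist_self]
  positivity

theorem exists_nat_of_disjoint_diagonal [ProperSpace X] {K : Set (raysFrom o × raysFrom o)}
    (hK : IsClosed K) (h : ∀ p ∈ K, p.1 ≠ p.2) :
    ∃ j : ℕ, ∀ p ∈ K, 1 / ((j : ℝ) + 1) < dist (p.1.1 j) (p.2.1 j) := by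
  by_contra! hcon
  let t : ℕ → Set (raysFrom o × raysFrom o) := fun j =>
    K ∩ {p | dist (p.1.1 j) (p.2.1 j) ≤ 1 / ((j : ℝ) + 1)}
  have htc : ∀ j, IsClosed (t j) := fun j => hK.inter (isClosed_le
    (((continuous_eval_left _).comp continuous_fst).dist
      ((continuous_eval_left _).comp continuous_snd)) continuous_const)
  obtain ⟨p, hp⟩ := IsCompact.nonempty_iInter_of_sequence_nonempty_isCompact_isClosed t
    (fun j p hp => ⟨hp.1, by
      have h1 := dist_mono p.1 p.2 (s := j) (K := (j + 1 : ℕ)) (by positivity) (by simp)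
      have h2 : dist (p.1.1 (j + 1 : ℕ)) (p.2.1 (j + 1 : ℕ)) ≤ 1 / (((j + 1 : ℕ) : ℝ) + 1) := hp.2
      have h3 : 1 / (((j + 1 : ℕ) : ℝ) + 1) ≤ 1 / ((j : ℝ) + 1) := by
        gcongr
        linarith
      exact h1.trans (h2.trans h3)⟩)
    (fun j => (hcon j).imp fun p hp => ⟨hp.1, hp.2⟩) (htc 0).isCompact htc
  rw [mem_iInter] at hp
  exact h p (hp 0).1 (eq_of_forall_nat fun j => (hp j).2)

/-- Far away points are seen from `o` close to the direction of a geodesic ray. -/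
theorem exists_radial_near [ProperSpace X] (o : X) (M : ℝ) {ε : ℝ} (hε : 0 < ε) :
    ∃ m : ℝ, ∀ x, m ≤ dist o x → ∃ δ : raysFrom o, dist (radial o x M) (δ.1 M) < ε := by
  by_contra! hcon
  choose x hx hfar using fun n : ℕ => hcon n
  obtain ⟨f, -, hf⟩ := (isCompact_univ_pi fun t : ℝ => isCompact_closedBall o
      |t|).exists_mapClusterPt
    (f := atTop) (u := fun n => radial o (x n)) (by
      rw [le_principal_iff, mem_map]
      refine univ_mem' fun n t _ => ?_
      rw [Metric.mem_closedBall, dist_comm]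
      have := dist_radial_radial_le o (x n) 0 t
      rwa [radial_of_nonpos _ _ le_rfl, zero_sub, abs_neg] at this)
  have hmem : f ∈ raysFrom o := by
    refine ⟨fun t ht => ?_, fun s hs t ht => ?_⟩
    · exact (isClosed_eq (continuous_apply t) continuous_const :
        IsClosed {f : ℝ → X | f t = o}).mem_of_mapClusterPt hf
        (Eventually.of_forall fun n => radial_of_nonpos _ _ ht)
    · refine (isClosed_eq ((continuous_apply s).dist (continuous_apply t)) continuous_const :
        IsClosed {f : ℝ → X | dist (f s) (f t) = |s - t|}).mem_of_mapClusterPt hf ?_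
      obtain ⟨N, hN⟩ := exists_nat_ge (max s t)
      rw [max_le_iff] at hN
      filter_upwards [eventually_ge_atTop N] with n hn
      have hn' : (N : ℝ) ≤ n := by exact_mod_cast hn
      exact dist_radial_radial _ _ ⟨hs, by linarith [hx n]⟩ ⟨ht, by linarith [hx n]⟩
  have hopen : ∀ᶠ g : ℝ → X in 𝓝 f, dist (g M) (f M) < ε :=
    (isOpen_lt ((continuous_apply M).dist continuous_const) continuous_const).mem_nhds
      (by simpa using hε)
  obtain ⟨n, hn⟩ := (hf.frequently hopen).exists
  exact absurd hn (not_lt.2 (hfar n ⟨f, hmem⟩))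

omit hX in
theorem exists_dist_ge [ProperSpace X] (hnc : ¬ IsCompact (univ : Set X)) (o : X) (m : ℝ) :
    ∃ x, m ≤ dist o x := by
  by_contra! hcon
  refine hnc ((isCompact_closedBall o m).of_isClosed_subset isClosed_univ fun x _ => ?_)
  rw [Metric.mem_closedBall, dist_comm]
  exact (hcon x).le

theorem nonempty [ProperSpace X] (hnc : ¬ IsCompact (univ : Set X)) (o : X) :
    Nonempty (raysFrom o) := by
  obtain ⟨m, hm⟩ := exists_radial_near o 0 one_pos
  obtain ⟨x, hx⟩ := exists_dist_ge hnc o m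
  obtain ⟨δ, -⟩ := hm x hx
  exact ⟨δ⟩

theorem preconnectedSpace [ProperSpace X] (hone : HasOneEnd X) (o : X) :
    PreconnectedSpace (raysFrom o) := by
  rw [preconnectedSpace_iff_clopen]
  by_contra! hcon
  obtain ⟨A, hA, hne, huniv⟩ := hcon
  obtain ⟨δ, hδ⟩ := hne
  obtain ⟨δ', hδ'⟩ := (ne_univ_iff_exists_notMem A).1 huniv
  obtain ⟨j, hj⟩ := exists_nat_of_disjoint_diagonal (K := A ×ˢ Aᶜ)
    (hA.1.prod hA.compl.1) (fun p hp h => hp.2 (h ▸ hp.1))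
  set e : ℝ := 1 / ((j : ℝ) + 1) / 2 with he
  have he0 : 0 < e := by positivity
  obtain ⟨m, hm⟩ := exists_radial_near o j he0
  obtain ⟨K', hK', hsub, hconn⟩ := hone.2 _ (isCompact_closedBall o m)
  obtain ⟨T, hT⟩ := hK'.isBounded.subset_closedBall o
  set T' : ℝ := max j (max T m + 1) with hT'
  have hT1 : (j : ℝ) ≤ T' := le_max_left _ _
  have hT2 : max T m + 1 ≤ T' := le_max_right _ _
  have hT3 := le_max_left T m
  have hT4 := le_max_right T m
  have hj0 : (0 : ℝ) ≤ j := by positivity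
  have hout : ∀ f : raysFrom o, f.1 T' ∈ K'ᶜ := fun f hf => by
    have := hT hf
    rw [Metric.mem_closedBall, dist_comm, dist_left f (hj0.trans hT1)] at this
    linarith
  have hcompl : K'ᶜ ⊆ (Metric.closedBall o m)ᶜ := compl_subset_compl.2 hsub
  set C := connectedComponentIn (Metric.closedBall o m)ᶜ (δ.1 T') with hC
  have h1 : δ.1 T' ∈ C := mem_connectedComponentIn (hcompl (hout δ))
  have h2 : δ'.1 T' ∈ C := by
    rw [hC, hconn _ (hout δ) _ (hout δ')]
    exact mem_connectedComponentIn (hcompl (hout δ'))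
  let P : Set (raysFrom o) → Set X := fun B => {z | ∃ f ∈ B, dist (radial o z j) (f.1 j) < e}
  have hPo : ∀ B, IsOpen (P B) := by
    intro B
    have : P B = ⋃ f ∈ B, {z | dist (radial o z j) (f.1 j) < e} := by
      ext z
      simp [P]
    rw [this]
    exact isOpen_biUnion fun f _ => isOpen_lt
      ((Continuous.radial o continuous_id continuous_const).dist continuous_const) continuous_const
  have hPm : ∀ B, ∀ f ∈ B, f.1 T' ∈ P B := fun B f hf => ⟨f, hf, by
    rw [radial_apply f hj0 hT1, dist_self]
    exact he0⟩
  have hdisj : Disjoint (P A) (P Aᶜ) := by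
    rw [Set.disjoint_left]
    rintro z ⟨f, hf, hfd⟩ ⟨g, hg, hgd⟩
    have h3 := hj (f, g) ⟨hf, hg⟩
    have h4 := dist_triangle_left (f.1 j) (g.1 j) (radial o z j)
    simp only at h3
    linarith
  have hcover : C ⊆ P A ∪ P Aᶜ := by
    intro z hz
    have hzm := connectedComponentIn_subset _ _ hz
    rw [mem_compl_iff, Metric.mem_closedBall, not_le, dist_comm] at hzm
    obtain ⟨f, hf⟩ := hm z hzm.le
    by_cases hfA : f ∈ A
    · exact Or.inl ⟨f, hfA, hf⟩
    · exact Or.inr ⟨f, hfA, hf⟩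
  rcases isPreconnected_connectedComponentIn.subset_or_subset (hPo A) (hPo Aᶜ) hdisj hcover with
    h | h
  · exact Set.disjoint_left.1 hdisj (h h2) (hPm _ δ' hδ')
  · exact Set.disjoint_left.1 hdisj (hPm _ δ hδ) (h h1)

end

end raysFrom

end RaySpace

section Deep

open CategoryTheory

variable {X : Type*} [TopologicalSpace X] {U V W : Set X}

/-- A morphism of the fundamental groupoid of `U` is deep in `V` if it is represented by a path
with values in `V`. -/
def IsDeep (V : Set X) {x y : X} {hx : x ∈ U} {hy : y ∈ U}
    (E : fgPt U x hx ⟶ fgPt U y hy) : Prop :=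
  ∃ (p : Path x y) (h : ∀ t, p t ∈ U), (∀ t, p t ∈ V) ∧ E = fgCls p h

theorem isDeep_fgCls {x y : X} {p : Path x y} (h : ∀ t, p t ∈ U) (hV : ∀ t, p t ∈ V) :
    IsDeep V (fgCls p h) :=
  ⟨p, h, hV, rfl⟩

theorem IsDeep.comp {x y z : X} {hx : x ∈ U} {hy : y ∈ U} {hz : z ∈ U}
    {E : fgPt U x hx ⟶ fgPt U y hy} {F : fgPt U y hy ⟶ fgPt U z hz} (hE : IsDeep V E)
    (hF : IsDeep V F) : IsDeep V (E ≫ F) := by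
  obtain ⟨p, hp, hpV, rfl⟩ := hE
  obtain ⟨q, hq, hqV, rfl⟩ := hF
  exact ⟨p.trans q, Path.trans_mem hp hq, Path.trans_mem hpV hqV, (fgCls_trans hp hq).symm⟩

theorem IsDeep.inv {x y : X} {hx : x ∈ U} {hy : y ∈ U} {E : fgPt U x hx ⟶ fgPt U y hy}
    (hE : IsDeep V E) : IsDeep V (Groupoid.inv E) := by
  obtain ⟨p, hp, hpV, rfl⟩ := hE
  exact ⟨p.symm, Path.symm_mem hp, Path.symm_mem hpV, (fgCls_symm hp).symm⟩

theorem IsDeep.mono {x y : X} {hx : x ∈ U} {hy : y ∈ U} {E : fgPt U x hx ⟶ fgPt U y hy}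
    (hE : IsDeep V E) (h : V ⊆ W) : IsDeep W E := by
  obtain ⟨p, hp, hpV, rfl⟩ := hE
  exact ⟨p, hp, fun t => h (hpV t), rfl⟩

end Deep

section Jumps

open CategoryTheory

variable {X : Type*} [MetricSpace X] [Fact (IsCAT0Space X)] {o p q r : X} {n : ℕ}

omit [Fact (IsCAT0Space X)] in
theorem mem_outside_of_dist_le {r : ℝ} (hp : r + 1 < dist o p) (h : dist p q ≤ 1) :
    q ∈ outside o r := by
  rw [outside, mem_ofPred_eq]
  linarith [dist_triangle o q p, dist_comm q p]

theorem geoArc_mem {r : ℝ} (hp : r + 1 < dist o p) (h : dist p q ≤ 1) (t : I) :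
    arc (geo p q) (continuous_const.geo continuous_const continuous_id) 0 1 (geo_zero _ _)
      (geo_one _ _) t ∈ outside o r :=
  mem_outside_of_dist_le hp ((dist_left_geo_le _ _ _).trans h)

omit [Fact (IsCAT0Space X)] in
theorem mem_outside_of_add_one_lt (hp : (n : ℝ) + 1 < dist o p) : p ∈ outside o n :=
  mem_outside_of_dist_le hp (by simp)

/-- The class of the geodesic from `p` to a point `q` at distance at most `1`. -/
noncomputable def jump (hp : (n : ℝ) + 1 < dist o p) (h : dist p q ≤ 1) :
    fgPt (outside o n) p (mem_outside_of_add_one_lt hp) ⟶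
      fgPt (outside o n) q (mem_outside_of_dist_le hp h) :=
  fgCls (arc (geo p q) (continuous_const.geo continuous_const continuous_id) 0 1 (geo_zero _ _)
    (geo_one _ _)) (geoArc_mem hp h)

theorem fgCls_eq_jump (hp : (n : ℝ) + 1 < dist o p) (h : dist p q ≤ 1) {c : Path p q}
    (hc : ∀ t, dist p (c t) ≤ 1) (hU : ∀ t, c t ∈ outside o n) : fgCls c hU = jump hp h :=
  fgCls_eq_of_geo_mem _ _ fun _ _ => mem_outside_of_dist_le hp (dist_geo_point_le _ _ _ (hc _)
    ((dist_left_geo_le _ _ _).trans h))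

theorem jump_trans (hp : (n : ℝ) + 1 < dist o p) (hq : (n : ℝ) + 1 < dist o q)
    (h : dist p q ≤ 1) (h' : dist q r ≤ 1) (h'' : dist p r ≤ 1) :
    jump hp h ≫ jump hq h' = jump hp h'' := by
  rw [jump, jump, ← fgCls_trans]
  refine fgCls_eq_jump hp h'' (fun t => ?_) _
  rw [Path.trans_apply]
  split_ifs
  · exact (dist_left_geo_le _ _ _).trans h
  · exact dist_geo_point_le _ _ _ h h''

theorem inv_jump (hp : (n : ℝ) + 1 < dist o p) (hq : (n : ℝ) + 1 < dist o q)
    (h : dist p q ≤ 1) (h' : dist q p ≤ 1) : Groupoid.inv (jump hp h) = jump hq h' := by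
  rw [jump, ← fgCls_symm]
  exact fgCls_eq_jump hq h' (fun t => dist_geo_point_le _ _ _ h' (by simp)) _

theorem isDeep_jump {r : ℝ} (hp : (n : ℝ) + 1 < dist o p) (h : dist p q ≤ 1)
    (hr : r + 1 < dist o p) : IsDeep (outside o r) (jump hp h) :=
  isDeep_fgCls _ (geoArc_mem hr h)

end Jumps

namespace raysFrom

open CategoryTheory

variable {X : Type*} [MetricSpace X] {o : X} {n : ℕ}

theorem mem_outside_nat (x : raysFrom o) {s : ℝ} (hs : n < s) : x.1 s ∈ outside o n :=
  mem_outside x ((Nat.cast_nonneg n).trans hs.le) hs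

/-- The class of the part of the ray `x` between times `s` and `t`. -/
noncomputable def piece (x : raysFrom o) {s t : ℝ} (hs : n < s) (ht : n < t) :
    fgPt (outside o n) (x.1 s) (mem_outside_nat x hs) ⟶
      fgPt (outside o n) (x.1 t) (mem_outside_nat x ht) :=
  fgCls (arc x.1 (continuous x) s t rfl rfl)
    (arc_mem ordConnected_Ioi hs ht fun _ h => mem_outside_nat x h)

theorem piece_trans (x : raysFrom o) {s t u : ℝ} (hs : n < s) (ht : n < t) (hu : n < u) :
    piece x hs ht ≫ piece x ht hu = piece x hs hu :=
  arc_trans ordConnected_Ioi hs ht hu fun _ h => mem_outside_nat x h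

theorem piece_self (x : raysFrom o) {s : ℝ} (hs : n < s) : piece x hs hs = 𝟙 _ := by
  rw [← fgCls_refl (fun _ => mem_outside_nat x hs)]
  exact fgCls_congr (arc_refl _ _ _) _ _

theorem piece_trans_assoc (x : raysFrom o) {s t u : ℝ} (hs : n < s) (ht : n < t) (hu : n < u)
    {z : FundamentalGroupoid (outside o n)} (E : fgPt (outside o n) (x.1 u) (mem_outside_nat x
        hu) ⟶ z) :
    piece x hs ht ≫ piece x ht hu ≫ E = piece x hs hu ≫ E := by
  rw [← Category.assoc, piece_trans]

theorem inv_piece (x : raysFrom o) {s t : ℝ} (hs : n < s) (ht : n < t) :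
    Groupoid.inv (piece x hs ht) = piece x ht hs := by
  rw [piece, ← fgCls_symm]
  exact fgCls_congr (arc_symm _ _ _) _ _

theorem isDeep_piece (x : raysFrom o) {s t r : ℝ} (hs : n < s) (ht : n < t) (hrs : r < s)
    (hrt : r < t) : IsDeep (outside o r) (piece x hs ht) :=
  isDeep_fgCls _ (arc_mem (J := Ioi r ∩ Ioi n) (ordConnected_Ioi.inter ordConnected_Ioi) ⟨hrs,
      hs⟩ ⟨hrt, ht⟩
    fun _ h => mem_outside x ((Nat.cast_nonneg n).trans (le_of_lt h.2)) h.1)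

end raysFrom

namespace raysFrom

open CategoryTheory

variable {X : Type*} [MetricSpace X] [Fact (IsCAT0Space X)] {o : X} {n : ℕ} {M : ℝ}

omit [Fact (IsCAT0Space X)] in
theorem add_one_lt_dist (hM : (n : ℝ) + 1 < M) (x : raysFrom o) : (n : ℝ) + 1 < dist o (x.1 M) := by
  rwa [dist_left x]
  linarith [n.cast_nonneg (α := ℝ)]

theorem lt_level (hM : (n : ℝ) + 1 < M) (k : ℕ) : (n : ℝ) < M + k := by
  linarith [k.cast_nonneg (α := ℝ)]

theorem lt_base (hM : (n : ℝ) + 1 < M) : (n : ℝ) < M := by linarith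

/-- Two rays close to each other at time `M` are linked at depth `k` if going inwards along
one of them, jumping to the other one and going outwards can be done deep outside. -/
def Linked (hM : (n : ℝ) + 1 < M) (k : ℕ) (x y : raysFrom o) : Prop :=
  ∃ h : dist (x.1 M) (y.1 M) ≤ 1, IsDeep (outside o (n + k))
    (piece x (lt_level hM k) (lt_base hM) ≫ jump (add_one_lt_dist hM x) h ≫
      piece y (lt_base hM) (lt_level hM k))

theorem Linked.symm {hM : (n : ℝ) + 1 < M} {k : ℕ} {x y : raysFrom o} (h : Linked hM k x y) :
    Linked hM k y x := by
  obtain ⟨h, hd⟩ := h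
  refine ⟨by rwa [dist_comm], ?_⟩
  have := hd.inv
  simp only [Groupoid.inv_eq_inv, IsIso.inv_comp, Category.assoc] at this
  simp only [← Groupoid.inv_eq_inv, inv_piece] at this
  rwa [inv_jump _ (add_one_lt_dist hM y) h (by rwa [dist_comm])] at this

theorem Linked.trans {hM : (n : ℝ) + 1 < M} {k : ℕ} {x y z : raysFrom o} (h : Linked hM k x y)
    (h' : Linked hM k y z) (h'' : dist (x.1 M) (z.1 M) ≤ 1) : Linked hM k x z := by
  obtain ⟨h, hd⟩ := h
  obtain ⟨h', hd'⟩ := h'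
  refine ⟨h'', ?_⟩
  have := hd.comp hd'
  simp only [Category.assoc, piece_trans_assoc, piece_self, Category.id_comp] at this
  rwa [← Category.assoc (jump _ _), jump_trans _ _ _ _ h''] at this

theorem Linked.anti {hM : (n : ℝ) + 1 < M} {k : ℕ} {x y : raysFrom o}
    (h : Linked hM (k + 1) x y) : Linked hM k x y := by
  obtain ⟨h, hd⟩ := h
  refine ⟨h, ?_⟩
  have hx : ∀ z : raysFrom o, IsDeep (outside o (n + k))
      (piece z (lt_level hM k) (lt_level hM (k + 1))) := fun z =>
    isDeep_piece z _ _ (by linarith) (by push_cast; linarith)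
  have := ((hx x).comp (hd.mono (outside_anti o (by push_cast; linarith)))).comp (hx y).inv
  simpa only [Category.assoc, piece_trans_assoc, piece_self, inv_piece, piece_trans] using this

theorem dist_geo_rays_le (x y : raysFrom o) {s t τ : ℝ} (hs : 0 ≤ s) (hst : s ≤ t)
    (h : dist (x.1 t) (y.1 t) ≤ 1) : dist (x.1 s) (geo (x.1 s) (y.1 s) τ) ≤ 1 :=
  (dist_left_geo_le _ _ _).trans ((dist_mono x y hs hst).trans h)

/-- Jumps between two rays at different times are conjugate. -/
theorem piece_jump (x y : raysFrom o) {s t : ℝ} (hs : (n : ℝ) + 1 < s) (ht : (n : ℝ) + 1 < t)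
    (h : dist (x.1 s) (y.1 s) ≤ 1) (h' : dist (x.1 t) (y.1 t) ≤ 1) :
    piece x (lt_base hs) (lt_base ht) ≫ jump (add_one_lt_dist ht x) h' =
      jump (add_one_lt_dist hs x) h ≫ piece y (lt_base hs) (lt_base ht) := by
  have hG : Continuous fun p : ℝ × ℝ => geo (x.1 p.1) (y.1 p.1) p.2 :=
    ((continuous x).comp continuous_fst).geo ((continuous y).comp continuous_fst) continuous_snd
  have hmax : dist (x.1 (max s t)) (y.1 (max s t)) ≤ 1 := by
    rcases le_total s t with hst | hst
    · rwa [max_eq_right hst]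
    · rwa [max_eq_left hst]
  have hn := n.cast_nonneg (α := ℝ)
  have key := arc_square (G := fun u τ => geo (x.1 u) (y.1 u) τ) hG (U := outside o n) (a := s)
      (b := t) (c := 0) (d := 1)
    (geo_zero _ _) (geo_zero _ _) (geo_one _ _) (geo_one _ _) (J := Ioc ((n : ℝ) + 1) (max s t))
    (K := univ) ordConnected_Ioc ordConnected_univ ⟨hs, le_max_left _ _⟩ ⟨ht, le_max_right _ _⟩
    trivial trivial (fun u hu τ _ => mem_outside_of_dist_le (add_one_lt_dist hu.1 x)
      (dist_geo_rays_le x y (by linarith [hu.1]) hu.2 hmax))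
  have e0 : ∀ hh, fgCls (arc (fun s => geo (x.1 s) (y.1 s) 0) (continuous_slice_left hG 0) s t
      (geo_zero _ _) (geo_zero _ _)) hh = piece x (lt_base hs) (lt_base ht) := fun _ =>
    fgCls_congr (arc_congr ordConnected_univ trivial trivial fun _ _ => geo_zero _ _) _ _
  have e1 : ∀ hh, fgCls (arc (fun s => geo (x.1 s) (y.1 s) 1) (continuous_slice_left hG 1) s t
      (geo_one _ _) (geo_one _ _)) hh = piece y (lt_base hs) (lt_base ht) := fun _ =>
    fgCls_congr (arc_congr ordConnected_univ trivial trivial fun _ _ => geo_one _ _) _ _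
  rw [e0, e1] at key
  exact key

theorem linked_of_dist_le (hM : (n : ℝ) + 1 < M) {k : ℕ} {x y : raysFrom o}
    (h : dist (x.1 (M + k)) (y.1 (M + k)) ≤ 1) : Linked hM k x y := by
  have hk := k.cast_nonneg (α := ℝ)
  have hn := n.cast_nonneg (α := ℝ)
  have h' : dist (x.1 M) (y.1 M) ≤ 1 :=
    (dist_mono x y (by linarith) (by linarith)).trans h
  refine ⟨h', ?_⟩
  have hT : (n : ℝ) + 1 < M + k := by linarith
  rw [← Category.assoc, piece_jump x y hT hM h h', Category.assoc, piece_trans, piece_self,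
    Category.comp_id]
  refine isDeep_jump _ _ ?_
  rw [dist_left x (by linarith)]
  linarith

end raysFrom

section Countable

open CategoryTheory

variable {X : Type*} [MetricSpace X] [Fact (IsCAT0Space X)] [ProperSpace X] {U : Set X}

/-- The homotopy classes of paths between two points of an open set of a proper CAT(0) space form
a countable set. -/
theorem countable_fgPt_hom (hU : IsOpen U) {x y : X} (hx : x ∈ U) (hy : y ∈ U) :
    Countable (fgPt U x hx ⟶ fgPt U y hy) := by
  let S := {g : C(I, X) // g 0 = x ∧ g 1 = y ∧ ∀ t, g t ∈ U}
  let toPath : S → Path x y := fun g => ⟨g.1, g.2.1, g.2.2.1⟩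
  let f : S → (fgPt U x hx ⟶ fgPt U y hy) := fun g => fgCls (toPath g) g.2.2.2
  have hloc : ∀ g : S, ∃ ε > 0, ∀ g' : S, dist g g' < ε → f g = f g' := by
    intro g
    obtain ⟨ε, hε, h⟩ := (isCompact_range g.1.continuous).exists_thickening_subset_open hU
      (range_subset_iff.2 g.2.2.2)
    refine ⟨ε, hε, fun g' hg' => fgCls_eq_of_geo_mem _ _ fun s τ => h ?_⟩
    refine Metric.mem_thickening_iff.2 ⟨g.1 s, mem_range_self _, ?_⟩
    rw [dist_comm]
    refine (dist_left_geo_le _ _ _).trans_lt ?_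
    exact (ContinuousMap.dist_apply_le_dist (f := g.1) (g := g'.1) s).trans_lt hg'
  obtain ⟨D, hDc, hD⟩ := TopologicalSpace.exists_countable_dense S
  have hsurj : SurjOn f D univ := by
    intro E _
    obtain ⟨p, hp, rfl⟩ := exists_fgCls E
    let g : S := ⟨⟨p, p.continuous⟩, p.source, p.target, hp⟩
    obtain ⟨ε, hε, h⟩ := hloc g
    obtain ⟨g', hg', hd⟩ := Metric.dense_iff.1 hD g ε hε
    exact ⟨g', hd, (h g' (by rwa [dist_comm])).symm⟩
  have := hDc.image f
  rw [← countable_univ_iff]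
  exact this.mono hsurj

end Countable

theorem exists_dist_lt_of_continuous {R Y : Type*} [MetricSpace R] [CompactSpace R]
    [MetricSpace Y] {f : R → Y} (hf : Continuous f) {ε : ℝ} (hε : 0 < ε) :
    ∃ δ > 0, ∀ x y, dist x y < δ → dist (f x) (f y) < ε := by
  obtain ⟨δ, hδ, H⟩ := Metric.uniformContinuous_iff.1
    (CompactSpace.uniformContinuous_of_continuous hf) ε hε
  exact ⟨δ, hδ, fun x y hxy => H hxy⟩

namespace raysFrom

open CategoryTheory

variable {X : Type*} [MetricSpace X] {o : X} {n : ℕ} {M : ℝ}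

/-- An element of `raysFrom o` as a geodesic ray. -/
def toGeodesicRay (x : raysFrom o) : GeodesicRay X where
  toFun t := x.1 t
  isometry s t := dist_eq x s.2 t.2

theorem exists_homotopy [ProperSpace X]
    (h : ∀ γ γ' : GeodesicRay X, ProperlyHomotopic γ.toFun γ'.toFun) (x y : raysFrom o) :
    ∃ H : ℝ → ℝ → X, (Continuous fun p : ℝ × ℝ => H p.1 p.2) ∧ (∀ t, H t 0 = x.1 t) ∧
      (∀ t, H t 1 = y.1 t) ∧ ∀ r, ∃ T, ∀ t, T ≤ t → ∀ s, H t s ∈ outside o r := by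
  obtain ⟨H, hH, hp, h0, h1⟩ := h (toGeodesicRay x) (toGeodesicRay y)
  refine ⟨fun t s => H (t.toNNReal, projIcc 0 1 zero_le_one s),
    hH.comp ((continuous_real_toNNReal.comp continuous_fst).prodMk
      (continuous_projIcc.comp continuous_snd)), fun t => ?_, fun t => ?_, fun r => ?_⟩
  · beta_reduce
    rw [projIcc_left]
    exact (h0 _).trans (by simp [toGeodesicRay, max_comm t, apply_clamp])
  · beta_reduce
    rw [projIcc_right]
    exact (h1 _).trans (by simp [toGeodesicRay, max_comm t, apply_clamp])
  · obtain ⟨b, hb⟩ := ((hp _ (isCompact_closedBall o r)).image continuous_fst).bddAbove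
    refine ⟨b + 1, fun t ht s => ?_⟩
    by_contra hcon
    have hmem : H (t.toNNReal, projIcc 0 1 zero_le_one s) ∈ Metric.closedBall o r := by
      rw [Metric.mem_closedBall, dist_comm]
      exact not_lt.1 hcon
    have h2 : t.toNNReal ≤ b := hb ⟨_, hmem, rfl⟩
    have h3 : t ≤ b := (Real.le_coe_toNNReal t).trans (by exact_mod_cast h2)
    linarith

variable [Fact (IsCAT0Space X)]

omit [Fact (IsCAT0Space X)] in
theorem exists_connecting [ProperSpace X]
    (h : ∀ γ γ' : GeodesicRay X, ProperlyHomotopic γ.toFun γ'.toFun)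
    (hM : (n : ℝ) + 1 < M) (x y : raysFrom o) :
    ∃ α : fgPt (outside o n) (x.1 M) (mem_outside_nat x (lt_base hM)) ⟶
        fgPt (outside o n) (y.1 M) (mem_outside_nat y (lt_base hM)),
      ∀ k : ℕ, IsDeep (outside o (n + k)) (piece x (lt_level hM k) (lt_base hM) ≫ α ≫
        piece y (lt_base hM) (lt_level hM k)) := by
  obtain ⟨H, hH, h0, h1, hp⟩ := exists_homotopy h x y
  obtain ⟨T₀, hT₀⟩ := hp n
  set S := max T₀ M with hS
  have hS1 : T₀ ≤ S := le_max_left _ _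
  have hS2 : M ≤ S := le_max_right _ _
  have hS' : (n : ℝ) < S := by linarith
  have hU : ∀ t, S ≤ t → ∀ s, H t s ∈ outside o n := fun t ht => hT₀ t (hS1.trans ht)
  let level : ∀ t, ∀ ht : S ≤ t, (fgPt (outside o n) (x.1 t) (mem_outside_nat x (hS'.trans_le ht)) ⟶
      fgPt (outside o n) (y.1 t) (mem_outside_nat y (hS'.trans_le ht))) := fun t ht =>
    fgCls (arc (H t) (continuous_slice_right hH t) 0 1 (h0 t) (h1 t)) fun _ => hU t ht _
  have hsq : ∀ t (ht : S ≤ t), level S le_rfl = piece x hS' (hS'.trans_le ht) ≫ level t ht ≫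
      piece y (hS'.trans_le ht) hS' := by
    intro t ht
    have key := arc_square hH (U := outside o n) (h0 S) (h0 t) (h1 S) (h1 t) (J := Ici S)
      (K := univ) ordConnected_Ici ordConnected_univ self_mem_Ici ht trivial trivial
      (fun u hu τ _ => hU u hu τ)
    have e0 : ∀ hh, fgCls (arc (fun s => H s 0) (continuous_slice_left hH 0) S t
        (h0 S) (h0 t)) hh = piece x hS' (hS'.trans_le ht) := fun _ =>
      fgCls_congr (arc_congr ordConnected_univ trivial trivial fun _ _ => h0 _) _ _
    have e1 : ∀ hh, fgCls (arc (fun s => H s 1) (continuous_slice_left hH 1) S t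
        (h1 S) (h1 t)) hh = piece y hS' (hS'.trans_le ht) := fun _ =>
      fgCls_congr (arc_congr ordConnected_univ trivial trivial fun _ _ => h1 _) _ _
    rw [e0, e1] at key
    change _ ≫ level t ht = level S le_rfl ≫ _ at key
    rw [← Category.assoc, key, Category.assoc, piece_trans, piece_self, Category.comp_id]
  refine ⟨piece x (lt_base hM) hS' ≫ level S le_rfl ≫ piece y hS' (lt_base hM), fun k => ?_⟩
  obtain ⟨T₁, hT₁⟩ := hp (n + k)
  set T := max T₁ (max S (M + k)) with hT
  have hT2 : T₁ ≤ T := le_max_left _ _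
  have hT3 : S ≤ T := (le_max_left _ _).trans (le_max_right _ _)
  have hT4 : M + k ≤ T := (le_max_right _ _).trans (le_max_right _ _)
  have hT' := hS'.trans_le hT3
  have e : piece x (lt_level hM k) (lt_base hM) ≫ (piece x (lt_base hM) hS' ≫ level S le_rfl ≫
      piece y hS' (lt_base hM)) ≫ piece y (lt_base hM) (lt_level hM k) =
      piece x (lt_level hM k) hT' ≫ level T hT3 ≫ piece y hT' (lt_level hM k) := by
    rw [hsq T hT3]
    simp only [Category.assoc, piece_trans_assoc, piece_trans]
  rw [e]
  have hlt : (n : ℝ) + k < M + k := by linarith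
  exact (isDeep_piece x _ _ hlt (hlt.trans_le hT4)).comp
    ((isDeep_fgCls _ fun _ => hT₁ T hT2 _).comp (isDeep_piece y _ _ (hlt.trans_le hT4) hlt))

theorem exists_linked_of_dist_lt [ProperSpace X] (hone : HasOneEnd X)
    (h : ∀ γ γ' : GeodesicRay X, ProperlyHomotopic γ.toFun γ'.toFun)
    (o : X) (hM : (n : ℝ) + 1 < M) :
    ∃ M₁, M ≤ M₁ ∧ ∃ ε, 0 < ε ∧ ε ≤ 1 ∧ ∀ x y : raysFrom o, dist (x.1 M₁) (y.1 M₁) < ε →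
      ∀ k, Linked hM k x y := by
  let _ : MetricSpace (raysFrom o) := TopologicalSpace.metrizableSpaceMetric _
  have := preconnectedSpace hone o
  obtain ⟨x₀⟩ := nonempty hone.1 o
  have hunif : ∀ t : ℝ, ∃ ε > 0, ∀ x y : raysFrom o, dist x y < ε →
      dist (x.1 t) (y.1 t) < 1 := fun t =>
    exists_dist_lt_of_continuous (continuous_eval_left (o := o) t) one_pos
  obtain ⟨ε₀, hε₀, hclose⟩ := hunif M
  have hrel : IsDeepRelation ε₀ (Linked (o := o) hM) := by
    refine ⟨hε₀, fun k x y _ h => h.symm, fun k x y z _ _ hxz h h' => h.trans h' (hclose x z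
        hxz).le,
      fun k x y h => h.anti, fun k => ?_, fun δ => ?_⟩
    · obtain ⟨η, hη, H⟩ := hunif (M + k)
      exact ⟨η, hη, fun x y hxy => linked_of_dist_le hM (H x y hxy).le⟩
    · choose α hα using exists_connecting h hM x₀
      have hN : {y : raysFrom o | dist (y.1 M) (δ.1 M) < 1 / 2} ∈ 𝓝 δ :=
        (isOpen_lt ((continuous_eval_left M).dist continuous_const) continuous_const).mem_nhds
          (by simp)
      have hd : ∀ y : raysFrom o, dist (y.1 M) (δ.1 M) < 1 / 2 → dist (y.1 M) (δ.1 M) ≤ 1 :=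
        fun y hy => by linarith
      have := countable_fgPt_hom (isOpen_outside o n) (mem_outside_nat x₀ (lt_base hM))
        (mem_outside_nat δ (lt_base hM))
      obtain ⟨f, hf⟩ := exists_injective_nat
        (fgPt (outside o n) (x₀.1 M) (mem_outside_nat x₀ (lt_base hM)) ⟶
          fgPt (outside o n) (δ.1 M) (mem_outside_nat δ (lt_base hM)))
      classical
      refine ⟨_, hN, fun y => if hy : dist (y.1 M) (δ.1 M) < 1 / 2 then
        f (α y ≫ jump (add_one_lt_dist hM y) (hd y hy)) else 0, fun y hy y' hy' hyy' k => ?_⟩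
      rw [mem_ofPred_eq] at hy hy'
      simp only [dif_pos hy, dif_pos hy'] at hyy'
      have heq := hf hyy'
      have hdist : dist (y.1 M) (y'.1 M) ≤ 1 := by
        linarith [dist_triangle_right (y.1 M) (y'.1 M) (δ.1 M)]
      have hδ' : dist (δ.1 M) (y'.1 M) ≤ 1 := by
        rw [dist_comm]
        exact hd y' hy'
      refine ⟨hdist, ?_⟩
      have e : jump (add_one_lt_dist hM y) hdist = Groupoid.inv (α y) ≫ α y' := by
        rw [← jump_trans (add_one_lt_dist hM y) (add_one_lt_dist hM δ) (hd y hy) hδ' hdist,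
          ← inv_jump (add_one_lt_dist hM y') (add_one_lt_dist hM δ) (hd y' hy') hδ']
        rw [Groupoid.inv_eq_inv, Groupoid.inv_eq_inv, IsIso.eq_inv_comp, ← Category.assoc,
          IsIso.comp_inv_eq]
        exact heq
      have := (hα y k).inv.comp (hα y' k)
      simp only [Groupoid.inv_eq_inv, IsIso.inv_comp, Category.assoc] at this
      simp only [← Groupoid.inv_eq_inv, inv_piece, piece_trans_assoc, piece_self,
        Category.id_comp] at this
      rwa [e, Category.assoc]
  obtain ⟨η, hη, H⟩ := hrel.exists_uniform_univ
  obtain ⟨j, hj⟩ := exists_nat_of_disjoint_diagonal (o := o) (K := {p | η ≤ dist p.1 p.2})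
    (isClosed_le continuous_const (continuous_fst.dist continuous_snd)) (by
      rintro p hp heq
      rw [mem_ofPred_eq, heq, dist_self] at hp
      linarith)
  refine ⟨max M j, le_max_left _ _, 1 / (j + 1), by positivity, ?_, fun x y hxy => H x y ?_⟩
  · rw [div_le_one (by positivity)]
    linarith [j.cast_nonneg (α := ℝ)]
  · by_contra! hcon
    have h1 := hj (x, y) hcon
    have h2 := dist_mono x y (j.cast_nonneg (α := ℝ)) (le_max_right M j)
    simp only at h1
    linarith

end raysFrom

namespace raysFrom

open CategoryTheory

variable {X : Type*} [MetricSpace X] [Fact (IsCAT0Space X)] {o : X} {n : ℕ} {M D : ℝ}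

theorem mem_outside_radial {p : X} {r s : ℝ} (hr : 0 ≤ r) (hp : r < dist o p) (hs : r < s) :
    radial o p s ∈ outside o r := by
  rw [outside, mem_ofPred_eq, dist_left_radial _ _ (hr.trans hs.le)]
  exact lt_min hp hs

/-- The class of the geodesic from `p` towards `o`, stopped at distance `s` from `o`. -/
noncomputable def inward {p : X} {s : ℝ} (hp : (n : ℝ) < dist o p) (hD : dist o p ≤ D)
    (hs : (n : ℝ) < s) :
    fgPt (outside o n) p hp ⟶
      fgPt (outside o n) (radial o p s) (mem_outside_radial n.cast_nonneg hp hs) :=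
  fgCls (arc (radial o p) (continuous_const.radial o continuous_id) D s (radial_of_le _ _ hD) rfl)
    (arc_mem ordConnected_Ioi (hp.trans_le hD) hs
      fun _ h => mem_outside_radial n.cast_nonneg hp h)

theorem isDeep_inward {p : X} {s r : ℝ} (hp : (n : ℝ) < dist o p) (hD : dist o p ≤ D)
    (hs : (n : ℝ) < s) (hr : 0 ≤ r) (hrp : r < dist o p) (hrs : r < s) :
    IsDeep (outside o r) (inward hp hD hs) :=
  isDeep_fgCls _ (arc_mem ordConnected_Ioi (hrp.trans_le hD) hrs
    fun _ h => mem_outside_radial hr hrp h)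

theorem add_one_lt_dist_radial (hM : (n : ℝ) + 1 < M) {p : X} (hp : M ≤ dist o p) :
    (n : ℝ) + 1 < dist o (radial o p M) := by
  have hn := n.cast_nonneg (α := ℝ)
  rwa [dist_left_radial _ _ (by linarith), min_eq_right hp]

omit [Fact (IsCAT0Space X)] in
theorem lt_dist (hM : (n : ℝ) + 1 < M) {p : X} (hp : M ≤ dist o p) : (n : ℝ) < dist o p := by
  linarith

theorem arc_comp_inward {f : ℝ → X} (hf : Continuous f) {s s' t : ℝ} {J : Set ℝ}
    (hJ : J.OrdConnected) (hs : s ∈ J) (hs' : s' ∈ J)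
    (hfJ : ∀ u ∈ J, (n : ℝ) < dist o (f u) ∧ dist o (f u) ≤ D) (ht : (n : ℝ) < t) :
    fgCls (U := outside o n) (arc f hf s s' rfl rfl) (arc_mem hJ hs hs' fun u hu => (hfJ u hu).1) ≫
      inward (hfJ s' hs').1 (hfJ s' hs').2 ht =
    inward (hfJ s hs).1 (hfJ s hs).2 ht ≫
      fgCls (arc (fun u => radial o (f u) t) (hf.radial o continuous_const) s s' rfl rfl)
        (arc_mem hJ hs hs' fun u hu => mem_outside_radial n.cast_nonneg (hfJ u hu).1 ht) := by
  have hG : Continuous fun p : ℝ × ℝ => radial o (f p.1) p.2 :=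
    (hf.comp continuous_fst).radial o continuous_snd
  have key := arc_square (G := fun u τ => radial o (f u) τ) hG (U := outside o n)
    (radial_of_le _ _ (hfJ s hs).2) (radial_of_le _ _ (hfJ s' hs').2) rfl rfl hJ ordConnected_Ioi
    hs hs' ((hfJ s hs).1.trans_le (hfJ s hs).2) ht
    (fun u hu τ hτ => mem_outside_radial n.cast_nonneg (hfJ u hu).1 hτ)
  refine Eq.trans ?_ key
  congr 1
  exact fgCls_congr (arc_congr hJ hs hs' fun u hu => (radial_of_le _ _ (hfJ u hu).2).symm) _ _

theorem inward_comp_jump (hM : (n : ℝ) + 1 < M) {T : ℝ} (hMT : M ≤ T) {p : X} (hD : dist o p ≤ D)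
    (hp : T ≤ dist o p) (δ : raysFrom o) (h : dist (radial o p M) (δ.1 M) ≤ 1)
    (h' : dist (radial o p T) (δ.1 T) ≤ 1) :
    inward (lt_dist hM (hMT.trans hp)) hD (lt_base hM) ≫
      jump (add_one_lt_dist_radial hM (hMT.trans hp)) h =
    inward (lt_dist hM (hMT.trans hp)) hD (lt_base (hM.trans_le hMT)) ≫
      jump (add_one_lt_dist_radial (hM.trans_le hMT) hp) h' ≫
        piece δ (lt_base (hM.trans_le hMT)) (lt_base hM) := by
  have hn := n.cast_nonneg (α := ℝ)
  have hG : Continuous fun q : ℝ × ℝ => geo (radial o p q.1) (δ.1 q.1) q.2 :=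
    (continuous_const.radial o continuous_fst).geo ((continuous δ).comp continuous_fst)
      continuous_snd
  have key := arc_square (G := fun u τ => geo (radial o p u) (δ.1 u) τ) hG (U := outside o n)
    (geo_zero _ _) (geo_zero _ _) (geo_one _ _) (geo_one _ _) (J := Icc M T) (K := univ)
    ordConnected_Icc ordConnected_univ (left_mem_Icc.2 hMT) (right_mem_Icc.2 hMT) trivial trivial
    (fun u hu τ _ => mem_outside_of_dist_le
      (add_one_lt_dist_radial (hM.trans_le hu.1) (hu.2.trans hp))
      ((dist_left_geo_le _ _ _).trans
        ((radial_dist_mono p δ (by linarith [hu.1]) hu.2 hp).trans h')))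
  have hout : ∀ s ∈ Ioi (n : ℝ), radial o p s ∈ outside o n := fun s hs =>
    mem_outside_radial n.cast_nonneg (lt_dist hM (hMT.trans hp)) hs
  have e0 : ∀ hh, fgCls (arc (fun s => geo (radial o p s) (δ.1 s) 0) (continuous_slice_left hG 0)
      M T (geo_zero _ _) (geo_zero _ _)) hh = fgCls (arc (radial o p)
      (continuous_const.radial o continuous_id) M T rfl rfl)
      (arc_mem ordConnected_Ioi (lt_base hM) (lt_base (hM.trans_le hMT)) hout) := fun _ =>
    fgCls_congr (arc_congr ordConnected_univ trivial trivial fun _ _ => geo_zero _ _) _ _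
  have e1 : ∀ hh, fgCls (arc (fun s => geo (radial o p s) (δ.1 s) 1) (continuous_slice_left hG 1)
      M T (geo_one _ _) (geo_one _ _)) hh =
      piece δ (lt_base hM) (lt_base (hM.trans_le hMT)) := fun _ =>
    fgCls_congr (arc_congr ordConnected_univ trivial trivial fun _ _ => geo_one _ _) _ _
  rw [e0, e1] at key
  change _ ≫ jump (add_one_lt_dist_radial (hM.trans_le hMT) hp) h' =
    jump (add_one_lt_dist_radial hM (hMT.trans hp)) h ≫ _ at key
  have e2 := arc_trans (f := radial o p) (hf := continuous_const.radial o continuous_id)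
    (hx := radial_of_le _ _ hD) (hy := rfl) (hz := rfl) ordConnected_Ioi
    ((lt_dist hM (hMT.trans hp)).trans_le hD) (lt_base hM) (lt_base (hM.trans_le hMT)) hout
  change inward (lt_dist hM (hMT.trans hp)) hD (lt_base hM) ≫ _ =
    inward (lt_dist hM (hMT.trans hp)) hD (lt_base (hM.trans_le hMT)) at e2
  rw [← e2, Category.assoc, ← Category.assoc (fgCls _ _), key, Category.assoc, piece_trans,
    piece_self, Category.comp_id]

/-- The class of the curve going from `p` towards `o`, jumping to the ray `δ` at time `M` and
following that ray. -/
noncomputable def chord (hM : (n : ℝ) + 1 < M) {p : X} (hp : M ≤ dist o p) (hD : dist o p ≤ D)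
    (k : ℕ) (δ : raysFrom o) (h : dist (radial o p M) (δ.1 M) ≤ 1) :
    fgPt (outside o n) p (lt_dist hM hp) ⟶
      fgPt (outside o n) (δ.1 (M + k)) (mem_outside_nat δ (lt_level hM k)) :=
  inward (lt_dist hM hp) hD (lt_base hM) ≫ jump (add_one_lt_dist_radial hM hp) h ≫
    piece δ (lt_base hM) (lt_level hM k)

theorem arc_comp_chord (hM : (n : ℝ) + 1 < M) {f : ℝ → X} (hf : Continuous f) {s s' : ℝ}
    {J : Set ℝ} (hJ : J.OrdConnected) (hs : s ∈ J) (hs' : s' ∈ J)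
    (hfJ : ∀ u ∈ J, M ≤ dist o (f u) ∧ dist o (f u) ≤ D)
    (hclose : ∀ u ∈ J, dist (radial o (f s) M) (radial o (f u) M) ≤ 1) (k : ℕ)
    {δ δ' : raysFrom o} (h : dist (radial o (f s) M) (δ.1 M) ≤ 1)
    (h' : dist (radial o (f s') M) (δ'.1 M) ≤ 1) (h'' : dist (radial o (f s) M) (δ'.1 M) ≤ 1)
    (hδ : dist (δ.1 M) (δ'.1 M) ≤ 1) :
    fgCls (U := outside o n) (arc f hf s s' rfl rfl)
        (arc_mem hJ hs hs' fun u hu => lt_dist hM (hfJ u hu).1) ≫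
      chord hM (hfJ s' hs').1 (hfJ s' hs').2 k δ' h' =
    chord hM (hfJ s hs).1 (hfJ s hs).2 k δ h ≫
      piece δ (lt_level hM k) (lt_base hM) ≫ jump (add_one_lt_dist hM δ) hδ ≫
        piece δ' (lt_base hM) (lt_level hM k) := by
  have e := arc_comp_inward hf hJ hs hs' (fun u hu => ⟨lt_dist hM (hfJ u hu).1, (hfJ u hu).2⟩)
    (lt_base hM)
  simp only [chord, Category.assoc, piece_trans_assoc, piece_self, Category.id_comp]
  rw [← Category.assoc, e, Category.assoc, fgCls_eq_jump
    (add_one_lt_dist_radial hM (hfJ s hs).1) (hclose s' hs')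
    (fun t => hclose _ (arc_param_mem hJ hs hs' t))]
  rw [← Category.assoc (jump _ _), jump_trans _ (add_one_lt_dist_radial hM (hfJ s' hs').1) _ h' h'',
    ← Category.assoc (jump _ _) (jump _ _), jump_trans _ (add_one_lt_dist hM δ) h hδ h'']

end raysFrom

namespace raysFrom

open CategoryTheory

variable {X : Type*} [MetricSpace X] [Fact (IsCAT0Space X)] {n : ℕ} {M : ℝ}

theorem exists_deep_chord [ProperSpace X] (o : X) (hM : (n : ℝ) + 1 < M) {M₁ ε : ℝ}
    (hM₁ : M ≤ M₁) (hε : 0 < ε) (hε1 : ε ≤ 1) (k : ℕ) :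
    ∃ K, ∀ (p : X) (D : ℝ), K ≤ dist o p → ∀ (hp : M ≤ dist o p) (hD : dist o p ≤ D),
      ∃ (δ : raysFrom o) (h : dist (radial o p M) (δ.1 M) ≤ 1),
        dist (radial o p M₁) (δ.1 M₁) < ε ∧ IsDeep (outside o (n + k)) (chord hM hp hD k δ h) := by
  have hn := n.cast_nonneg (α := ℝ)
  have hk := k.cast_nonneg (α := ℝ)
  set T := max (M + k) M₁ with hT
  have hT1 : M + k ≤ T := le_max_left _ _
  have hT2 : M₁ ≤ T := le_max_right _ _
  have hMk : M ≤ M + k := by linarith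
  obtain ⟨m, hm⟩ := exists_radial_near o T hε
  refine ⟨max m T, fun p D hKp hp hD => ?_⟩
  have hpT : T ≤ dist o p := (le_max_right _ _).trans hKp
  obtain ⟨δ, hδ⟩ := hm p ((le_max_left _ _).trans hKp)
  have hle : ∀ s, 0 ≤ s → s ≤ T → dist (radial o p s) (δ.1 s) < ε := fun s h0 hs =>
    (radial_dist_mono p δ h0 hs hpT).trans_lt hδ
  refine ⟨δ, ((hle M (by linarith) (hMk.trans hT1)).trans_le hε1).le,
    hle M₁ (by linarith) hT2, ?_⟩
  have e := inward_comp_jump hM hMk hD (hT1.trans hpT) δ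
    ((hle M (by linarith) (hMk.trans hT1)).trans_le hε1).le
    ((hle (M + k) (by linarith) hT1).trans_le hε1).le
  rw [chord, ← Category.assoc, e]
  simp only [Category.assoc, piece_trans, piece_self, Category.comp_id]
  have hlt : (n : ℝ) + k < M + k := by linarith
  refine (isDeep_inward _ _ _ (by positivity) (by linarith) hlt).comp (isDeep_jump _ _ ?_)
  rw [dist_left_radial _ _ (by linarith), min_eq_right (hT1.trans hpT)]
  linarith

/-- Under the hypothesis on geodesic rays, paths far away with end points very far away can be
pushed off large balls by homotopies avoiding a smaller ball. -/
theorem exists_isDeep [ProperSpace X] (hone : HasOneEnd X)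
    (h : ∀ γ γ' : GeodesicRay X, ProperlyHomotopic γ.toFun γ'.toFun) (o : X) (n : ℕ) :
    ∃ m : ℝ, (n : ℝ) ≤ m ∧ ∀ k : ℕ, ∃ K : ℝ, ∀ (a b : X) (ω : Path a b)
      (hU : ∀ t, ω t ∈ outside o n), (∀ t, ω t ∈ outside o m) → K ≤ dist o a → K ≤ dist o b →
        IsDeep (outside o (n + k)) (fgCls ω hU) := by
  have hn := n.cast_nonneg (α := ℝ)
  have hM : (n : ℝ) + 1 < n + 2 := by linarith
  obtain ⟨M₁, hM₁, ε, hε, hε1, hlink⟩ := exists_linked_of_dist_lt hone h o hM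
  set M : ℝ := n + 2
  have hε3 : 0 < ε / 3 := by positivity
  obtain ⟨m, hm⟩ := exists_radial_near o M₁ hε3
  refine ⟨max m M₁, (by linarith : (n : ℝ) ≤ M₁).trans (le_max_right _ _), fun k => ?_⟩
  obtain ⟨K, hK⟩ := exists_deep_chord o hM hM₁ hε3 (by linarith) k
  refine ⟨K, fun a b ω hU hωm ha hb => ?_⟩
  obtain ⟨f, hfω⟩ : ∃ f : ℝ → X, f = ω.extend := ⟨_, rfl⟩
  have hf : Continuous f := hfω ▸ ω.continuous_extend
  have hf0 : f 0 = a := by rw [hfω, ω.extend_zero]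
  have hf1 : f 1 = b := by rw [hfω, ω.extend_one]
  have hfm : ∀ u, max m M₁ < dist o (f u) := fun u => by
    rw [hfω]
    exact hωm _
  have hfM₁ : ∀ u, M₁ ≤ dist o (f u) := fun u => (le_max_right _ _).trans (hfm u).le
  have hfM : ∀ u, M ≤ dist o (f u) := fun u => hM₁.trans (hfM₁ u)
  have hfn : ∀ u, f u ∈ outside o n := fun u => lt_dist hM (hfM u)
  obtain ⟨D, hD⟩ : ∃ D, ∀ u, dist o (f u) ≤ D := by
    obtain ⟨D, hD⟩ := (isCompact_range ω.continuous).isBounded.subset_closedBall o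
    refine ⟨D, fun u => ?_⟩
    rw [dist_comm, hfω]
    exact hD (mem_range_self _)
  obtain ⟨η, hη, hunif⟩ := Metric.uniformContinuous_iff.1 ω.uniformContinuous_extend (ε / 9)
    (by positivity)
  rw [← hfω] at hunif
  have hrad : ∀ u v t, dist u v < η → dist (radial o (f u) t) (radial o (f v) t) < ε / 3 :=
    fun u v t huv => (dist_radial_le o (f u) (f v) t).trans_lt (by linarith [hunif huv])
  have hdM : ∀ u (δ : raysFrom o), dist (radial o (f u) M₁) (δ.1 M₁) < ε / 3 →
      dist (radial o (f u) M) (δ.1 M) < ε / 3 := fun u δ hδ =>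
    (radial_dist_mono (f u) δ (by linarith) hM₁ (hfM₁ u)).trans_lt hδ
  let along : ∀ u, fgPt (outside o n) (f 0) (hfn 0) ⟶ fgPt (outside o n) (f u) (hfn u) := fun u =>
    fgCls (arc f hf 0 u rfl rfl) fun _ => hfn _
  let P : ℝ → Prop := fun u => ∃ (δ : raysFrom o) (h : dist (radial o (f u) M) (δ.1 M) ≤ 1),
    dist (radial o (f u) M₁) (δ.1 M₁) < ε / 3 ∧
      IsDeep (outside o (n + k)) (along u ≫ chord hM (hfM u) (hD u) k δ h)
  have hmove : ∀ u v, dist u v < η → ∀ δ δ' : raysFrom o,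
      ∀ (hδ : dist (radial o (f u) M) (δ.1 M) ≤ 1) (hδ' : dist (radial o (f v) M) (δ'.1 M) ≤ 1),
      dist (radial o (f u) M₁) (δ.1 M₁) < ε / 3 → dist (radial o (f v) M₁) (δ'.1 M₁) < ε / 3 →
      IsDeep (outside o (n + k)) (along u ≫ chord hM (hfM u) (hD u) k δ hδ) →
      IsDeep (outside o (n + k)) (along v ≫ chord hM (hfM v) (hD v) k δ' hδ') := by
    intro u v huv δ δ' hδ hδ' hδ₁ hδ₁' hdeep
    have hlt : dist (δ.1 M₁) (δ'.1 M₁) < ε := by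
      have h1 := dist_triangle4 (δ.1 M₁) (radial o (f u) M₁) (radial o (f v) M₁) (δ'.1 M₁)
      rw [dist_comm (δ.1 M₁) (radial o (f u) M₁)] at h1
      linarith [hrad u v M₁ huv]
    obtain ⟨hd, hl⟩ := hlink δ δ' hlt k
    have e := arc_comp_chord hM hf (J := uIcc u v) ordConnected_uIcc left_mem_uIcc right_mem_uIcc
      (fun w _ => ⟨hfM w, hD w⟩) (fun w hw => by
        have : dist u w < η := by
          refine lt_of_le_of_lt ?_ huv
          rw [Real.dist_eq, Real.dist_eq, abs_sub_comm, abs_sub_comm u v]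
          exact abs_sub_left_of_mem_uIcc hw
        linarith [hrad u w M this]) k hδ hδ' (by
        linarith [dist_triangle (radial o (f u) M) (radial o (f v) M) (δ'.1 M), hrad u v M huv,
          hdM v δ' hδ₁']) hd
    have e' : along v = along u ≫ fgCls (arc f hf u v rfl rfl) fun _ => hfn _ :=
      (arc_trans ordConnected_univ trivial trivial trivial fun s _ => hfn s).symm
    rw [e', Category.assoc, e, ← Category.assoc]
    exact hdeep.comp hl
  have hstep : ∀ u v, dist u v < η → P u → P v := by
    rintro u v huv ⟨δ, hδ, hδ₁, hdeep⟩
    obtain ⟨δ', hδ₁'⟩ := hm (f v) ((le_max_left _ _).trans (hfm v).le)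
    have hδ' : dist (radial o (f v) M) (δ'.1 M) ≤ 1 := by linarith [hdM v δ' hδ₁']
    exact ⟨δ', hδ', hδ₁', hmove u v huv δ δ' hδ hδ' hδ₁ hδ₁' hdeep⟩
  have hP0 : P 0 := by
    obtain ⟨δ, hδ, hδ₁, hdeep⟩ := hK (f 0) D (by rwa [hf0]) (hfM 0) (hD 0)
    refine ⟨δ, hδ, hδ₁, ?_⟩
    have : along 0 = 𝟙 _ := by
      rw [← fgCls_refl (fun _ => hfn 0)]
      exact fgCls_congr (arc_refl _ _ _) _ _
    rwa [this, Category.id_comp]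
  have hclopen : IsClopen {u | P u} := by
    refine ⟨⟨Metric.isOpen_iff.2 fun u hu => ⟨η, hη, fun v hv hPv => hu ?_⟩⟩,
      Metric.isOpen_iff.2 fun u hu => ⟨η, hη, fun v hv => ?_⟩⟩
    · exact hstep v u hv hPv
    · exact hstep u v (by rwa [dist_comm]) hu
  have hP1 : P 1 := by
    have := hclopen.eq_univ ⟨0, hP0⟩
    exact this.symm.subset (mem_univ 1)
  obtain ⟨δ, hδ, hδ₁, hdeep⟩ := hP1
  obtain ⟨δ', hδ', hδ₁', hdeep'⟩ := hK (f 1) D (by rwa [hf1]) (hfM 1) (hD 1)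
  have key := (hmove 1 1 (by simpa using hη) δ δ' hδ hδ' hδ₁ hδ₁' hdeep).comp hdeep'.inv
  simp only [Category.assoc, Groupoid.comp_inv, Category.comp_id] at key
  obtain ⟨p, hp, hpV, he⟩ := key
  refine ⟨p.cast hf0.symm hf1.symm, hp, hpV, ?_⟩
  obtain ⟨F, hF, hFU, h0, h1, hs, ht⟩ := (fgCls_eq_iff _ _).1 he
  refine (fgCls_eq_iff _ _).2 ⟨F, hF, hFU, fun t => ?_, h1, fun s => (hs s).trans hf0,
    fun s => (ht s).trans hf1⟩
  rw [h0]
  simp [arc, hfω]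

end raysFrom

section OneEnd

variable {X : Type*} [MetricSpace X] [Fact (IsCAT0Space X)]

theorem isPathConnected_ball_of_isCAT0Space (x : X) {r : ℝ} (hr : 0 < r) :
    IsPathConnected (Metric.ball x r) := by
  refine ⟨x, Metric.mem_ball_self hr, fun {y} hy => ⟨arc (geo x y)
    (continuous_const.geo continuous_const continuous_id) 0 1 (geo_zero _ _) (geo_one _ _),
    fun t => ?_⟩⟩
  rw [Metric.mem_ball, dist_comm]
  exact (dist_left_geo_le _ _ _).trans_lt (by rwa [dist_comm])

theorem locallyPathConnectedSpace_of_isCAT0Space : LocallyPathConnectedSpace X :=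
  LocallyPathConnectedSpace.of_bases (fun _ => Metric.nhds_basis_ball) fun x _ hr =>
    isPathConnected_ball_of_isCAT0Space x hr

/-- In a one-ended space, points far away are joined by paths far away. -/
theorem HasOneEnd.exists_path [ProperSpace X] (hone : HasOneEnd X) (o : X) (r : ℝ) :
    ∃ R, ∀ a b, R < dist o a → R < dist o b → ∃ p : Path a b, ∀ t, p t ∈ outside o r := by
  have := locallyPathConnectedSpace_of_isCAT0Space (X := X)
  obtain ⟨K', hK', hsub, hconn⟩ := hone.2 _ (isCompact_closedBall o r)
  obtain ⟨R, hR⟩ := hK'.isBounded.subset_closedBall o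
  refine ⟨R, fun a b ha hb => ?_⟩
  have hmem : ∀ z, R < dist o z → z ∈ K'ᶜ := fun z hz hzK => by
    have := hR hzK
    rw [Metric.mem_closedBall, dist_comm] at this
    linarith
  have hcompl : (Metric.closedBall o r)ᶜ = outside o r := by
    ext z
    simp [outside, dist_comm]
  rw [hcompl] at hconn
  have hout : ∀ z, R < dist o z → z ∈ outside o r := fun z hz =>
    hcompl ▸ compl_subset_compl.2 hsub (hmem z hz)
  have hC : IsPathConnected (connectedComponentIn (outside o r) a) :=
    ((isOpen_outside o r).connectedComponentIn.isConnected_iff_isPathConnected).1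
      (isConnected_connectedComponentIn_iff.2 (hout a ha))
  obtain ⟨p, hp⟩ := hC.joinedIn a (mem_connectedComponentIn (hout a ha)) b (by
    rw [hconn a (hmem a ha) b (hmem b hb)]
    exact mem_connectedComponentIn (hout b hb))
  exact ⟨p, fun t => connectedComponentIn_subset _ _ (hp t)⟩

end OneEnd

section Square

open CategoryTheory

/-- The map of the unit square collapsing its left and right edges to the corners `(0, 0)` and
`(1, 1)`, and spreading its other edges over two sides each. -/
noncomputable def cornerCollapse (z : I × I) : I × I :=
  (⟨min (2 * (z.2 : ℝ)) 1 * z.1 + max (2 * (z.2 : ℝ) - 1) 0 * (1 - z.1), by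
    obtain ⟨⟨s, hs⟩, ⟨v, hv⟩⟩ := z
    have h1 : 0 ≤ min (2 * v) 1 := le_min (by linarith [hv.1]) zero_le_one
    have h2 : min (2 * v) 1 ≤ 1 := min_le_right _ _
    have h3 : 0 ≤ max (2 * v - 1) 0 := le_max_right _ _
    have h4 : max (2 * v - 1) 0 ≤ 1 := max_le (by linarith [hv.2]) zero_le_one
    constructor <;> dsimp only <;> nlinarith [hs.1, hs.2]⟩,
  ⟨min (2 * (z.2 : ℝ)) 1 * (1 - z.1) + max (2 * (z.2 : ℝ) - 1) 0 * z.1, by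
    obtain ⟨⟨s, hs⟩, ⟨v, hv⟩⟩ := z
    have h1 : 0 ≤ min (2 * v) 1 := le_min (by linarith [hv.1]) zero_le_one
    have h2 : min (2 * v) 1 ≤ 1 := min_le_right _ _
    have h3 : 0 ≤ max (2 * v - 1) 0 := le_max_right _ _
    have h4 : max (2 * v - 1) 0 ≤ 1 := max_le (by linarith [hv.2]) zero_le_one
    constructor <;> dsimp only <;> nlinarith [hs.1, hs.2]⟩)

theorem continuous_cornerCollapse : Continuous cornerCollapse := by
  unfold cornerCollapse
  fun_prop

theorem cornerCollapse_of_le {s v : I} (hv : (v : ℝ) ≤ 1 / 2) :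
    ((cornerCollapse (s, v)).1 : ℝ) = 2 * v * s ∧
      ((cornerCollapse (s, v)).2 : ℝ) = 2 * v * (1 - s) := by
  simp only [cornerCollapse]
  rw [min_eq_left (by linarith), max_eq_right (by linarith)]
  constructor <;> ring

theorem cornerCollapse_of_ge {s v : I} (hv : 1 / 2 ≤ (v : ℝ)) :
    ((cornerCollapse (s, v)).1 : ℝ) = 1 - (2 - 2 * v) * (1 - s) ∧
      ((cornerCollapse (s, v)).2 : ℝ) = 1 - (2 - 2 * v) * s := by
  simp only [cornerCollapse]
  rw [min_eq_right (by linarith), max_eq_left (by linarith)]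
  constructor <;> ring

theorem surjective_cornerCollapse : Function.Surjective cornerCollapse := by
  rintro ⟨⟨u, hu⟩, ⟨w, hw⟩⟩
  obtain h | h := le_total (u + w) 1
  · obtain h0 | h0 := (add_nonneg hu.1 hw.1).eq_or_lt
    · refine ⟨(0, 0), Prod.ext (Subtype.ext ?_) (Subtype.ext ?_)⟩
      · rw [(cornerCollapse_of_le (by simp)).1]
        dsimp only [Icc.coe_zero]
        linarith [hu.1, hw.1]
      · rw [(cornerCollapse_of_le (by simp)).2]
        dsimp only [Icc.coe_zero]
        linarith [hu.1, hw.1]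
    · refine ⟨(⟨u / (u + w), div_nonneg hu.1 h0.le, (div_le_one h0).2 (by linarith [hw.1])⟩,
        ⟨(u + w) / 2, by linarith, by linarith⟩), Prod.ext (Subtype.ext ?_) (Subtype.ext ?_)⟩
      · rw [(cornerCollapse_of_le (by dsimp only; linarith)).1]
        dsimp only
        field_simp
      · rw [(cornerCollapse_of_le (by dsimp only; linarith)).2]
        dsimp only
        field_simp
        ring
  · obtain h0 | h0 := (by linarith [hu.2, hw.2] : 0 ≤ 2 - u - w).eq_or_lt
    · refine ⟨(0, 1), Prod.ext (Subtype.ext ?_) (Subtype.ext ?_)⟩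
      · rw [(cornerCollapse_of_ge (by norm_num)).1]
        dsimp only [Icc.coe_one]
        linarith [hu.2, hw.2]
      · rw [(cornerCollapse_of_ge (by norm_num)).2]
        dsimp only [Icc.coe_one]
        linarith [hu.2, hw.2]
    · refine ⟨(⟨(1 - w) / (2 - u - w), div_nonneg (by linarith [hw.2]) h0.le,
        (div_le_one h0).2 (by linarith [hu.2])⟩,
        ⟨(u + w) / 2, by linarith, by linarith [hu.2, hw.2]⟩),
        Prod.ext (Subtype.ext ?_) (Subtype.ext ?_)⟩
      · rw [(cornerCollapse_of_ge (by dsimp only; linarith)).1]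
        dsimp only
        field_simp
        ring
      · rw [(cornerCollapse_of_ge (by dsimp only; linarith)).2]
        dsimp only
        field_simp
        ring

theorem eq_of_cornerCollapse_eq {s v s' v' : I}
    (h : cornerCollapse (s, v) = cornerCollapse (s', v')) : v = v' ∧ (s = s' ∨ v = 0 ∨ v = 1) := by
  have hsum : ∀ z : I × I,
      ((cornerCollapse z).1 : ℝ) + (cornerCollapse z).2 = 2 * z.2 := by
    rintro ⟨s, v⟩
    obtain hv | hv := le_total (v : ℝ) (1 / 2)
    · rw [(cornerCollapse_of_le hv).1, (cornerCollapse_of_le hv).2]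
      ring
    · rw [(cornerCollapse_of_ge hv).1, (cornerCollapse_of_ge hv).2]
      ring
  have hv : v = v' := Subtype.ext (by
    have := hsum (s, v)
    rw [h, hsum] at this
    dsimp only at this
    linarith)
  subst hv
  refine ⟨rfl, ?_⟩
  have h1 : ((cornerCollapse (s, v)).1 : ℝ) = (cornerCollapse (s', v)).1 := by rw [h]
  obtain hv | hv := le_total (v : ℝ) (1 / 2)
  · rw [(cornerCollapse_of_le hv).1, (cornerCollapse_of_le hv).1] at h1
    obtain h2 | h2 := mul_eq_mul_left_iff.1 h1
    · exact Or.inl (Subtype.ext h2)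
    · exact Or.inr (Or.inl (Subtype.ext (by simpa using h2)))
  · rw [(cornerCollapse_of_ge hv).1, (cornerCollapse_of_ge hv).1] at h1
    obtain h2 | h2 := mul_eq_mul_left_iff.1 (sub_right_injective h1)
    · exact Or.inl (Subtype.ext (by linarith))
    · exact Or.inr (Or.inr (Subtype.ext (by simp only [Icc.coe_one]; linarith)))

/-- The first half of the unit interval. -/
noncomputable def lowerHalf (t : I) : I := ⟨t / 2, by linarith [t.2.1], by linarith [t.2.2]⟩

/-- The second half of the unit interval. -/
noncomputable def upperHalf (t : I) : I :=
  ⟨(t + 1) / 2, by linarith [t.2.1], by linarith [t.2.2]⟩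

theorem coe_lowerHalf (t : I) : (lowerHalf t : ℝ) = t / 2 := rfl

theorem coe_upperHalf (t : I) : (upperHalf t : ℝ) = (t + 1) / 2 := rfl

theorem lowerHalf_le (t : I) : (lowerHalf t : ℝ) ≤ 1 / 2 := by
  simp only [lowerHalf]
  linarith [t.2.2]

theorem le_upperHalf (t : I) : 1 / 2 ≤ (upperHalf t : ℝ) := by
  simp only [upperHalf]
  linarith [t.2.1]

theorem cornerCollapse_one_lowerHalf (t : I) : cornerCollapse (1, lowerHalf t) = (t, 0) := by
  refine Prod.ext (Subtype.ext ?_) (Subtype.ext ?_)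
  · rw [(cornerCollapse_of_le (lowerHalf_le t)).1, coe_lowerHalf]
    simp only [Icc.coe_one]
    ring
  · rw [(cornerCollapse_of_le (lowerHalf_le t)).2, coe_lowerHalf]
    simp only [Icc.coe_zero, Icc.coe_one]
    ring

theorem cornerCollapse_zero_lowerHalf (t : I) : cornerCollapse (0, lowerHalf t) = (0, t) := by
  refine Prod.ext (Subtype.ext ?_) (Subtype.ext ?_)
  · rw [(cornerCollapse_of_le (lowerHalf_le t)).1, coe_lowerHalf]
    simp only [Icc.coe_zero]
    ring
  · rw [(cornerCollapse_of_le (lowerHalf_le t)).2, coe_lowerHalf]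
    simp only [Icc.coe_zero]
    ring

theorem cornerCollapse_one_upperHalf (t : I) : cornerCollapse (1, upperHalf t) = (1, t) := by
  refine Prod.ext (Subtype.ext ?_) (Subtype.ext ?_)
  · rw [(cornerCollapse_of_ge (le_upperHalf t)).1, coe_upperHalf]
    simp only [Icc.coe_one]
    ring
  · rw [(cornerCollapse_of_ge (le_upperHalf t)).2, coe_upperHalf]
    simp only [Icc.coe_one]
    ring

theorem cornerCollapse_zero_upperHalf (t : I) : cornerCollapse (0, upperHalf t) = (t, 1) := by
  refine Prod.ext (Subtype.ext ?_) (Subtype.ext ?_)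
  · rw [(cornerCollapse_of_ge (le_upperHalf t)).1, coe_upperHalf]
    simp only [Icc.coe_zero]
    ring
  · rw [(cornerCollapse_of_ge (le_upperHalf t)).2, coe_upperHalf]
    simp only [Icc.coe_zero, Icc.coe_one]
    ring

theorem Path.trans_lowerHalf {X : Type*} [TopologicalSpace X] {x y z : X} (p : Path x y)
    (q : Path y z) (t : I) : p.trans q (lowerHalf t) = p t := by
  rw [Path.trans_apply, dif_pos (lowerHalf_le t)]
  congr 1
  ext
  simp only [lowerHalf]
  ring

theorem Path.trans_upperHalf {X : Type*} [TopologicalSpace X] {x y z : X} (p : Path x y)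
    (q : Path y z) (t : I) : p.trans q (upperHalf t) = q t := by
  rw [Path.trans_apply]
  split_ifs with h
  · have : t = 0 := by
      ext
      simp only [upperHalf] at h
      simp only [Icc.coe_zero]
      linarith [t.2.1]
    subst this
    refine (congrArg p (Subtype.ext ?_)).trans (p.target.trans q.source.symm)
    simp [coe_upperHalf]
  · congr 1
    ext
    simp only [upperHalf]
    ring

/-- A commuting square in the fundamental groupoid is filled by a map of the unit square. -/
theorem exists_square {X : Type*} [TopologicalSpace X] {U : Set X} {x₀₀ x₁₀ x₀₁ x₁₁ : X}
    {p : Path x₀₀ x₁₀} {r : Path x₁₀ x₁₁} {l : Path x₀₀ x₀₁} {q : Path x₀₁ x₁₁}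
    (hp : ∀ t, p t ∈ U) (hr : ∀ t, r t ∈ U) (hl : ∀ t, l t ∈ U) (hq : ∀ t, q t ∈ U)
    (h : fgCls p hp ≫ fgCls r hr = fgCls l hl ≫ fgCls q hq) :
    ∃ Φ : I × I → X, Continuous Φ ∧ (∀ z, Φ z ∈ U) ∧ (∀ t, Φ (t, 0) = p t) ∧
      (∀ t, Φ (t, 1) = q t) ∧ (∀ t, Φ (0, t) = l t) ∧ (∀ t, Φ (1, t) = r t) := by
  rw [← fgCls_trans, ← fgCls_trans] at h
  obtain ⟨F, hF, hFU, h0, h1, hs, ht⟩ := (fgCls_eq_iff _ _).1 h.symm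
  have hquot : IsQuotientMap cornerCollapse := continuous_cornerCollapse.isClosedMap.isQuotientMap
    continuous_cornerCollapse surjective_cornerCollapse
  obtain ⟨Φ, hΦ⟩ : ∃ Φ : I × I → X, ∀ z, Φ (cornerCollapse z) = F z := by
    refine ⟨fun z => F (Function.surjInv surjective_cornerCollapse z), fun z => ?_⟩
    have := Function.surjInv_eq surjective_cornerCollapse (cornerCollapse z)
    revert this
    dsimp only
    generalize Function.surjInv surjective_cornerCollapse (cornerCollapse z) = z'
    obtain ⟨s, v⟩ := z
    obtain ⟨s', v'⟩ := z'
    intro this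
    obtain ⟨rfl, rfl | rfl | rfl⟩ := eq_of_cornerCollapse_eq this
    · rfl
    · rw [hs, hs]
    · rw [ht, ht]
  refine ⟨Φ, hquot.continuous_iff.2 (by simpa only [Function.comp_def, hΦ] using hF), fun z => ?_,
    fun t => ?_, fun t => ?_, fun t => ?_, fun t => ?_⟩
  · obtain ⟨z, rfl⟩ := surjective_cornerCollapse z
    rw [hΦ]
    exact hFU z
  · rw [← cornerCollapse_one_lowerHalf, hΦ, h1, Path.trans_lowerHalf]
  · rw [← cornerCollapse_zero_upperHalf, hΦ, h0, Path.trans_upperHalf]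
  · rw [← cornerCollapse_zero_lowerHalf, hΦ, h0, Path.trans_lowerHalf]
  · rw [← cornerCollapse_one_upperHalf, hΦ, h1, Path.trans_upperHalf]

end Square

section Glue

variable {X : Type*} [MetricSpace X]

theorem isCompact_preimage_of_eventually_outside [ProperSpace X] (o : X)
    {H : ℝ≥0 × I → X} (hH : Continuous H)
    (hout : ∀ r : ℝ, ∃ T : ℝ≥0, ∀ t s, T ≤ t → H (t, s) ∈ outside o r) {K : Set X}
    (hK : IsCompact K) : IsCompact (H ⁻¹' K) := by
  obtain ⟨r, hr⟩ := hK.isBounded.subset_closedBall o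
  obtain ⟨T, hT⟩ := hout r
  refine ((isCompact_Icc (a := 0) (b := T)).prod (isCompact_univ (X := I))).of_isClosed_subset
    (hK.isClosed.preimage hH) fun ⟨t, s⟩ h => ⟨⟨zero_le, ?_⟩, mem_univ _⟩
  by_contra! hlt
  have h1 := hr h
  have h2 : r < dist o (H (t, s)) := hT t s hlt.le
  rw [Metric.mem_closedBall, dist_comm] at h1
  linarith

/-- Squares filling a sequence of strips between two rays, ever farther out, glue to a proper
homotopy. -/
theorem properlyHomotopic_of_squares [ProperSpace X] (o : X) {f f' : ℝ → X} {T : ℕ → ℝ}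
    (hT0 : T 0 = 0) (hT : ∀ i, T i + 1 ≤ T (i + 1)) {Φ : ℕ → I × I → X}
    (hΦ : ∀ i, Continuous (Φ i)) (hout : ∀ (i : ℕ) z, Φ i z ∈ outside o (i - 1))
    (hf : ∀ i t, Φ i (t, 0) = f ((1 - t) * T i + t * T (i + 1)))
    (hf' : ∀ i t, Φ i (t, 1) = f' ((1 - t) * T i + t * T (i + 1)))
    (hΦΦ : ∀ i s, Φ i (1, s) = Φ (i + 1) (0, s)) :
    ProperlyHomotopic (fun t : ℝ≥0 => f t) fun t : ℝ≥0 => f' t := by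
  have hle : ∀ i : ℕ, (i : ℝ) ≤ T i := by
    intro i
    induction i with
    | zero => simp [hT0]
    | succ i ih => push_cast; linarith [hT i]
  have hmono : StrictMono T := strictMono_nat_of_lt_succ fun i => by linarith [hT i]
  have hpos : ∀ i, 0 < T (i + 1) - T i := fun i => by linarith [hT i]
  have hex : ∀ t : ℝ≥0, ∃ i, (t : ℝ) < T (i + 1) := fun t => by
    obtain ⟨N, hN⟩ := exists_nat_gt (t : ℝ)
    exact ⟨N, hN.trans_le ((hle N).trans (by linarith [hT N]))⟩
  obtain ⟨ι, hι, hι'⟩ : ∃ ι : ℝ≥0 → ℕ, (∀ t : ℝ≥0, T (ι t) ≤ t) ∧ ∀ t : ℝ≥0,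
      (t : ℝ) < T (ι t + 1) := by
    classical
    refine ⟨fun t => Nat.find (hex t), fun t => ?_, fun t => Nat.find_spec (hex t)⟩
    dsimp only
    cases hj : Nat.find (hex t) with
    | zero => simp [hT0]
    | succ j =>
      exact not_lt.1 (Nat.find_min (hex t) (by omega))
  obtain ⟨ρ, hρ⟩ : ∃ ρ : ℕ → ℝ≥0 → I, ρ = fun i (t : ℝ≥0) =>
    projIcc 0 1 zero_le_one ((t - T i) / (T (i + 1) - T i)) := ⟨_, rfl⟩
  have hρc : ∀ i, Continuous (ρ i) := fun i => by
    rw [hρ]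
    exact continuous_projIcc.comp (by fun_prop)
  have hρτ : ∀ i (t : ℝ≥0), T i ≤ t → (t : ℝ) ≤ T (i + 1) →
      (1 - (ρ i t : ℝ)) * T i + ρ i t * T (i + 1) = t := fun i t h h' => by
    have h1 : (ρ i t : ℝ) = (t - T i) / (T (i + 1) - T i) := by
      rw [hρ]
      dsimp only
      rw [projIcc_of_mem _ ⟨div_nonneg (by linarith) (hpos i).le,
        (div_le_one (hpos i)).2 (by linarith)⟩]
    rw [h1]
    have := (hpos i).ne'
    field_simp
    ring
  have hcongr : ∀ i (t : ℝ≥0) s, T i ≤ t → (t : ℝ) ≤ T (i + 1) →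
      Φ (ι t) (ρ (ι t) t, s) = Φ i (ρ i t, s) := fun i t s h h' => by
    have h1 : i < ι t + 1 := hmono.lt_iff_lt.1 (h.trans_lt (hι' t))
    have h2 : ι t ≤ i + 1 := hmono.le_iff_le.1 ((hι t).trans h')
    obtain h3 | h3 : ι t = i ∨ ι t = i + 1 := by omega
    · rw [h3]
    · have ht : (t : ℝ) = T (i + 1) := le_antisymm h' (h3 ▸ hι t)
      rw [h3]
      have e1 : ρ i t = 1 := by
        rw [hρ]
        dsimp only
        rw [ht, div_self (hpos i).ne', projIcc_right]
        rfl
      have e2 : ρ (i + 1) t = 0 := by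
        rw [hρ]
        dsimp only
        rw [ht, sub_self, zero_div, projIcc_left]
        rfl
      rw [e1, e2, hΦΦ]
  have hcont : Continuous fun z : ℝ≥0 × I => Φ (ι z.1) (ρ (ι z.1) z.1, z.2) := by
    refine LocallyFinite.continuous
      (f := fun i => {z : ℝ≥0 × I | T i ≤ z.1 ∧ (z.1 : ℝ) ≤ T (i + 1)}) (fun z => ?_)
      (eq_univ_of_forall fun z => mem_iUnion.2 ⟨ι z.1, hι _, (hι' _).le⟩) (fun i => ?_)
      fun i => ?_
    · obtain ⟨N, hN⟩ := exists_nat_gt (z.1 : ℝ)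
      refine ⟨{w | (w.1 : ℝ) < N}, (isOpen_lt (by fun_prop) (by fun_prop)).mem_nhds hN,
        (finite_lt_nat N).subset ?_⟩
      rintro i ⟨w, hw, hw'⟩
      exact_mod_cast (hle i).trans_lt (hw.1.trans_lt hw')
    · have hfst : Continuous fun z : ℝ≥0 × I => (z.1 : ℝ) := by fun_prop
      exact (isClosed_le continuous_const hfst).inter (isClosed_le hfst continuous_const)
    · refine ContinuousOn.congr (f := fun z : ℝ≥0 × I => Φ i (ρ i z.1, z.2)) ?_
        fun z hz => hcongr i z.1 z.2 hz.1 hz.2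
      exact ((hΦ i).comp (((hρc i).comp continuous_fst).prodMk continuous_snd)).continuousOn
  refine ⟨_, hcont, fun K hK => isCompact_preimage_of_eventually_outside o hcont (fun r => ?_) hK,
    fun t => ?_, fun t => ?_⟩
  · obtain ⟨N, hN⟩ := exists_nat_gt r
    refine ⟨(T (N + 1)).toNNReal, fun t s ht => ?_⟩
    have h1 : N + 1 < ι t + 1 :=
      hmono.lt_iff_lt.1 ((Real.toNNReal_le_iff_le_coe.1 ht).trans_lt (hι' t))
    refine outside_anti o ?_ (hout _ _)
    have : (N : ℝ) + 1 ≤ ι t := by exact_mod_cast (by omega : N + 1 ≤ ι t)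
    linarith
  · simp only [hf, hρτ _ _ (hι t) (hι' t).le]
  · simp only [hf', hρτ _ _ (hι t) (hι' t).le]

end Glue

section Main

open CategoryTheory

theorem IsDeep.exists_fgCls_eq {X : Type*} [TopologicalSpace X] {U V : Set X} {x y : X}
    {p : Path x y} {hp : ∀ t, p t ∈ U} (h : IsDeep V (fgCls p hp)) :
    ∃ (q : Path x y) (hq : ∀ t, q t ∈ U), (∀ t, q t ∈ V) ∧ fgCls p hp = fgCls q hq :=
  h

variable {X : Type*} [MetricSpace X]

theorem GeodesicRay.isCompact_preimage (γ : GeodesicRay X) {K : Set X} (hK : IsCompact K) :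
    IsCompact (γ.toFun ⁻¹' K) := by
  have h : Isometry γ.toFun := Isometry.of_dist_eq fun s t => by
    rw [γ.isometry, NNReal.dist_eq]
  exact h.isClosedEmbedding.isCompact_preimage hK

/-- A geodesic ray as a proper ray. -/
def GeodesicRay.toProperRay (γ : GeodesicRay X) : ProperRay X where
  toFun := γ.toFun
  continuous_toFun := (Isometry.of_dist_eq fun s t => by
    rw [γ.isometry, NNReal.dist_eq]).continuous
  isProper _ hK := γ.isCompact_preimage hK

theorem ProperRay.eventually_outside [ProperSpace X] (c : ProperRay X) (o : X) (r : ℝ) :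
    ∀ᶠ t in atTop, c.toFun t ∈ outside o r := by
  obtain ⟨T, hT⟩ := (c.isProper _ (isCompact_closedBall o r)).bddAbove
  filter_upwards [eventually_gt_atTop T] with t ht
  by_contra hc
  refine ht.not_ge (hT ?_)
  rw [mem_preimage, Metric.mem_closedBall, dist_comm]
  exact not_lt.1 hc

variable [Fact (IsCAT0Space X)]

/-- The levels used in the construction of a proper homotopy: outside the `i`-th radius, a path
can be pushed arbitrarily far out, staying outside the ball of radius `i - 1`. -/
theorem exists_levels [ProperSpace X] (hone : HasOneEnd X)
    (h : ∀ γ γ' : GeodesicRay X, ProperlyHomotopic γ.toFun γ'.toFun) (o : X) :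
    ∃ μ : ℕ → ℝ, μ 0 = -1 ∧ (∀ i : ℕ, (i : ℝ) - 1 ≤ μ i) ∧ ∀ (i : ℕ) (L : ℝ), ∃ K : ℝ,
      ∀ (a b : X) (ω : Path a b) (hU : ∀ t, ω t ∈ outside o (i - 1)),
        (∀ t, ω t ∈ outside o (μ i)) → K ≤ dist o a → K ≤ dist o b →
          IsDeep (outside o L) (fgCls ω hU) := by
  choose m hm hdeep using raysFrom.exists_isDeep hone h o
  have huniv : ∀ z : X, z ∈ outside o (-1) := fun z => by
    rw [outside, mem_ofPred_eq]
    linarith [dist_nonneg (x := o) (y := z)]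
  refine ⟨fun i => i.casesOn (-1) m, rfl, fun i => ?_, fun i L => ?_⟩
  · cases i with
    | zero => simp
    | succ i => simpa using hm i
  · cases i with
    | zero =>
      obtain ⟨R, hR⟩ := hone.exists_path o L
      refine ⟨R + 1, fun a b ω hU _ ha hb => ?_⟩
      obtain ⟨p, hp⟩ := hR a b (by linarith) (by linarith)
      have h0 : ((0 : ℕ) : ℝ) - 1 = -1 := by simp
      refine ⟨p, fun t => h0 ▸ huniv _, hp, fgCls_eq_of_geo_mem _ _ fun s τ => h0 ▸ huniv _⟩
    | succ i =>
      obtain ⟨k, hk⟩ := exists_nat_ge L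
      obtain ⟨K, hK⟩ := hdeep i k
      have hi : ((i + 1 : ℕ) : ℝ) - 1 = i := by simp
      rw [hi]
      exact ⟨K, fun a b ω hU hω ha hb => (hK a b ω hU hω ha hb).mono
        (outside_anti o (hk.trans (by simp)))⟩

theorem ProperRay.properlyHomotopic [ProperSpace X] (hone : HasOneEnd X)
    (h : ∀ γ γ' : GeodesicRay X, ProperlyHomotopic γ.toFun γ'.toFun) (c c' : ProperRay X) :
    ProperlyHomotopic c.toFun c'.toFun := by
  obtain ⟨o, ho⟩ : ∃ o, o = c.toFun 0 := ⟨_, rfl⟩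
  clear ho
  obtain ⟨μ, hμ0, hμ, hdeep⟩ := exists_levels hone h o
  obtain ⟨f, hf⟩ : ∃ f : ℝ → X, f = fun t => c.toFun t.toNNReal := ⟨_, rfl⟩
  obtain ⟨f', hf'⟩ : ∃ f' : ℝ → X, f' = fun t => c'.toFun t.toNNReal := ⟨_, rfl⟩
  have hfc : Continuous f := hf ▸ c.continuous_toFun.comp continuous_real_toNNReal
  have hfc' : Continuous f' := hf' ▸ c'.continuous_toFun.comp continuous_real_toNNReal
  have hfar : ∀ r, ∀ᶠ t in atTop, f t ∈ outside o r ∧ f' t ∈ outside o r := fun r => by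
    rw [hf, hf']
    exact tendsto_real_toNNReal_atTop.eventually
      ((c.eventually_outside o r).and (c'.eventually_outside o r))
  obtain ⟨Stage, hStage⟩ : ∃ Stage : ℕ → (T : ℝ) → Path (f T) (f' T) → Prop,
    Stage = fun i T β => (∀ s, β s ∈ outside o (μ i)) ∧
      ∀ t, T ≤ t → f t ∈ outside o (μ i) ∧ f' t ∈ outside o (μ i) := ⟨_, rfl⟩
  have hstep : ∀ (i : ℕ) (a : {q : Σ T, Path (f T) (f' T) // Stage i q.1 q.2}),
      ∃ b : {q : Σ T, Path (f T) (f' T) // Stage (i + 1) q.1 q.2}, a.1.1 + 1 ≤ b.1.1 ∧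
        ∃ Φ : I × I → X, Continuous Φ ∧ (∀ z, Φ z ∈ outside o (i - 1)) ∧
          (∀ t : I, Φ (t, 0) = f ((1 - t) * a.1.1 + t * b.1.1)) ∧
          (∀ t : I, Φ (t, 1) = f' ((1 - t) * a.1.1 + t * b.1.1)) ∧
          (∀ t, Φ (0, t) = a.1.2 t) ∧ ∀ t, Φ (1, t) = b.1.2 t := by
    rintro i ⟨⟨T, β⟩, hβ⟩
    rw [hStage] at hβ
    obtain ⟨hβ, htail⟩ := hβ
    obtain ⟨K, hK⟩ := hdeep i (μ (i + 1))
    obtain ⟨T', hT'⟩ := eventually_atTop.1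
      ((hfar (max (μ (i + 1)) K)).and (eventually_ge_atTop (T + 1)))
    have hTT' : T + 1 ≤ T' := (hT' T' le_rfl).2
    have hsub := outside_anti o (hμ i)
    have hT'mem : T' ∈ Ici T := by
      rw [mem_Ici]
      linarith
    have hTmem : T ∈ Ici T := mem_Ici.2 le_rfl
    have hp : ∀ s, arc f hfc T T' rfl rfl s ∈ outside o (μ i) :=
      arc_mem ordConnected_Ici hTmem hT'mem fun s hs => (htail s hs).1
    have hq : ∀ s, arc f' hfc' T T' rfl rfl s ∈ outside o (μ i) :=
      arc_mem ordConnected_Ici hTmem hT'mem fun s hs => (htail s hs).2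
    have hω := Path.trans_mem (Path.symm_mem hp) (Path.trans_mem hβ hq)
    obtain ⟨β', hβ'U, hβ'V, he⟩ := (hK _ _ _ (fun t => hsub (hω t)) hω
      ((le_max_right _ _).trans (hT' T' le_rfl).1.1.le)
      ((le_max_right _ _).trans (hT' T' le_rfl).1.2.le)).exists_fgCls_eq
    rw [fgCls_trans (Path.symm_mem fun t => hsub (hp t))
      (Path.trans_mem (fun t => hsub (hβ t)) fun t => hsub (hq t)),
          fgCls_symm (fun t => hsub (hp t)),
      fgCls_trans (fun t => hsub (hβ t)) fun t => hsub (hq t)] at he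
    have hsq : fgCls _ (fun t => hsub (hp t)) ≫ fgCls β' hβ'U =
        fgCls β (fun t => hsub (hβ t)) ≫ fgCls _ fun t => hsub (hq t) := by
      rw [← he, ← Category.assoc, Groupoid.comp_inv, Category.id_comp]
    obtain ⟨Φ, hΦ, hΦU, h1, h2, h3, h4⟩ := exists_square _ _ _ _ hsq
    refine ⟨⟨⟨T', β'⟩, ?_⟩, hTT', Φ, hΦ, hΦU, h1, h2, h3, h4⟩
    rw [hStage]
    exact ⟨hβ'V, fun t ht => ⟨outside_anti o (le_max_left _ _) (hT' t ht).1.1,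
      outside_anti o (le_max_left _ _) (hT' t ht).1.2⟩⟩
  have huniv : ∀ z : X, z ∈ outside o (μ 0) := fun z => by
    rw [hμ0, outside, mem_ofPred_eq]
    linarith [dist_nonneg (x := o) (y := z)]
  choose next hnext Φ hΦ hΦU h1 h2 h3 h4 using hstep
  let stage : ∀ i, {q : Σ T, Path (f T) (f' T) // Stage i q.1 q.2} := fun i => Nat.rec
    ⟨⟨0, arc (geo (f 0) (f' 0)) (continuous_const.geo continuous_const continuous_id) 0 1
      (geo_zero _ _) (geo_one _ _)⟩, by
      rw [hStage]
      exact ⟨fun _ => huniv _, fun _ _ => ⟨huniv _, huniv _⟩⟩⟩ next i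
  have key := properlyHomotopic_of_squares o (f := f) (f' := f') (T := fun i => (stage i).1.1)
    (Φ := fun i => Φ i (stage i)) rfl (fun i => hnext i _) (fun i => hΦ i _) (fun i => hΦU i _)
    (fun i => h1 i _) (fun i => h2 i _) fun i s => (h4 i _ s).trans (h3 (i + 1) _ s).symm
  simpa [hf, hf'] using key

end Main

/-- **Theorem 1 (Geoghegan).** A one-ended proper CAT(0) space `X` has semistable fundamental
group at infinity (any two proper rays in `X` are properly homotopic) if and only if any two
geodesic rays in `X` are properly homotopic. -/
theorem semistable_iff_geodesic_rays_properly_homotopic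
    {X : Type*} [MetricSpace X] [ProperSpace X]
    (hX : IsCAT0Space X) (hone : HasOneEnd X) :
    (∀ c c' : ProperRay X, ProperlyHomotopic c.toFun c'.toFun) ↔
      (∀ γ γ' : GeodesicRay X, ProperlyHomotopic γ.toFun γ'.toFun) := by
  have : Fact (IsCAT0Space X) := ⟨hX⟩
  exact ⟨fun h γ γ' => h γ.toProperRay γ'.toProperRay,
    fun h c c' => ProperRay.properlyHomotopic hone h c c'⟩
end

section
/- Let X be a one-ended proper CAT(0) metric space, let ∂X be its visual boundary, and let X̂ = X ∪ ∂X be the compactification of X by ∂X (a compact absolute retract in which ∂X is a Z-set). If two proper rays c, c' : [0,∞) → X both end at the same point p ∈ ∂X, then c and c' are properly homotopic. -/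
open Set Filter Topology
open scoped NNReal unitInterval

open Set Filter Topology

/-- A compact metrizable space `Y` is an absolute retract (AR) if every continuous map into
`Y` from a closed subset of a metric space extends continuously over the whole space. -/
def IsAR (Y : Type*) [TopologicalSpace Y] : Prop :=
  ∀ (Z : Type) (_ : MetricSpace Z) (A : Set Z), IsClosed A →
    ∀ f : C(A, Y), ∃ g : C(Z, Y), ∀ a : A, g (a : Z) = f a

/-- A closed subset `A` of a space `Y` is a Z-set if for every open `U ⊆ Y` the inclusion
`U ∖ A → U` is a homotopy equivalence. -/
def IsZSetIn {Y : Type*} [TopologicalSpace Y] (A : Set Y) : Prop :=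
  IsClosed A ∧ ∀ U : Set Y, IsOpen U →
    ∃ h : ContinuousMap.HomotopyEquiv (U \ A : Set Y) U,
      ∀ x : (U \ A : Set Y), (h.toFun x : Y) = (x : Y)

/-- An absolute retract extends maps that are continuous on a closed subset of a metrizable
space. -/
theorem IsAR.exists_extension {Y : Type*} [TopologicalSpace Y] (hY : IsAR Y)
    {Z : Type} [TopologicalSpace Z] [TopologicalSpace.MetrizableSpace Z]
    {C : Set Z} (hC : IsClosed C) {f : Z → Y} (hf : ContinuousOn f C) :
    ∃ g : C(Z, Y), EqOn g f C := by
  let := TopologicalSpace.metrizableSpaceMetric Z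
  obtain ⟨g, hg⟩ := hY Z inferInstance C hC ⟨C.domRestrict f, hf.domRestrict⟩
  exact ⟨g, fun z hz => hg ⟨z, hz⟩⟩

/-- The set of points whose whole fibre is mapped into an open set is open. -/
theorem isOpen_setOf_forall_unitInterval {Z Y : Type*} [TopologicalSpace Z] [TopologicalSpace Y]
    (E : C(Z × I, Y)) {U : Set Y} (hU : IsOpen U) : IsOpen {z | ∀ t, E (z, t) ∈ U} := by
  have h := isClosedMap_fst_of_compactSpace (X := Z) (Y := I) _
    (hU.preimage E.continuous).isClosed_compl
  rw [← isClosed_compl_iff]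
  convert h using 1
  ext z
  constructor
  · intro hz
    obtain ⟨t, ht⟩ := not_forall.1 hz
    exact ⟨(z, t), ht, rfl⟩
  · rintro ⟨⟨z, t⟩, ht, rfl⟩ hz
    exact ht (hz t)

/-- A continuous function to the unit interval separating a closed set from the complement of an
open neighbourhood. -/
theorem exists_unitInterval_urysohn {Z : Type*} [TopologicalSpace Z] [NormalSpace Z]
    {C N : Set Z} (hC : IsClosed C) (hN : IsOpen N) (hCN : C ⊆ N) :
    ∃ u : C(Z, I), (∀ z ∈ C, u z = 0) ∧ ∀ z ∉ N, u z = 1 := by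
  obtain ⟨u, h0, h1, hu⟩ := exists_continuous_zero_one_of_isClosed hC hN.isClosed_compl
    (disjoint_compl_right_iff_subset.2 hCN)
  exact ⟨⟨fun z => ⟨u z, hu z⟩, by fun_prop⟩, fun z hz => Subtype.ext (h0 hz),
    fun z hz => Subtype.ext (h1 hz)⟩

/-- A map into an open set `U` of an absolute retract can be pushed off a Z-set inside `U`,
without changing it on a closed set where it already misses the Z-set. -/
theorem IsZSetIn.exists_push_off {Y : Type*} [TopologicalSpace Y] (hY : IsAR Y) {A : Set Y}
    (hA : IsZSetIn A) {U : Set Y} (hU : IsOpen U)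
    {Z : Type} [TopologicalSpace Z] [TopologicalSpace.MetrizableSpace Z]
    {C : Set Z} (hC : IsClosed C) (F : C(Z, Y)) (hFU : ∀ z, F z ∈ U) (hFA : ∀ z ∈ C, F z ∉ A) :
    ∃ G : C(Z, Y), EqOn G F C ∧ ∀ z, G z ∈ U \ A := by
  obtain ⟨h, hh⟩ := hA.2 U hU
  obtain ⟨K⟩ := h.left_inv
  have hUA : IsOpen (U \ A) := hU.sdiff hA.1
  let F' : C(Z, U) := ⟨fun z => ⟨F z, hFU z⟩, by fun_prop⟩
  have hK0 : ∀ x : (U \ A : Set Y), K (0, x) = h.invFun ⟨x, x.2.1⟩ := fun x => by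
    rw [K.apply_zero]
    exact congrArg h.invFun (Subtype.ext (hh x))
  let ψ : Z × I → Y := fun q => open Classical in
    if hq : q.1 ∈ C then K (q.2, ⟨F q.1, hFU q.1, hFA q.1 hq⟩) else h.invFun (F' q.1)
  have hψ0 : ∀ z, ψ (z, 0) = h.invFun (F' z) := by
    intro z
    by_cases hz : z ∈ C
    · simp only [ψ, dif_pos hz, hK0]
      rfl
    · simp only [ψ, dif_neg hz]
  have hψC : ∀ z (hz : z ∈ C) t, ψ (z, t) = K (t, ⟨F z, hFU z, hFA z hz⟩) := fun z hz t => by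
    simp only [ψ, dif_pos hz]
  have hψ : ContinuousOn ψ (univ ×ˢ {0} ∪ C ×ˢ univ) := by
    refine ContinuousOn.union_of_isClosed ?_ ?_ (isClosed_univ.prod isClosed_singleton)
      (hC.prod isClosed_univ)
    · refine ContinuousOn.congr (f := fun q : Z × I => (h.invFun (F' q.1) : Y))
        (by fun_prop) ?_
      rintro ⟨z, t⟩ ⟨-, rfl⟩
      exact hψ0 z
    · rw [continuousOn_iff_continuous_domRestrict]
      have : (C ×ˢ (univ : Set I)).domRestrict ψ = fun q : (C ×ˢ (univ : Set I) : Set (Z × I)) =>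
          (K (q.1.2, ⟨F q.1.1, hFU q.1.1, hFA q.1.1 q.2.1⟩) : Y) :=
        funext fun q => hψC q.1.1 q.2.1 q.1.2
      rw [this]
      fun_prop
  obtain ⟨E, hE⟩ := hY.exists_extension
    ((isClosed_univ.prod isClosed_singleton).union (hC.prod isClosed_univ)) hψ
  have hE0 : ∀ z, E (z, 0) = h.invFun (F' z) := fun z =>
    (hE (Or.inl ⟨mem_univ _, mem_singleton _⟩)).trans (hψ0 z)
  have hEC : ∀ z (hz : z ∈ C) t, E (z, t) = K (t, ⟨F z, hFU z, hFA z hz⟩) := fun z hz t =>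
    (hE (Or.inr ⟨hz, mem_univ _⟩)).trans (hψC z hz t)
  obtain ⟨u, hu0, hu1⟩ := exists_unitInterval_urysohn hC
    (isOpen_setOf_forall_unitInterval E hUA) (fun z hz t => by
      rw [hEC z hz]
      exact Subtype.coe_prop _)
  refine ⟨⟨fun z => E (z, σ (u z)), by fun_prop⟩, fun z hz => ?_, fun z => ?_⟩
  · simp [hu0 z hz, hEC z hz]
  · by_cases hz : ∀ t, E (z, t) ∈ U \ A
    · exact hz _
    · simp only [ContinuousMap.coe_mk, hu1 z hz, unitInterval.symm_one, hE0]
      exact Subtype.coe_prop _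

/-- A metrizable absolute retract contracts to any of its points, keeping that point fixed. -/
theorem IsAR.exists_contraction {Y : Type} [TopologicalSpace Y]
    [TopologicalSpace.MetrizableSpace Y] (hY : IsAR Y) (p : Y) :
    ∃ H : C(Y × I, Y), (∀ y, H (y, 0) = y) ∧ (∀ y, H (y, 1) = p) ∧ ∀ t, H (p, t) = p := by
  have h0 : IsClosed (univ ×ˢ {0} : Set (Y × I)) := isClosed_univ.prod isClosed_singleton
  have h1 : IsClosed (univ ×ˢ {1} ∪ {p} ×ˢ univ : Set (Y × I)) :=
    (isClosed_univ.prod isClosed_singleton).union (isClosed_singleton.prod isClosed_univ)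
  let f : Y × I → Y := fun q => open Classical in if q.2 = 0 then q.1 else p
  have hf : ContinuousOn f (univ ×ˢ {0} ∪ (univ ×ˢ {1} ∪ {p} ×ˢ univ)) := by
    refine ContinuousOn.union_of_isClosed ?_ ?_ h0 h1
    · refine ContinuousOn.congr (f := Prod.fst) (by fun_prop) ?_
      rintro ⟨y, t⟩ ⟨-, rfl⟩
      simp [f]
    · refine ContinuousOn.congr (f := fun _ => p) (by fun_prop) ?_
      rintro ⟨y, t⟩ (⟨-, rfl⟩ | ⟨rfl, -⟩) <;> simp [f]
  obtain ⟨H, hH⟩ := hY.exists_extension (h0.union h1) hf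
  refine ⟨H, fun y => ?_, fun y => ?_, fun t => ?_⟩
  · rw [hH (Or.inl ⟨mem_univ _, mem_singleton _⟩)]
    simp [f]
  · rw [hH (Or.inr (Or.inl ⟨mem_univ _, mem_singleton _⟩))]
    simp [f]
  · rw [hH (Or.inr (Or.inr ⟨mem_singleton _, mem_univ _⟩))]
    simp [f]

/-- Near a point `p` of a Z-set `A` in a metrizable absolute retract, maps defined on a closed
subset extend in the complement of `A` with control on the size of the extension. -/
theorem IsZSetIn.exists_controlled_extension {Y : Type} [TopologicalSpace Y]
    [TopologicalSpace.MetrizableSpace Y] (hY : IsAR Y) {A : Set Y} (hA : IsZSetIn A) (p : Y) :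
    ∃ V : Set Y → Set Y, V univ = univ ∧ ∀ U, IsOpen U → p ∈ U → V U ∈ 𝓝 p ∧
      ∀ (Z : Type) [TopologicalSpace Z] [TopologicalSpace.MetrizableSpace Z] (C : Set Z)
        (φ : Z → Y), IsClosed C → ContinuousOn φ C → MapsTo φ C (V U \ A) →
        ∃ G : C(Z, Y), EqOn G φ C ∧ ∀ z, G z ∈ U \ A := by
  obtain ⟨H, hH0, hH1, hHp⟩ := hY.exists_contraction p
  refine ⟨fun U => {y | ∀ t, H (y, t) ∈ U}, by simp, fun U hU hp => ?_⟩
  have hV := isOpen_setOf_forall_unitInterval H hU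
  refine ⟨hV.mem_nhds fun t => (hHp t).symm ▸ hp, fun Z _ _ C φ hC hφ hφV => ?_⟩
  obtain ⟨e, he⟩ := hY.exists_extension hC hφ
  obtain ⟨u, hu0, hu1⟩ := exists_unitInterval_urysohn hC (hV.preimage e.continuous)
    (fun z hz => by
      rw [mem_preimage, he hz]
      exact (hφV hz).1)
  have hF : ∀ z ∈ C, H (e z, u z) = φ z := fun z hz => by rw [hu0 z hz, hH0, he hz]
  obtain ⟨G, hG, hGU⟩ := hA.exists_push_off hY hU hC ⟨fun z => H (e z, u z), by fun_prop⟩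
    (fun z => by
      by_cases hz : ∀ t, H (e z, t) ∈ U
      · exact hz _
      · simpa [hu1 z hz, hH1] using hp)
    (fun z hz => by
      rw [ContinuousMap.coe_mk, hF z hz]
      exact (hφV hz).2)
  exact ⟨G, fun z hz => (hG hz).trans (hF z hz), hGU⟩

/-- Choosing a sequence of solutions which shrink to a point, when arbitrarily small solutions
eventually exist. -/
theorem exists_seq_eventually_forall_mem {β ι Y : Type*} [TopologicalSpace Y]
    [FirstCountableTopology Y] (p : Y) (P : ℕ → β → Prop) (S : β → ι → Y)
    (hP : ∀ k, ∃ b, P k b)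
    (hS : ∀ U, IsOpen U → p ∈ U → ∀ᶠ k in atTop, ∃ b, P k b ∧ ∀ i, S b i ∈ U) :
    ∃ b : ℕ → β, (∀ k, P k (b k)) ∧ ∀ U ∈ 𝓝 p, ∀ᶠ k in atTop, ∀ i, S (b k) i ∈ U := by
  classical
  obtain ⟨U, hU⟩ := (𝓝 p).exists_antitone_basis
  let Q : ℕ → ℕ → Prop := fun k n => ∃ b, P k b ∧ ∀ i, S b i ∈ U n
  have key : ∀ k, ∃ b, P k b ∧ ∀ n ≤ k, Q k n → ∀ i, S b i ∈ U n := by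
    intro k
    by_cases h : ∃ n ≤ k, Q k n
    · obtain ⟨n, hn, hQ⟩ := h
      obtain ⟨b, hb, hbU⟩ := Nat.findGreatest_spec hn hQ
      exact ⟨b, hb, fun m hm hQm i => hU.antitone (Nat.le_findGreatest hm hQm) (hbU i)⟩
    · obtain ⟨b, hb⟩ := hP k
      exact ⟨b, hb, fun n hn hQ => (h ⟨n, hn, hQ⟩).elim⟩
  choose b hb hbU using key
  refine ⟨b, hb, fun W hW => ?_⟩
  obtain ⟨n, hn⟩ := hU.mem_iff.1 hW
  obtain ⟨O, hOU, hO, hpO⟩ := mem_nhds_iff.1 (hU.mem n)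
  filter_upwards [hS O hO hpO, eventually_ge_atTop n] with k ⟨b', hb', hbO⟩ hk i
  exact hn (hbU k n hk ⟨b', hb', fun i => hOU (hbO i)⟩ i)

/-- Four paths agreeing at the corners give a continuous map on the boundary of the square. -/
theorem exists_continuousOn_square_boundary {Y : Type*} [TopologicalSpace Y] (l r d t : C(I, Y))
    (hld : l 0 = d 0) (hlt : l 1 = t 0) (hrd : r 0 = d 1) (hrt : r 1 = t 1) :
    ∃ φ : I × I → Y,
      ContinuousOn φ ((({0} ×ˢ univ) ∪ ({1} ×ˢ univ)) ∪ ((univ ×ˢ {0}) ∪ (univ ×ˢ {1}))) ∧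
      (∀ s, φ (0, s) = l s) ∧ (∀ s, φ (1, s) = r s) ∧ (∀ u, φ (u, 0) = d u) ∧
      ∀ u, φ (u, 1) = t u := by
  classical
  let φ : I × I → Y := fun q =>
    if q.1 = 0 then l q.2 else if q.1 = 1 then r q.2 else if q.2 = 0 then d q.1 else t q.1
  have hl : ∀ s, φ (0, s) = l s := fun s => by simp [φ]
  have hr : ∀ s, φ (1, s) = r s := fun s => by simp [φ]
  have hd : ∀ u, φ (u, 0) = d u := fun u => by
    by_cases h0 : u = 0
    · simp [φ, h0, hld]
    · by_cases h1 : u = 1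
      · simp [φ, h1, hrd]
      · simp [φ, h0, h1]
  have ht : ∀ u, φ (u, 1) = t u := fun u => by
    by_cases h0 : u = 0
    · simp [φ, h0, hlt]
    · by_cases h1 : u = 1
      · simp [φ, h1, hrt]
      · simp [φ, h0, h1]
  have c1 : ∀ a : I, IsClosed ({a} ×ˢ univ : Set (I × I)) := fun a =>
    isClosed_singleton.prod isClosed_univ
  have c2 : ∀ a : I, IsClosed (univ ×ˢ {a} : Set (I × I)) := fun a =>
    isClosed_univ.prod isClosed_singleton
  refine ⟨φ, ?_, hl, hr, hd, ht⟩
  refine ContinuousOn.union_of_isClosed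
    (ContinuousOn.union_of_isClosed ?_ ?_ (c1 0) (c1 1))
    (ContinuousOn.union_of_isClosed ?_ ?_ (c2 0) (c2 1))
    ((c1 0).union (c1 1)) ((c2 0).union (c2 1))
  · refine ContinuousOn.congr (f := fun q => l q.2) (by fun_prop) ?_
    rintro ⟨u, s⟩ ⟨rfl, -⟩
    exact hl s
  · refine ContinuousOn.congr (f := fun q => r q.2) (by fun_prop) ?_
    rintro ⟨u, s⟩ ⟨rfl, -⟩
    exact hr s
  · refine ContinuousOn.congr (f := fun q => d q.1) (by fun_prop) ?_
    rintro ⟨u, s⟩ ⟨-, rfl⟩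
    exact hd u
  · refine ContinuousOn.congr (f := fun q => t q.1) (by fun_prop) ?_
    rintro ⟨u, s⟩ ⟨-, rfl⟩
    exact ht u

/-- Squares matching along consecutive vertical sides glue to a map on the half-infinite
strip. -/
theorem exists_continuous_strip_of_squares {Y : Type*} [TopologicalSpace Y]
    (G : ℕ → C(I × I, Y)) (hG : ∀ k s, G k (1, s) = G (k + 1) (0, s)) :
    ∃ F : C(ℝ≥0 × I, Y), ∀ (k : ℕ) (u s : I),
      F (k + unitInterval.toNNReal u, s) = G k (u, s) := by
  let g : ℕ → ℝ≥0 × I → Y := fun k q =>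
    G k (projIcc (0 : ℝ) 1 zero_le_one ((q.1 : ℝ) - k), q.2)
  have hgc : ∀ k, Continuous (g k) := fun k => by
    have := continuous_projIcc (a := (0 : ℝ)) (b := 1) (h := zero_le_one)
    fun_prop
  let F : ℝ≥0 × I → Y := fun q => g ⌊q.1⌋₊ q
  have hF : ∀ (k : ℕ) (q : ℝ≥0 × I), q.1 ∈ Icc (k : ℝ≥0) (k + 1) → F q = g k q := by
    rintro k ⟨t, s⟩ ⟨h1, h2⟩
    rcases h2.lt_or_eq with h2 | h2
    · have : ⌊t⌋₊ = k := (Nat.floor_eq_iff zero_le).2 ⟨h1, h2⟩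
      simp only [F, this]
    · simp only at h2
      have : ⌊t⌋₊ = k + 1 := by
        rw [h2]
        exact_mod_cast Nat.floor_natCast (R := ℝ≥0) (k + 1)
      have e1 : projIcc (0 : ℝ) 1 zero_le_one (((k + 1 : ℝ≥0) : ℝ) - k) = 1 :=
        projIcc_of_right_le _ (by simp)
      have e2 : projIcc (0 : ℝ) 1 zero_le_one (((k + 1 : ℝ≥0) : ℝ) - (k + 1 : ℕ)) = 0 :=
        projIcc_of_le_left _ (by simp)
      simp only [F, this, g]
      rw [h2, e1, e2, hG]
  have hloc : LocallyFinite fun k : ℕ => (Prod.fst ⁻¹' Icc (k : ℝ≥0) (k + 1) :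
      Set (ℝ≥0 × I)) := by
    rintro ⟨t, s⟩
    refine ⟨Prod.fst ⁻¹' Iio (t + 1), (isOpen_Iio.preimage continuous_fst).mem_nhds (by simp), ?_⟩
    refine (finite_le_nat ⌈t + 1⌉₊).subset ?_
    rintro k ⟨⟨t', s'⟩, ⟨h1, -⟩, h2⟩
    have : (k : ℝ≥0) ≤ ⌈t + 1⌉₊ := (h1.trans (le_of_lt h2)).trans (Nat.le_ceil _)
    exact_mod_cast this
  refine ⟨⟨F, hloc.continuous ?_ (fun k => ?_) fun k => ?_⟩, fun k u s => ?_⟩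
  · refine eq_univ_of_forall fun q => mem_iUnion.2 ⟨⌊q.1⌋₊, Nat.floor_le zero_le, ?_⟩
    exact (Nat.lt_floor_add_one q.1).le
  · exact isClosed_Icc.preimage continuous_fst
  · exact (hgc k).continuousOn.congr fun q hq => hF k q hq
  · have hu : unitInterval.toNNReal u ≤ 1 := u.2.2
    rw [ContinuousMap.coe_mk, hF k _ ⟨by simp, by simpa using hu⟩]
    simp only [g]
    congr 2
    simp

/-- **Lemma 2.** Let `X` be a one-ended proper CAT(0) space and `X̂ = X ∪ ∂X` its
compactification by the visual boundary (a compact absolute retract in which `∂X` is a Z-set).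
If two proper rays in `X` end at the same point `p ∈ ∂X`, then they are properly homotopic. -/
theorem properlyHomotopic_of_endsAt_same_boundary_point
    {X : Type*} [MetricSpace X] [ProperSpace X]
    (hX : IsCAT0Space X) (hone : HasOneEnd X)
    (B : BoundaryCompactification X) (hAR : IsAR B.carrier) (hZ : IsZSetIn B.boundary)
    (c c' : ProperRay X) (p : B.carrier)
    (hc : B.EndsAt c.toFun p) (hc' : B.EndsAt c'.toFun p) :
    ProperlyHomotopic c.toFun c'.toFun := by
  have := B.metrizable
  obtain ⟨V, hVuniv, hV⟩ := hZ.exists_controlled_extension hAR p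
  have hmem : ∀ x, B.incl x ∉ B.boundary := fun x h => h ⟨x, rfl⟩
  have hnat : Tendsto (fun k : ℕ => (k : ℝ≥0)) atTop atTop := tendsto_natCast_atTop_atTop
  have hic := B.isEmbedding.continuous
  have hcc := c.continuous_toFun
  have hcc' := c'.continuous_toFun
  have hpath : ∀ U, IsOpen U → p ∈ U → ∀ k : ℕ, B.incl (c.toFun k) ∈ V U →
      B.incl (c'.toFun k) ∈ V U → ∃ α : C(I, B.carrier), (α 0 = B.incl (c.toFun k) ∧
        α 1 = B.incl (c'.toFun k) ∧ ∀ s, α s ∉ B.boundary) ∧ ∀ s, α s ∈ U := by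
    classical
    intro U hU hp k h0 h1
    obtain ⟨α, hα, hαU⟩ := (hV U hU hp).2 I {0, 1}
      (fun s => if s = 0 then B.incl (c.toFun k) else B.incl (c'.toFun k))
      ((finite_singleton _).insert _).isClosed (((finite_singleton _).insert _).continuousOn _)
      (by
        rintro s (rfl | rfl)
        · simpa using ⟨h0, hmem _⟩
        · simpa using ⟨h1, hmem _⟩)
    refine ⟨α, ⟨?_, ?_, fun s => (hαU s).2⟩, fun s => (hαU s).1⟩
    · rw [hα (by simp)]
      simp
    · rw [hα (by simp)]
      simp
  obtain ⟨α, hα, hαp⟩ := exists_seq_eventually_forall_mem p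
    (fun (k : ℕ) (α : C(I, B.carrier)) => α 0 = B.incl (c.toFun k) ∧
      α 1 = B.incl (c'.toFun k) ∧ ∀ s, α s ∉ B.boundary) (fun α s => α s)
    (fun k => by
      obtain ⟨α, hα, -⟩ := hpath univ isOpen_univ (mem_univ _) k (by simp [hVuniv])
        (by simp [hVuniv])
      exact ⟨α, hα⟩)
    (fun U hU hp => by
      filter_upwards [(hc.2.comp hnat).eventually (hV U hU hp).1,
        (hc'.2.comp hnat).eventually (hV U hU hp).1] with k h0 h1
      exact hpath U hU hp k h0 h1)
  let edge : ℕ → (ℝ≥0 → X) → I → B.carrier := fun k r u => B.incl (r (k + unitInterval.toNNReal u))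
  have hedge : ∀ k r, Continuous r → Continuous (edge k r) := fun k r hr => by
    fun_prop
  have hedge0 : ∀ k r, edge k r 0 = B.incl (r k) := fun k r => by
    simp [edge]
  have hedge1 : ∀ k r, edge k r 1 = B.incl (r (k + 1 : ℕ)) := fun k r => by
    simp [edge]
  have hsquare : ∀ U, IsOpen U → p ∈ U → ∀ k : ℕ, (∀ s, α k s ∈ V U) →
      (∀ s, α (k + 1) s ∈ V U) → (∀ u, edge k c.toFun u ∈ V U) →
      (∀ u, edge k c'.toFun u ∈ V U) → ∃ G : C(I × I, B.carrier),
        ((∀ s, G (0, s) = α k s) ∧ (∀ s, G (1, s) = α (k + 1) s) ∧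
          (∀ u, G (u, 0) = edge k c.toFun u) ∧ (∀ u, G (u, 1) = edge k c'.toFun u) ∧
          ∀ q, G q ∉ B.boundary) ∧ ∀ q, G q ∈ U := by
    intro U hU hp k h1 h2 h3 h4
    obtain ⟨φ, hφ, hl, hr, hd, ht⟩ := exists_continuousOn_square_boundary (α k) (α (k + 1))
      ⟨edge k c.toFun, hedge _ _ hcc⟩ ⟨edge k c'.toFun, hedge _ _ hcc'⟩
      ((hα k).1.trans (hedge0 _ _).symm) ((hα k).2.1.trans (hedge0 _ _).symm)
      ((hα (k + 1)).1.trans (hedge1 _ _).symm) ((hα (k + 1)).2.1.trans (hedge1 _ _).symm)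
    obtain ⟨G, hG, hGU⟩ := (hV U hU hp).2 (I × I) _ φ
      (((isClosed_singleton.prod isClosed_univ).union
        (isClosed_singleton.prod isClosed_univ)).union
        ((isClosed_univ.prod isClosed_singleton).union
        (isClosed_univ.prod isClosed_singleton))) hφ
      (by
        rintro ⟨u, s⟩ ((⟨rfl, -⟩ | ⟨rfl, -⟩) | (⟨-, rfl⟩ | ⟨-, rfl⟩))
        · exact hl s ▸ ⟨h1 s, (hα k).2.2 s⟩
        · exact hr s ▸ ⟨h2 s, (hα (k + 1)).2.2 s⟩
        · exact hd u ▸ ⟨h3 u, hmem _⟩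
        · exact ht u ▸ ⟨h4 u, hmem _⟩)
    refine ⟨G, ⟨fun s => ?_, fun s => ?_, fun u => ?_, fun u => ?_, fun q => (hGU q).2⟩,
      fun q => (hGU q).1⟩
    · rw [hG (by simp), hl]
    · rw [hG (by simp), hr]
    · rw [hG (by simp), hd, ContinuousMap.coe_mk]
    · rw [hG (by simp), ht, ContinuousMap.coe_mk]
  have hedgep : ∀ r : ℝ≥0 → X, Tendsto (B.incl ∘ r) atTop (𝓝 p) → ∀ W ∈ 𝓝 p,
      ∀ᶠ k : ℕ in atTop, ∀ u, edge k r u ∈ W := fun r hr W hW => by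
    obtain ⟨T, hT⟩ := eventually_atTop.1 (hr.eventually hW)
    filter_upwards [hnat.eventually_ge_atTop T] with k hk u
    exact hT _ (hk.trans le_self_add)
  obtain ⟨G, hG, hGp⟩ := exists_seq_eventually_forall_mem p
    (fun (k : ℕ) (G : C(I × I, B.carrier)) => (∀ s, G (0, s) = α k s) ∧
      (∀ s, G (1, s) = α (k + 1) s) ∧ (∀ u, G (u, 0) = edge k c.toFun u) ∧
      (∀ u, G (u, 1) = edge k c'.toFun u) ∧ ∀ q, G q ∉ B.boundary) (fun G q => G q)
    (fun k => by
      obtain ⟨G, hG, -⟩ := hsquare univ isOpen_univ (mem_univ _) k (by simp [hVuniv])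
        (by simp [hVuniv]) (by simp [hVuniv]) (by simp [hVuniv])
      exact ⟨G, hG⟩)
    (fun U hU hp => by
      have hVU := (hV U hU hp).1
      filter_upwards [hαp _ hVU, (tendsto_add_atTop_nat 1).eventually (hαp _ hVU),
        hedgep _ hc.2 _ hVU, hedgep _ hc'.2 _ hVU] with k h1 h2 h3 h4
      exact hsquare U hU hp k h1 h2 h3 h4)
  obtain ⟨F, hF⟩ := exists_continuous_strip_of_squares G
    (fun k s => ((hG k).2.1 s).trans ((hG (k + 1)).1 s).symm)
  have hdecomp : ∀ t : ℝ≥0, ∃ u : I, t = (⌊t⌋₊ : ℝ≥0) + unitInterval.toNNReal u := fun t => by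
    have h1 : (⌊t⌋₊ : ℝ≥0) ≤ t := Nat.floor_le zero_le
    have h2 : t ≤ (⌊t⌋₊ : ℝ≥0) + 1 := (Nat.lt_floor_add_one t).le
    have h1' : ((⌊t⌋₊ : ℝ≥0) : ℝ) ≤ t := by exact_mod_cast h1
    have h2' : (t : ℝ) ≤ ((⌊t⌋₊ : ℝ≥0) : ℝ) + 1 := by exact_mod_cast h2
    refine ⟨⟨(t : ℝ) - (⌊t⌋₊ : ℝ≥0), by linarith, by linarith⟩, ?_⟩
    apply NNReal.eq
    simp
  have hFrange : ∀ q, ∃ x, B.incl x = F q := by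
    rintro ⟨t, s⟩
    obtain ⟨u, hu⟩ := hdecomp t
    rw [hu, hF]
    exact not_not.1 ((hG _).2.2.2.2 (u, s))
  choose H hH using hFrange
  have hHc : Continuous H := by
    rw [B.isEmbedding.continuous_iff]
    exact F.continuous.congr fun q => (hH q).symm
  refine ⟨H, hHc, fun K hK => ?_, fun t => ?_, fun t => ?_⟩
  · have hpK : (B.incl '' K)ᶜ ∈ 𝓝 p := by
      refine (hK.image hic).isClosed.isOpen_compl.mem_nhds ?_
      rintro ⟨x, -, rfl⟩
      exact hmem x hc.1
    obtain ⟨N, hN⟩ := eventually_atTop.1 (hGp _ hpK)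
    refine (isCompact_Icc.prod isCompact_univ).of_isClosed_subset (hK.isClosed.preimage hHc)
      (s := Icc (0 : ℝ≥0) N ×ˢ (univ : Set I)) ?_
    rintro ⟨t, s⟩ hts
    refine ⟨⟨zero_le, ?_⟩, mem_univ _⟩
    by_contra! hlt
    obtain ⟨u, hu⟩ := hdecomp t
    refine hN ⌊t⌋₊ (Nat.le_floor hlt.le) (u, s) ⟨H (t, s), hts, ?_⟩
    rw [hH, ← hF, ← hu]
  · obtain ⟨u, hu⟩ := hdecomp t
    apply B.isEmbedding.injective
    rw [hH, hu, hF, (hG _).2.2.1]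
  · obtain ⟨u, hu⟩ := hdecomp t
    apply B.isEmbedding.injective
    rw [hH, hu, hF, (hG _).2.2.2.1]
end
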